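/- arXiv:1912.09071 — 5 statements merged into one kernel-verified Lean document; each statement's English description precedes it below -/
import Mathlib

section
/- Let N ≥ 3, α ∈ [0,2), β > 0, b, c ∈ ℝ, λ ∈ ℝ, and set c₀ = ((N−2)/2)². For every u ∈ C_c^∞(ℝ^N \ {0}; ℂ) one has Re 𝔞(u,u) ≥ ∫_{ℝ^N} |x|^α |∇u|² dx + (1/2)∫_{ℝ^N} |∇u|² dx + ∫_{ℝ^N} [ c₀/(2|x|²) + (c − 1 − ((α−b)/2)(α−2+N)) |x|^{α−2} + λ ] |u|² dx + ∫_{ℝ^N} |x|^{α−2} |u|² dx + ∫_{ℝ^N} |x|^β |u|² dx. -/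
open MeasureTheory Real

noncomputable section

/-- The `i`-th partial derivative of a complex-valued function on `ℝ^N`. -/
def pdC {N : ℕ} (i : Fin N) (f : EuclideanSpace ℝ (Fin N) → ℂ)
    (x : EuclideanSpace ℝ (Fin N)) : ℂ :=
  fderiv ℝ f x (EuclideanSpace.single i 1)

/-- Smooth compactly supported functions whose support avoids the origin. -/
def IsTestAway0 {N : ℕ} (u : EuclideanSpace ℝ (Fin N) → ℂ) : Prop :=
  ContDiff ℝ (⊤ : ℕ∞) u ∧ HasCompactSupport u ∧ (0 : EuclideanSpace ℝ (Fin N)) ∉ tsupport u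

/-- The quadratic form `𝔞(u,u)` associated with the operator `A_{b,c}`, with shift `l`. -/
def formA {N : ℕ} (α β b c l : ℝ) (u : EuclideanSpace ℝ (Fin N) → ℂ) : ℂ :=
  ∫ x, (((1 + ‖x‖ ^ α : ℝ) : ℂ) * ((∑ i, ‖pdC i u x‖ ^ 2 : ℝ) : ℂ)
    + (((α - b) * ‖x‖ ^ (α - 2) : ℝ) : ℂ) *
        ((∑ i, (x i : ℂ) * pdC i u x) * (starRingEnd ℂ) (u x))
    + ((c * ‖x‖ ^ (α - 2) + ‖x‖ ^ β + l : ℝ) : ℂ) * ((‖u x‖ ^ 2 : ℝ) : ℂ))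

theorem sum_coord_mul_apply_single {N : ℕ} (L : EuclideanSpace ℝ (Fin N) →L[ℝ] ℝ)
    (x : EuclideanSpace ℝ (Fin N)) :
    ∑ i, x i * L (EuclideanSpace.single i 1) = L x := by
  have h := (EuclideanSpace.basisFun (Fin N) ℝ).sum_repr x
  conv_rhs => rw [← h]
  simp [map_sum]

theorem sum_coord_mul_pdC {N : ℕ} (u : EuclideanSpace ℝ (Fin N) → ℂ)
    (x : EuclideanSpace ℝ (Fin N)) :
    ∑ i, (x i : ℂ) * pdC i u x = fderiv ℝ u x x := by
  have h := (EuclideanSpace.basisFun (Fin N) ℝ).sum_repr x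
  conv_rhs => arg 2; rw [← h]
  rw [map_sum]
  simp [pdC]

/-- The divergence theorem for the Euler vector field. -/
theorem integral_fderiv_apply_self {N : ℕ} {h : EuclideanSpace ℝ (Fin N) → ℝ}
    (hh : ContDiff ℝ 1 h) (hc : HasCompactSupport h) :
    ∫ x, fderiv ℝ h x x = -(N : ℝ) * ∫ x, h x := by
  have hcont := hh.continuous
  have hdc : Continuous (fderiv ℝ h) := hh.continuous_fderiv one_ne_zero
  have hdiff : Differentiable ℝ h := hh.differentiable one_ne_zero
  have hi : Integrable h := hcont.integrable_of_hasCompactSupport hc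
  have hpi : ∀ i : Fin N, Integrable
      (fun x : EuclideanSpace ℝ (Fin N) ↦ x i * fderiv ℝ h x (EuclideanSpace.single i 1)) := by
    intro i
    refine Continuous.integrable_of_hasCompactSupport (by fun_prop) ?_
    exact (hc.fderiv_apply ℝ (EuclideanSpace.single i 1)).mul_left
  have key : ∀ i : Fin N,
      ∫ x, x i * fderiv ℝ h x (EuclideanSpace.single i 1) = -∫ x, h x := by
    intro i
    have h1 : ∀ x : EuclideanSpace ℝ (Fin N),
        fderiv ℝ (fun y : EuclideanSpace ℝ (Fin N) ↦ y i) x (EuclideanSpace.single i 1) = 1 := by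
      intro x
      have : HasFDerivAt (fun y : EuclideanSpace ℝ (Fin N) ↦ y i)
        (EuclideanSpace.proj i : EuclideanSpace ℝ (Fin N) →L[ℝ] ℝ) x :=
        (EuclideanSpace.proj i : EuclideanSpace ℝ (Fin N) →L[ℝ] ℝ).hasFDerivAt
      rw [this.fderiv]
      simp
    have h2 := integral_mul_fderiv_eq_neg_fderiv_mul_of_integrable
      (μ := (volume : Measure (EuclideanSpace ℝ (Fin N))))
      (f := fun y : EuclideanSpace ℝ (Fin N) ↦ y i) (g := h)
      (v := EuclideanSpace.single i 1) (by simpa only [h1, one_mul] using hi) (hpi i)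
      ((Continuous.integrable_of_hasCompactSupport (by fun_prop) hc.mul_left))
      (by fun_prop) (by fun_prop)
    simpa only [h1, one_mul] using h2
  rw [← integral_congr_ae (.of_forall fun x ↦ sum_coord_mul_apply_single (fderiv ℝ h x) x),
    integral_finsetSum _ (fun i _ ↦ hpi i)]
  simp [key]

theorem integral_rpow_norm_mul_fderiv_apply_self {N : ℕ} {g : EuclideanSpace ℝ (Fin N) → ℝ}
    (hg : ContDiff ℝ 1 g) (hc : HasCompactSupport g) (h0 : 0 ∉ tsupport g) (s : ℝ)
    (hi₁ : Integrable (fun x ↦ ‖x‖ ^ s * g x))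
    (hi₂ : Integrable (fun x ↦ ‖x‖ ^ s * fderiv ℝ g x x)) :
    ∫ x, ‖x‖ ^ s * fderiv ℝ g x x = -(s + N) * ∫ x, ‖x‖ ^ s * g x := by
  have hdiff : Differentiable ℝ g := hg.differentiable one_ne_zero
  have hsm : ContDiff ℝ 1 (fun x : EuclideanSpace ℝ (Fin N) ↦ ‖x‖ ^ s * g x) := by
    rw [contDiff_iff_contDiffAt]
    intro x
    by_cases hx : x = 0
    · subst hx
      have hz : (fun x : EuclideanSpace ℝ (Fin N) ↦ ‖x‖ ^ s * g x) =ᶠ[nhds 0] fun _ ↦ 0 := by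
        filter_upwards [notMem_tsupport_iff_eventuallyEq.mp h0] with y hy
        simp [hy]
      exact contDiffAt_const.congr_of_eventuallyEq hz
    · exact ((contDiffAt_norm ℝ hx).rpow_const_of_ne (norm_ne_zero_iff.mpr hx)).mul
        hg.contDiffAt
  have hd : ∀ x : EuclideanSpace ℝ (Fin N),
      fderiv ℝ (fun x : EuclideanSpace ℝ (Fin N) ↦ ‖x‖ ^ s * g x) x x
        = s * (‖x‖ ^ s * g x) + ‖x‖ ^ s * fderiv ℝ g x x := by
    intro x
    by_cases hx : x = 0
    · subst hx
      simp [image_eq_zero_of_notMem_tsupport h0]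
    · have hn : ‖x‖ ≠ 0 := norm_ne_zero_iff.mpr hx
      have hnd : DifferentiableAt ℝ (fun y : EuclideanSpace ℝ (Fin N) ↦ ‖y‖) x :=
        (contDiffAt_norm ℝ hx (n := 1)).differentiableAt one_ne_zero
      have hnx : fderiv ℝ (fun y : EuclideanSpace ℝ (Fin N) ↦ ‖y‖) x x = ‖x‖ :=
        hnd.fderiv_norm_self
      have hf : HasFDerivAt (fun x : EuclideanSpace ℝ (Fin N) ↦ ‖x‖ ^ s * g x) _ x :=
        (hnd.hasFDerivAt.rpow_const (Or.inl hn)).mul (hdiff x).hasFDerivAt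
      rw [hf.fderiv]
      simp only [add_apply, smul_apply, smul_eq_mul, hnx]
      rw [Real.rpow_sub_one hn]
      field_simp
      ring
  have := integral_fderiv_apply_self hsm hc.mul_left
  simp_rw [hd] at this
  rw [integral_add (hi₁.const_mul s) hi₂, integral_const_mul] at this
  linarith

theorem integrable_mul_of_support_subset {N : ℕ} {w : EuclideanSpace ℝ (Fin N) → ℝ}
    {φ : EuclideanSpace ℝ (Fin N) → ℝ} {K : Set (EuclideanSpace ℝ (Fin N))}
    (hw : ContinuousOn w {0}ᶜ) (hφ : Continuous φ) (hK : IsCompact K) (h0 : 0 ∉ K)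
    (hs : ∀ x ∉ K, φ x = 0) : Integrable (fun x ↦ w x * φ x) := by
  have hsub : K ⊆ {0}ᶜ := fun x hx h ↦ h0 (h ▸ hx)
  refine (integrableOn_iff_integrable_of_support_subset (s := K) ?_).mp
    (((hw.mono hsub).mul hφ.continuousOn).integrableOn_compact hK)
  intro x hx
  by_contra h
  simp [hs x h] at hx

theorem continuousOn_rpow_norm {N : ℕ} (s : ℝ) :
    ContinuousOn (fun x : EuclideanSpace ℝ (Fin N) ↦ ‖x‖ ^ s) {0}ᶜ :=
  continuous_norm.continuousOn.rpow_const fun _ hx ↦ Or.inl (norm_ne_zero_iff.mpr hx)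

theorem fderiv_norm_sq_comp_apply {N : ℕ} {u : EuclideanSpace ℝ (Fin N) → ℂ}
    {x : EuclideanSpace ℝ (Fin N)} (hu : DifferentiableAt ℝ u x) (v : EuclideanSpace ℝ (Fin N)) :
    fderiv ℝ (fun y ↦ ‖u y‖ ^ 2) x v
      = 2 * (fderiv ℝ u x v * (starRingEnd ℂ) (u x)).re := by
  rw [hu.hasFDerivAt.norm_sq.fderiv]
  simp [Complex.inner, mul_add]

theorem normSq_add_ofReal_mul (a z : ℂ) (t : ℝ) :
    ‖a + t * z‖ ^ 2 = ‖a‖ ^ 2 + 2 * t * (a * (starRingEnd ℂ) z).re + t ^ 2 * ‖z‖ ^ 2 := by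
  simp only [Complex.sq_norm, Complex.normSq_apply, Complex.add_re, Complex.add_im,
    Complex.mul_re, Complex.mul_im, Complex.ofReal_re, Complex.ofReal_im, Complex.conj_re,
    Complex.conj_im]
  ring

/-- The completed square behind Hardy's inequality. -/
theorem hardy_pointwise {N : ℕ} (u : EuclideanSpace ℝ (Fin N) → ℂ)
    (x : EuclideanSpace ℝ (Fin N)) (hx : x ≠ 0) (k : ℝ) :
    0 ≤ (∑ i, ‖pdC i u x‖ ^ 2)
      + 2 * k * (‖x‖ ^ (-2 : ℝ) * (fderiv ℝ u x x * (starRingEnd ℂ) (u x)).re)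
      + k ^ 2 * (‖x‖ ^ (-2 : ℝ) * ‖u x‖ ^ 2) := by
  have hn : ‖x‖ ≠ 0 := norm_ne_zero_iff.mpr hx
  have hr : ‖x‖ ^ (-2 : ℝ) = (‖x‖ ^ 2)⁻¹ := by
    rw [Real.rpow_neg (norm_nonneg x)]
    norm_num
  have hsq : ∑ i, x i ^ 2 = ‖x‖ ^ 2 := (EuclideanSpace.real_norm_sq_eq x).symm
  have h : 0 ≤ ∑ i, ‖pdC i u x + ((k * (‖x‖ ^ 2)⁻¹ * x i : ℝ) : ℂ) * u x‖ ^ 2 := by positivity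
  simp_rw [normSq_add_ofReal_mul, Finset.sum_add_distrib] at h
  have h2 : ∑ i, 2 * (k * (‖x‖ ^ 2)⁻¹ * x i) * (pdC i u x * (starRingEnd ℂ) (u x)).re
      = 2 * k * ((‖x‖ ^ 2)⁻¹ * (fderiv ℝ u x x * (starRingEnd ℂ) (u x)).re) := by
    rw [← sum_coord_mul_pdC, Finset.sum_mul, Complex.re_sum, Finset.mul_sum, Finset.mul_sum]
    refine Finset.sum_congr rfl fun i _ ↦ ?_
    rw [mul_assoc (x i : ℂ), Complex.re_ofReal_mul]
    ring
  have h3 : ∑ i, (k * (‖x‖ ^ 2)⁻¹ * x i) ^ 2 * ‖u x‖ ^ 2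
      = k ^ 2 * ((‖x‖ ^ 2)⁻¹ * ‖u x‖ ^ 2) := by
    simp_rw [mul_pow _ (x _) 2]
    rw [← Finset.sum_mul, ← Finset.mul_sum, hsq]
    field_simp
  rw [h2, h3] at h
  rwa [hr]

theorem stmt2 (N : ℕ) (hN : 3 ≤ N) (α β b c l : ℝ) (hα0 : 0 ≤ α) (hα2 : α < 2) (hβ : 0 < β)
    (c₀ : ℝ) (hc₀ : c₀ = (((N : ℝ) - 2) / 2) ^ 2)
    (u : EuclideanSpace ℝ (Fin N) → ℂ) (hu : IsTestAway0 u) :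
    (formA α β b c l u).re ≥
      (∫ x, ‖x‖ ^ α * ∑ i, ‖pdC i u x‖ ^ 2)
      + (1 / 2) * (∫ x, ∑ i, ‖pdC i u x‖ ^ 2)
      + (∫ x, (c₀ / (2 * ‖x‖ ^ 2)
          + (c - 1 - (α - b) / 2 * (α - 2 + N)) * ‖x‖ ^ (α - 2) + l) * ‖u x‖ ^ 2)
      + (∫ x, ‖x‖ ^ (α - 2) * ‖u x‖ ^ 2)
      + (∫ x, ‖x‖ ^ β * ‖u x‖ ^ 2) := by
  obtain ⟨hsm, hcs, h0⟩ := hu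
  have hdiff : Differentiable ℝ u := hsm.differentiable (by simp)
  have hcont : Continuous u := hsm.continuous
  have hfd : Continuous (fderiv ℝ u) := hsm.continuous_fderiv (by simp)
  have hpd : ∀ i, Continuous (pdC i u) := fun i ↦ by
    unfold pdC
    fun_prop
  set D : EuclideanSpace ℝ (Fin N) → ℝ := fun x ↦ ∑ i, ‖pdC i u x‖ ^ 2 with hD
  set G : EuclideanSpace ℝ (Fin N) → ℝ := fun x ↦ ‖u x‖ ^ 2 with hG
  set P : EuclideanSpace ℝ (Fin N) → ℂ := fun x ↦ fderiv ℝ u x x * (starRingEnd ℂ) (u x) with hP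
  have hDc : Continuous D := by fun_prop
  have hGc : Continuous G := by fun_prop
  have hPc : Continuous P :=
    (hfd.clm_apply continuous_id).mul (Complex.continuous_conj.comp hcont)
  have hu0 : ∀ x ∉ tsupport u, u x = 0 := fun x hx ↦ image_eq_zero_of_notMem_tsupport hx
  have hD0 : ∀ x ∉ tsupport u, D x = 0 := fun x hx ↦ by
    have : fderiv ℝ u x = 0 := by
      by_contra h
      exact hx (support_fderiv_subset ℝ h)
    simp [hD, pdC, this]
  have hG0 : ∀ x ∉ tsupport u, G x = 0 := fun x hx ↦ by simp [hG, hu0 x hx]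
  have hP0 : ∀ x ∉ tsupport u, P x = 0 := fun x hx ↦ by simp [hP, hu0 x hx]
  have hK : IsCompact (tsupport u) := hcs
  have iD : ∀ s : ℝ, Integrable fun x ↦ ‖x‖ ^ s * D x := fun s ↦
    integrable_mul_of_support_subset (continuousOn_rpow_norm s) hDc hK h0 hD0
  have iD1 : Integrable D := by
    simpa using iD 0
  have iG : ∀ s : ℝ, Integrable fun x ↦ ‖x‖ ^ s * G x := fun s ↦
    integrable_mul_of_support_subset (continuousOn_rpow_norm s) hGc hK h0 hG0
  have iG1 : Integrable G := by
    simpa using iG 0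
  have iPre : ∀ s : ℝ, Integrable fun x ↦ ‖x‖ ^ s * (P x).re := fun s ↦
    integrable_mul_of_support_subset (continuousOn_rpow_norm s)
      (Complex.continuous_re.comp hPc) hK h0 fun x hx ↦ by simp [hP0 x hx]
  have iPim : ∀ s : ℝ, Integrable fun x ↦ ‖x‖ ^ s * (P x).im := fun s ↦
    integrable_mul_of_support_subset (continuousOn_rpow_norm s)
      (Complex.continuous_im.comp hPc) hK h0 fun x hx ↦ by simp [hP0 x hx]
  have hGd : ∀ x, fderiv ℝ G x x = 2 * (P x).re := fun x ↦ fderiv_norm_sq_comp_apply (hdiff x) x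
  have hparts : ∀ s : ℝ, ∫ x, ‖x‖ ^ s * (P x).re = -((s + N) / 2) * ∫ x, ‖x‖ ^ s * G x := by
    intro s
    have hsub : tsupport G ⊆ tsupport u := closure_minimal
      (fun x hx ↦ by_contra fun h ↦ hx (hG0 x h)) (isClosed_tsupport u)
    have e : ∀ x, ‖x‖ ^ s * (2 * (P x).re) = 2 * (‖x‖ ^ s * (P x).re) := fun x ↦ by ring
    have h := integral_rpow_norm_mul_fderiv_apply_self (g := G)
      ((hsm.of_le (by simp)).norm_sq ℝ) (hcs.of_isClosed_subset (isClosed_tsupport G) hsub)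
      (fun h ↦ h0 (hsub h)) s (iG s) (by simpa only [hGd, e] using (iPre s).const_mul 2)
    simp only [hGd, e, integral_const_mul] at h
    linarith
  have hardy : c₀ * ∫ x, ‖x‖ ^ (-2 : ℝ) * G x ≤ ∫ x, D x := by
    have h : 0 ≤ ∫ x, (D x + 2 * (((N : ℝ) - 2) / 2) * (‖x‖ ^ (-2 : ℝ) * (P x).re)
        + (((N : ℝ) - 2) / 2) ^ 2 * (‖x‖ ^ (-2 : ℝ) * G x)) := by
      refine integral_nonneg fun x ↦ ?_
      by_cases hx : x ∈ tsupport u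
      · exact hardy_pointwise u x (fun h ↦ h0 (h ▸ hx)) _
      · simp [hD0 x hx, hG0 x hx, hP0 x hx]
    rw [integral_add (by fun_prop) (by fun_prop), integral_add (by fun_prop) (by fun_prop),
      integral_const_mul, integral_const_mul, hparts] at h
    rw [hc₀]
    linarith
  have hform : (formA α β b c l u).re = (∫ x, D x) + (∫ x, ‖x‖ ^ α * D x)
      + (α - b) * (∫ x, ‖x‖ ^ (α - 2) * (P x).re)
      + (c * (∫ x, ‖x‖ ^ (α - 2) * G x) + (∫ x, ‖x‖ ^ β * G x) + l * ∫ x, G x) := by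
    unfold formA
    simp_rw [sum_coord_mul_pdC]
    have i₁ : Integrable fun x ↦ (((D x + ‖x‖ ^ α * D x) + (α - b) * (‖x‖ ^ (α - 2) * (P x).re))
        + ((c * (‖x‖ ^ (α - 2) * G x) + ‖x‖ ^ β * G x) + l * G x)) :=
      ((iD1.add (iD α)).add ((iPre _).const_mul _)).add
        ((((iG _).const_mul c).add (iG β)).add (iG1.const_mul l))
    have i₂ : Integrable fun x ↦ (α - b) * (‖x‖ ^ (α - 2) * (P x).im) := (iPim _).const_mul _
    have e : ∀ x, (((1 + ‖x‖ ^ α : ℝ) : ℂ) * ((D x : ℝ) : ℂ)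
        + (((α - b) * ‖x‖ ^ (α - 2) : ℝ) : ℂ) * P x
        + ((c * ‖x‖ ^ (α - 2) + ‖x‖ ^ β + l : ℝ) : ℂ) * ((G x : ℝ) : ℂ))
        = (((((D x + ‖x‖ ^ α * D x) + (α - b) * (‖x‖ ^ (α - 2) * (P x).re))
        + ((c * (‖x‖ ^ (α - 2) * G x) + ‖x‖ ^ β * G x) + l * G x)) : ℝ) : ℂ)
        + (((α - b) * (‖x‖ ^ (α - 2) * (P x).im) : ℝ) : ℂ) * Complex.I := by
      intro x
      conv_lhs => rw [← Complex.re_add_im (P x)]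
      push_cast
      ring
    refine (congrArg Complex.re (integral_congr_ae (.of_forall e))).trans ?_
    rw [integral_add i₁.ofReal (i₂.ofReal.mul_const _), integral_mul_const,
      integral_complex_ofReal, integral_complex_ofReal, Complex.add_re, Complex.ofReal_re,
      Complex.re_ofReal_mul, Complex.I_re, mul_zero, add_zero,
      integral_add (by fun_prop) (by fun_prop),
      integral_add (by fun_prop) (by fun_prop),
      integral_add (by fun_prop) (by fun_prop),
      integral_add (by fun_prop) (by fun_prop),
      integral_add (by fun_prop) (by fun_prop)]
    simp only [integral_const_mul]
  have hpot : ∫ x, (c₀ / (2 * ‖x‖ ^ 2)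
      + (c - 1 - (α - b) / 2 * (α - 2 + N)) * ‖x‖ ^ (α - 2) + l) * G x
      = c₀ / 2 * (∫ x, ‖x‖ ^ (-2 : ℝ) * G x)
        + (c - 1 - (α - b) / 2 * (α - 2 + N)) * (∫ x, ‖x‖ ^ (α - 2) * G x) + l * ∫ x, G x := by
    have e : ∀ x, (c₀ / (2 * ‖x‖ ^ 2)
        + (c - 1 - (α - b) / 2 * (α - 2 + N)) * ‖x‖ ^ (α - 2) + l) * G x
        = c₀ / 2 * (‖x‖ ^ (-2 : ℝ) * G x)
          + (c - 1 - (α - b) / 2 * (α - 2 + N)) * (‖x‖ ^ (α - 2) * G x) + l * G x := by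
      intro x
      have hr : ‖x‖ ^ (-2 : ℝ) = (‖x‖ ^ 2)⁻¹ := by
        rw [Real.rpow_neg (norm_nonneg x)]
        norm_num
      simp only [hr, div_eq_mul_inv, mul_inv]
      ring
    rw [integral_congr_ae (.of_forall e), integral_add (by fun_prop) (by fun_prop),
      integral_add (by fun_prop) (by fun_prop)]
    simp only [integral_const_mul]
  rw [hform, hpot, hparts]
  linarith
end
end

section
/- Let N ≥ 3, α ∈ [0,2), β > 0, b, c ∈ ℝ, and let λ > 0 be such that ((N−2)²/8) t^{−2} + (c − 1 − ((α−b)/2)(α−2+N)) t^{α−2} + λ > 0 for every t > 0. Then for every u ∈ C_c^∞(ℝ^N \ {0}; ℂ): ∫_{ℝ^N} |∇u|² dx ≤ 2 Re 𝔞(u,u) and ∫_{ℝ^N} (1+|x|^α)|∇u|² dx ≤ 3 Re 𝔞(u,u). -/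
open MeasureTheory Real

noncomputable section

theorem continuousOn_norm_rpow {E : Type*} [NormedAddCommGroup E] (p : ℝ) :
    ContinuousOn (fun x : E => ‖x‖ ^ p) {0}ᶜ :=
  continuous_norm.continuousOn.rpow_const fun _ hx => Or.inl (norm_ne_zero_iff.2 hx)

theorem hasFDerivAt_norm_rpow_of_ne_zero {E : Type*} [NormedAddCommGroup E]
    [InnerProductSpace ℝ E] (p : ℝ) {x : E} (hx : x ≠ 0) :
    HasFDerivAt (fun y : E => ‖y‖ ^ p) ((p * ‖x‖ ^ (p - 2)) • innerSL ℝ x) x := by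
  have h := ((hasStrictFDerivAt_norm_sq x).hasFDerivAt).rpow_const (p := p / 2)
    (Or.inl (pow_ne_zero 2 (norm_ne_zero_iff.2 hx)))
  have e : ∀ (y : E) (q : ℝ), (‖y‖ ^ 2) ^ q = ‖y‖ ^ (2 * q) := fun y q => by
    rw [← Real.rpow_natCast_mul (norm_nonneg y)]; norm_num
  simp only [e] at h
  convert h using 1
  · funext y
    ring_nf
  · ext y
    simp only [smul_apply, smul_eq_mul, nsmul_eq_mul]
    rw [show 2 * (p / 2 - 1) = p - 2 by ring]
    norm_num
    ring

namespace IsTestAway0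

variable {N : ℕ} {u : EuclideanSpace ℝ (Fin N) → ℂ}

theorem continuous (hu : IsTestAway0 u) : Continuous u := hu.1.continuous

theorem differentiable (hu : IsTestAway0 u) : Differentiable ℝ u :=
  hu.1.differentiable (by simp)

theorem continuous_pdC (hu : IsTestAway0 u) (i : Fin N) : Continuous (pdC i u) :=
  (hu.1.continuous_fderiv (by simp)).clm_apply continuous_const

theorem pdC_eq_zero {x : EuclideanSpace ℝ (Fin N)} (hx : x ∉ tsupport u) (i : Fin N) :
    pdC i u x = 0 := by
  have h : fderiv ℝ u x = 0 := by
    by_contra h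
    exact hx (support_fderiv_subset ℝ h)
  simp [pdC, h]

/-- A function continuous away from the origin and vanishing off the support of a test function
is integrable. -/
theorem integrable_of_continuousOn (hu : IsTestAway0 u) {F : Type*} [NormedAddCommGroup F]
    {h : EuclideanSpace ℝ (Fin N) → F} (hc : ContinuousOn h {0}ᶜ)
    (h0 : ∀ x ∉ tsupport u, h x = 0) : Integrable h := by
  have hs : tsupport h ⊆ tsupport u :=
    closure_minimal (fun x hx => by_contra fun hxu => hx (h0 x hxu)) (isClosed_tsupport u)
  refine Continuous.integrable_of_hasCompactSupport ?_
    (hu.2.1.of_isClosed_subset (isClosed_tsupport h) hs)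
  exact hc.continuous_of_tsupport_subset isOpen_compl_singleton
    (hs.trans fun x hx h => hu.2.2 (h ▸ hx))

theorem hasFDerivAt_norm_sq (hu : IsTestAway0 u) (x : EuclideanSpace ℝ (Fin N)) :
    HasFDerivAt (fun y => ‖u y‖ ^ 2) (2 • (innerSL ℝ (u x)).comp (fderiv ℝ u x)) x :=
  (hu.differentiable x).hasFDerivAt.norm_sq

/-- The divergence of the vector field `‖x‖ ^ p * ‖u x‖ ^ 2 • x`. -/
def radialDiv (p : ℝ) (u : EuclideanSpace ℝ (Fin N) → ℂ) (x : EuclideanSpace ℝ (Fin N)) : ℝ :=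
  2 * ‖x‖ ^ p * ∑ i, x i * inner ℝ (u x) (pdC i u x) + (p + N) * ‖x‖ ^ p * ‖u x‖ ^ 2

theorem integral_radial_by_parts (hu : IsTestAway0 u) (p : ℝ) (i : Fin N) :
    ∫ x, (‖x‖ ^ p * x i) * (2 * inner ℝ (u x) (pdC i u x)) =
      -∫ x, (p * ‖x‖ ^ (p - 2) * x i * x i + ‖x‖ ^ p) * ‖u x‖ ^ 2 := by
  have c1 := continuousOn_norm_rpow (E := EuclideanSpace ℝ (Fin N)) p
  have c2 := continuousOn_norm_rpow (E := EuclideanSpace ℝ (Fin N)) (p - 2)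
  have cu := hu.continuous
  have cd := hu.continuous_pdC i
  have key := integral_bilinear_hasFDerivAt_right_eq_neg_left_of_integrable
    (μ := (volume : Measure (EuclideanSpace ℝ (Fin N))))
    (f := fun x => ‖x‖ ^ p * x i) (g := fun x => ‖u x‖ ^ 2)
    (f' := fun x => (‖x‖ ^ p) • (EuclideanSpace.proj i : EuclideanSpace ℝ (Fin N) →L[ℝ] ℝ)
      + (x i) • ((p * ‖x‖ ^ (p - 2)) • innerSL ℝ x))
    (g' := fun x => 2 • (innerSL ℝ (u x)).comp (fderiv ℝ u x))
    (v := EuclideanSpace.single i 1) (B := ContinuousLinearMap.mul ℝ ℝ)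
  have e1 : ∀ x : EuclideanSpace ℝ (Fin N),
      ((‖x‖ ^ p) • (EuclideanSpace.proj i : EuclideanSpace ℝ (Fin N) →L[ℝ] ℝ)
      + (x i) • ((p * ‖x‖ ^ (p - 2)) • innerSL ℝ x)) (EuclideanSpace.single i 1)
      = p * ‖x‖ ^ (p - 2) * x i * x i + ‖x‖ ^ p := fun x => by
    simp [EuclideanSpace.inner_single_right]
    ring
  have e2 : ∀ x : EuclideanSpace ℝ (Fin N),
      (2 • (innerSL ℝ (u x)).comp (fderiv ℝ u x)) (EuclideanSpace.single i 1)
      = 2 * inner ℝ (u x) (pdC i u x) := fun x => by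
    simp [pdC]
    ring
  simp only [e1, e2, ContinuousLinearMap.mul_apply'] at key
  refine key ?_ ?_ ?_ ?_ fun x _ => hu.hasFDerivAt_norm_sq x
  · exact hu.integrable_of_continuousOn (by fun_prop)
      fun x hx => by simp [image_eq_zero_of_notMem_tsupport hx]
  · exact hu.integrable_of_continuousOn (by fun_prop)
      fun x hx => by simp [image_eq_zero_of_notMem_tsupport hx]
  · exact hu.integrable_of_continuousOn (by fun_prop)
      fun x hx => by simp [image_eq_zero_of_notMem_tsupport hx]
  · intro x hx
    have hx0 : x ≠ 0 := by
      rintro rfl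
      refine hu.2.2 (closure_mono (fun y hy => ?_) hx)
      simpa using hy
    exact (hasFDerivAt_norm_rpow_of_ne_zero p hx0).mul
      (EuclideanSpace.proj i : EuclideanSpace ℝ (Fin N) →L[ℝ] ℝ).hasFDerivAt

theorem integrable_radialDiv (hu : IsTestAway0 u) (p : ℝ) : Integrable (radialDiv p u) := by
  have c1 := continuousOn_norm_rpow (E := EuclideanSpace ℝ (Fin N)) p
  have cu := hu.continuous
  have cd := hu.continuous_pdC
  exact hu.integrable_of_continuousOn (by unfold radialDiv; fun_prop)
      fun x hx => by simp [radialDiv, image_eq_zero_of_notMem_tsupport hx]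

theorem integral_radialDiv (hu : IsTestAway0 u) (p : ℝ) : ∫ x, radialDiv p u x = 0 := by
  have c1 := continuousOn_norm_rpow (E := EuclideanSpace ℝ (Fin N)) p
  have c2 := continuousOn_norm_rpow (E := EuclideanSpace ℝ (Fin N)) (p - 2)
  have cu := hu.continuous
  have cd := hu.continuous_pdC
  have i1 : ∀ i : Fin N, Integrable fun x : EuclideanSpace ℝ (Fin N) =>
      (‖x‖ ^ p * x i) * (2 * inner ℝ (u x) (pdC i u x)) := fun i =>
    hu.integrable_of_continuousOn (by fun_prop)
      fun x hx => by simp [image_eq_zero_of_notMem_tsupport hx]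
  have i2 : ∀ i : Fin N, Integrable fun x : EuclideanSpace ℝ (Fin N) =>
      (p * ‖x‖ ^ (p - 2) * x i * x i + ‖x‖ ^ p) * ‖u x‖ ^ 2 := fun i =>
    hu.integrable_of_continuousOn (by fun_prop)
      fun x hx => by simp [image_eq_zero_of_notMem_tsupport hx]
  have e : radialDiv p u = fun x => ∑ i, ((‖x‖ ^ p * x i) * (2 * inner ℝ (u x) (pdC i u x)) +
      (p * ‖x‖ ^ (p - 2) * x i * x i + ‖x‖ ^ p) * ‖u x‖ ^ 2) := by
    funext x
    by_cases hx : x = 0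
    · have hx' : x ∉ tsupport u := hx ▸ hu.2.2
      simp [radialDiv, image_eq_zero_of_notMem_tsupport hx']
    have hr : ‖x‖ ^ p = ‖x‖ ^ (p - 2) * ∑ i, x i * x i := by
      have h2 : ∑ i, x i * x i = ‖x‖ ^ (2 : ℝ) := by
        rw [Real.rpow_two, EuclideanSpace.real_norm_sq_eq]
        simp only [sq]
      rw [h2, ← Real.rpow_add (norm_pos_iff.2 hx)]
      ring_nf
    have h1 : ∑ i, p * ‖x‖ ^ (p - 2) * x i * x i = p * ‖x‖ ^ p := by
      rw [hr, Finset.mul_sum, Finset.mul_sum]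
      exact Finset.sum_congr rfl fun i _ => by ring
    rw [Finset.sum_add_distrib, ← Finset.sum_mul, Finset.sum_add_distrib, h1, radialDiv,
      Finset.mul_sum]
    simp only [Finset.sum_const, Finset.card_univ, Fintype.card_fin, nsmul_eq_mul]
    congr 1
    · exact Finset.sum_congr rfl fun i _ => by ring
    · ring
  simp only [e]
  rw [integral_finsetSum _ fun i _ => by simpa only [Pi.add_apply] using! (i1 i).add (i2 i)]
  refine Finset.sum_eq_zero fun i _ => ?_
  rw [integral_add (i1 i) (i2 i), hu.integral_radial_by_parts p i, neg_add_cancel]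

/-- Pointwise form of Hardy's inequality, up to a divergence. -/
theorem hardy_pointwise (hu : IsTestAway0 u) (x : EuclideanSpace ℝ (Fin N)) :
    0 ≤ ∑ i, ‖pdC i u x‖ ^ 2 + ((N : ℝ) - 2) / 2 * radialDiv (-2) u x
      - ((N : ℝ) - 2) ^ 2 / 4 * ‖x‖ ^ (-2 : ℝ) * ‖u x‖ ^ 2 := by
  by_cases hx : x = 0
  · have hx' : x ∉ tsupport u := hx ▸ hu.2.2
    simp [radialDiv, image_eq_zero_of_notMem_tsupport hx', pdC_eq_zero hx']
  set s : ℝ := ((N : ℝ) - 2) / 2 with hs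
  set q : ℝ := ‖x‖ ^ (-2 : ℝ) with hq
  have hr : q ^ 2 * ∑ i, x i ^ 2 = q := by
    rw [← EuclideanSpace.real_norm_sq_eq, hq, Real.rpow_neg (norm_nonneg x), Real.rpow_two]
    have := norm_ne_zero_iff.2 hx
    field_simp
  have h : 0 ≤ ∑ i, ‖(s * q * x i) • u x + pdC i u x‖ ^ 2 :=
    Finset.sum_nonneg fun i _ => sq_nonneg _
  have e : ∑ i, ‖(s * q * x i) • u x + pdC i u x‖ ^ 2 =
      s ^ 2 * ‖u x‖ ^ 2 * (q ^ 2 * ∑ i, x i ^ 2)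
      + 2 * s * q * (∑ i, x i * inner ℝ (u x) (pdC i u x)) + ∑ i, ‖pdC i u x‖ ^ 2 := by
    rw [Finset.mul_sum, Finset.mul_sum, Finset.mul_sum, ← Finset.sum_add_distrib,
      ← Finset.sum_add_distrib]
    refine Finset.sum_congr rfl fun i _ => ?_
    rw [norm_add_sq_real, norm_smul, inner_smul_left, mul_pow, Real.norm_eq_abs, sq_abs]
    simp only [conj_trivial]
    ring
  rw [e, hr] at h
  rw [radialDiv, ← hq]
  have hN : (N : ℝ) = 2 * s + 2 := by rw [hs]; ring
  rw [hN]
  linarith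

end IsTestAway0

/-- The real part of the integrand of `formA`. -/
def formADensity {N : ℕ} (α β b c l : ℝ) (u : EuclideanSpace ℝ (Fin N) → ℂ)
    (x : EuclideanSpace ℝ (Fin N)) : ℝ :=
  (1 + ‖x‖ ^ α) * ∑ i, ‖pdC i u x‖ ^ 2
    + (α - b) * ‖x‖ ^ (α - 2) * ∑ i, x i * inner ℝ (u x) (pdC i u x)
    + (c * ‖x‖ ^ (α - 2) + ‖x‖ ^ β + l) * ‖u x‖ ^ 2

namespace IsTestAway0

variable {N : ℕ} {u : EuclideanSpace ℝ (Fin N) → ℂ}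

theorem integrable_formADensity (hu : IsTestAway0 u) (α β b c l : ℝ) :
    Integrable (formADensity α β b c l u) := by
  have c1 := continuousOn_norm_rpow (E := EuclideanSpace ℝ (Fin N)) α
  have c2 := continuousOn_norm_rpow (E := EuclideanSpace ℝ (Fin N)) (α - 2)
  have c3 := continuousOn_norm_rpow (E := EuclideanSpace ℝ (Fin N)) β
  have cu := hu.continuous
  have cd := hu.continuous_pdC
  exact hu.integrable_of_continuousOn (by unfold formADensity; fun_prop)
    fun x hx => by simp [formADensity, image_eq_zero_of_notMem_tsupport hx, pdC_eq_zero hx]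

theorem re_formA (hu : IsTestAway0 u) (α β b c l : ℝ) :
    (formA α β b c l u).re = ∫ x, formADensity α β b c l u x := by
  have c1 := continuousOn_norm_rpow (E := EuclideanSpace ℝ (Fin N)) α
  have c2 := continuousOn_norm_rpow (E := EuclideanSpace ℝ (Fin N)) (α - 2)
  have c3 := continuousOn_norm_rpow (E := EuclideanSpace ℝ (Fin N)) β
  have cu := hu.continuous
  have cd := hu.continuous_pdC
  rw [formA, ← RCLike.re_eq_complex_re, ← integral_re]
  · refine integral_congr_ae (Filter.Eventually.of_forall fun x => ?_)
    simp only [RCLike.re_eq_complex_re, Complex.add_re, Complex.re_ofReal_mul, Complex.ofReal_re,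
      formADensity, Finset.sum_mul, Complex.re_sum, mul_assoc, Complex.inner]
  · exact hu.integrable_of_continuousOn (by fun_prop)
      fun x hx => by simp [image_eq_zero_of_notMem_tsupport hx, pdC_eq_zero hx]

theorem integrable_weight_mul_gradient (hu : IsTestAway0 u) (α : ℝ) :
    Integrable fun x => (1 + ‖x‖ ^ α) * ∑ i, ‖pdC i u x‖ ^ 2 := by
  have c1 := continuousOn_norm_rpow (E := EuclideanSpace ℝ (Fin N)) α
  have cd := hu.continuous_pdC
  exact hu.integrable_of_continuousOn (by fun_prop) fun x hx => by simp [pdC_eq_zero hx]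

theorem integrable_gradient (hu : IsTestAway0 u) :
    Integrable fun x => ∑ i, ‖pdC i u x‖ ^ 2 := by
  have cd := hu.continuous_pdC
  exact hu.integrable_of_continuousOn (by fun_prop) fun x hx => by simp [pdC_eq_zero hx]

/-- It suffices to compare integrands up to multiples of radial divergences. -/
theorem integral_le_of_pointwise (hu : IsTestAway0 u) (α β b c l k m₁ m₂ p q : ℝ)
    {g : EuclideanSpace ℝ (Fin N) → ℝ} (hg : Integrable g)
    (h : ∀ x, g x ≤ k * formADensity α β b c l u x + m₁ * radialDiv p u x
      + m₂ * radialDiv q u x) :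
    ∫ x, g x ≤ k * (formA α β b c l u).re := by
  have iA := (hu.integrable_formADensity α β b c l).const_mul k
  have i1 := (hu.integrable_radialDiv p).const_mul m₁
  have i2 := (hu.integrable_radialDiv q).const_mul m₂
  refine (integral_mono hg ((iA.add i1).add i2) h).trans_eq ?_
  rw [integral_add' (iA.add i1) i2, integral_add' iA i1, integral_const_mul, integral_const_mul,
    integral_const_mul, hu.integral_radialDiv, hu.integral_radialDiv, hu.re_formA]
  ring

end IsTestAway0

theorem stmt3 (N : ℕ) (hN : 3 ≤ N) (α β b c l : ℝ) (hα0 : 0 ≤ α) (hα2 : α < 2) (hβ : 0 < β)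
    (hl : 0 < l)
    (hlpos : ∀ t : ℝ, 0 < t →
      0 < ((N : ℝ) - 2) ^ 2 / 8 * t ^ (-2 : ℝ)
        + (c - 1 - (α - b) / 2 * (α - 2 + N)) * t ^ (α - 2) + l)
    (u : EuclideanSpace ℝ (Fin N) → ℂ) (hu : IsTestAway0 u) :
    (∫ x, ∑ i, ‖pdC i u x‖ ^ 2) ≤ 2 * (formA α β b c l u).re ∧
    (∫ x, (1 + ‖x‖ ^ α) * ∑ i, ‖pdC i u x‖ ^ 2) ≤ 3 * (formA α β b c l u).re := by
  have hv : ∀ x, 0 ≤ (((N : ℝ) - 2) ^ 2 / 8 * ‖x‖ ^ (-2 : ℝ)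
      + (c - (α - b) / 2 * (α - 2 + N)) * ‖x‖ ^ (α - 2) + ‖x‖ ^ β + l) * ‖u x‖ ^ 2 := by
    intro x
    by_cases hx : x = 0
    · have hx' : x ∉ tsupport u := hx ▸ hu.2.2
      simp [image_eq_zero_of_notMem_tsupport hx']
    have h := hlpos ‖x‖ (norm_pos_iff.2 hx)
    have h1 : 0 ≤ ‖x‖ ^ β := by positivity
    have h2 : 0 ≤ ‖x‖ ^ (α - 2) := by positivity
    exact mul_nonneg (by linarith) (sq_nonneg _)
  have hG : ∀ x, 0 ≤ ∑ i, ‖pdC i u x‖ ^ 2 := fun x =>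
    Finset.sum_nonneg fun i _ => sq_nonneg _
  have hαG : ∀ x, 0 ≤ ‖x‖ ^ α * ∑ i, ‖pdC i u x‖ ^ 2 := fun x =>
    mul_nonneg (by positivity) (hG x)
  constructor
  · refine hu.integral_le_of_pointwise α β b c l 2 (-(α - b)) (((N : ℝ) - 2) / 2) (α - 2) (-2)
      hu.integrable_gradient fun x => ?_
    have h1 := hu.hardy_pointwise x
    have h2 := hv x
    have h3 := hαG x
    simp only [formADensity, IsTestAway0.radialDiv] at h1 ⊢
    linarith
  · refine hu.integral_le_of_pointwise α β b c l 3 (-(3 / 2 * (α - b)))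
      (3 / 2 * (((N : ℝ) - 2) / 2)) (α - 2) (-2)
      (hu.integrable_weight_mul_gradient α) fun x => ?_
    have h1 := hu.hardy_pointwise x
    have h2 := hv x
    have h3 := hαG x
    have h4 := hG x
    simp only [formADensity, IsTestAway0.radialDiv] at h1 ⊢
    linarith
end
end

section
/- Let N ≥ 3, α ∈ [0,2) and β > 0. For every u ∈ C_c^∞(ℝ^N; ℂ) and every δ > 0 there exists v ∈ C_c^∞(ℝ^N \ {0}; ℂ) such that ∫_{ℝ^N} [ (1+|x|^α) |∇(u−v)|² + ( |x|^{α−2} + |x|^β + 1 ) |u−v|² ] dx < δ. (In other words, smooth compactly supported functions vanishing near the origin are dense, with respect to the energy norm of the form 𝔞, among all smooth compactly supported functions.) -/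
open MeasureTheory Real

noncomputable section

open Metric in
/-- Near a null point, integrals of a locally integrable function over small balls are small. -/
theorem exists_setIntegral_closedBall_lt {E : Type*} [NormedAddCommGroup E] [ProperSpace E]
    [MeasurableSpace E] [OpensMeasurableSpace E] {μ : Measure E} [NullSingletonClass μ] {g : E → ℝ}
    (hg : LocallyIntegrable g μ) {ε : ℝ} (hε : 0 < ε) :
    ∃ ρ : ℝ, 0 < ρ ∧ ρ ≤ 1 ∧ ∫ x in closedBall 0 ρ, g x ∂μ < ε := by
  have hlim := tendsto_setIntegral_of_antitone (μ := μ) (f := g)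
    (s := fun n : ℕ => closedBall (0 : E) (1 / ((n : ℝ) + 1)))
    (fun _ => isClosed_closedBall.measurableSet)
    (fun m n hmn => closedBall_subset_closedBall (Nat.one_div_le_one_div hmn))
    ⟨0, hg.integrableOn_isCompact (isCompact_closedBall _ _)⟩
  have hinter : (⋂ n : ℕ, closedBall (0 : E) (1 / ((n : ℝ) + 1))) = {0} := by
    ext x
    simp only [Set.mem_iInter, mem_closedBall, dist_zero_right, Set.mem_singleton_iff]
    refine ⟨fun h => norm_le_zero_iff.1 ?_, fun h n => by rw [h, norm_zero]; positivity⟩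
    exact ge_of_tendsto' tendsto_one_div_add_atTop_nhds_zero_nat h
  rw [hinter, Measure.restrict_singleton] at hlim
  simp only [measure_singleton, zero_smul, integral_zero_measure] at hlim
  obtain ⟨n, hn⟩ := (hlim.eventually (gt_mem_nhds hε)).exists
  exact ⟨1 / ((n : ℝ) + 1), by positivity,
    by rw [div_le_one (by positivity)]; linarith [n.cast_nonneg (α := ℝ)], hn⟩

open Metric in
/-- A smooth function cut off to the ball of radius `ρ` by rescaling a fixed bump function agrees
with the original near the origin, and its gradient is at most `K / ‖x‖`, with `K` independent
of `ρ`. -/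
theorem exists_cutoff_near_zero {E F : Type*} [NormedAddCommGroup E] [InnerProductSpace ℝ E]
    [FiniteDimensional ℝ E] [NormedAddCommGroup F] [NormedSpace ℝ F] {u : E → F}
    (hu : ContDiff ℝ (⊤ : ℕ∞) u) (hus : HasCompactSupport u) :
    ∃ K : ℝ, 0 ≤ K ∧ ∀ ρ : ℝ, 0 < ρ → ρ ≤ 1 → ∃ w : E → F,
      ContDiff ℝ (⊤ : ℕ∞) w ∧ HasCompactSupport w ∧ w =ᶠ[nhds 0] u ∧
      (∀ x, ρ < ‖x‖ → w x = 0 ∧ fderiv ℝ w x = 0) ∧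
      (∀ x, ‖w x‖ ≤ K) ∧ ∀ x, x ≠ 0 → ‖fderiv ℝ w x‖ ≤ K / ‖x‖ := by
  let f : ContDiffBump (0 : E) := ⟨1 / 2, 1, by norm_num, by norm_num⟩
  obtain ⟨M, hM⟩ := hu.continuous.bounded_above_of_compact_support hus
  obtain ⟨A, hA⟩ := (hu.continuous_fderiv (by simp)).bounded_above_of_compact_support
    (hus.fderiv (𝕜 := ℝ))
  obtain ⟨C, hC⟩ := ((f.contDiff (n := 1)).continuous_fderiv
    (by simp)).bounded_above_of_compact_support (f.hasCompactSupport.fderiv (𝕜 := ℝ))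
  have hM0 : 0 ≤ M := (norm_nonneg _).trans (hM 0)
  have hA0 : 0 ≤ A := (norm_nonneg _).trans (hA 0)
  have hC0 : 0 ≤ C := (norm_nonneg _).trans (hC 0)
  refine ⟨M + A + C * M, by positivity, fun ρ hρ hρ1 => ?_⟩
  let h : E → ℝ := fun x => f (ρ⁻¹ • x)
  have hh : ContDiff ℝ (⊤ : ℕ∞) h := f.contDiff.comp (contDiff_const_smul _)
  have hh1 : ∀ x, ‖h x‖ ≤ 1 := fun x => by
    rw [Real.norm_of_nonneg f.nonneg]; exact f.le_one
  have hw : ContDiff ℝ (⊤ : ℕ∞) fun x => h x • u x := hh.smul hu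
  have hout : ∀ x, ρ < ‖x‖ → (fun x => h x • u x) =ᶠ[nhds x] 0 := fun x hx => by
    filter_upwards [(isOpen_lt continuous_const continuous_norm).mem_nhds hx] with y hy
    have : h y = 0 := f.zero_of_le_dist <| by
      have hy : ρ < ‖y‖ := hy
      rw [dist_zero_right, norm_smul, norm_inv, Real.norm_of_nonneg hρ.le, ← div_eq_inv_mul]
      exact ((one_lt_div hρ).2 hy).le
    simp [this]
  have hout' : ∀ x, ρ < ‖x‖ → h x • u x = 0 ∧ fderiv ℝ (fun x => h x • u x) x = 0 :=
    fun x hx => ⟨(hout x hx).eq_of_nhds, by rw [(hout x hx).fderiv_eq]; simp⟩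
  refine ⟨fun x => h x • u x, hw, hus.smul_left, ?_, hout', fun x => ?_, fun x hx => ?_⟩
  · have : Filter.Tendsto (fun x : E => ρ⁻¹ • x) (nhds 0) (nhds 0) := by
      simpa using (continuous_const_smul ρ⁻¹).tendsto (0 : E)
    filter_upwards [this.eventually f.eventuallyEq_one] with x hx
    have : h x = 1 := hx
    simp [this]
  · calc ‖h x • u x‖ ≤ 1 * M := by
          rw [norm_smul]; exact mul_le_mul (hh1 x) (hM x) (norm_nonneg _) zero_le_one
      _ ≤ M + A + C * M := by nlinarith [mul_nonneg hC0 hM0]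
  · have hx0 : 0 < ‖x‖ := norm_pos_iff.2 hx
    rcases lt_or_ge ρ ‖x‖ with hlt | hle
    · rw [(hout' x hlt).2, norm_zero]; positivity
    have hdh : fderiv ℝ h x = ρ⁻¹ • fderiv ℝ f (ρ⁻¹ • x) := fderiv_comp_smul _
    have hdh' : ‖fderiv ℝ h x‖ ≤ C / ‖x‖ := by
      rw [hdh, norm_smul, norm_inv, Real.norm_of_nonneg hρ.le, div_eq_inv_mul]
      exact mul_le_mul (inv_anti₀ hx0 hle) (hC _) (norm_nonneg _) (by positivity)
    have hd : fderiv ℝ (fun x => h x • u x) x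
        = h x • fderiv ℝ u x + (fderiv ℝ h x).smulRight (u x) :=
      fderiv_fun_smul (hh.differentiable (by simp) x) (hu.differentiable (by simp) x)
    have hA' : A ≤ A / ‖x‖ := by
      rw [le_div_iff₀ hx0]; exact mul_le_of_le_one_right hA0 (hle.trans hρ1)
    calc ‖fderiv ℝ (fun x => h x • u x) x‖
        ≤ ‖h x • fderiv ℝ u x‖ + ‖(fderiv ℝ h x).smulRight (u x)‖ := by
          rw [hd]; exact norm_add_le _ _
      _ ≤ 1 * A + C / ‖x‖ * M := by
          rw [norm_smul, ContinuousLinearMap.norm_smulRight_apply]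
          exact add_le_add (mul_le_mul (hh1 x) (hA x) (norm_nonneg _) zero_le_one)
            (mul_le_mul hdh' (hM x) (norm_nonneg _) (by positivity))
      _ ≤ M / ‖x‖ + A / ‖x‖ + C * M / ‖x‖ := by
          rw [one_mul, div_mul_eq_mul_div]
          have : 0 ≤ M / ‖x‖ := by positivity
          linarith
      _ = (M + A + C * M) / ‖x‖ := by ring

theorem norm_pdC_le {N : ℕ} (i : Fin N) (f : EuclideanSpace ℝ (Fin N) → ℂ)
    (x : EuclideanSpace ℝ (Fin N)) : ‖pdC i f x‖ ≤ ‖fderiv ℝ f x‖ := by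
  simpa [pdC] using (fderiv ℝ f x).le_opNorm (EuclideanSpace.single i 1)

/-- On the unit ball the weights of the energy density are all dominated by `‖x‖ ^ (-2)`. -/
theorem energy_density_le {N : ℕ} {α β K : ℝ} (hα0 : 0 ≤ α) (hβ : 0 ≤ β)
    {w : EuclideanSpace ℝ (Fin N) → ℂ} {x : EuclideanSpace ℝ (Fin N)} (hx0 : x ≠ 0)
    (hx1 : ‖x‖ ≤ 1) (hw : ‖w x‖ ≤ K) (hdw : ‖fderiv ℝ w x‖ ≤ K / ‖x‖) :
    (1 + ‖x‖ ^ α) * ∑ i, ‖pdC i w x‖ ^ 2 + (‖x‖ ^ (α - 2) + ‖x‖ ^ β + 1) * ‖w x‖ ^ 2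
      ≤ (2 * N + 3) * K ^ 2 * ‖x‖ ^ (-2 : ℝ) := by
  have hx : 0 < ‖x‖ := norm_pos_iff.2 hx0
  have hsum : ∑ i, ‖pdC i w x‖ ^ 2 ≤ N * (K ^ 2 * ‖x‖ ^ (-2 : ℝ)) := by
    have hsq : (K / ‖x‖) ^ 2 = K ^ 2 * ‖x‖ ^ (-2 : ℝ) := by
      rw [div_pow, rpow_neg hx.le, rpow_two, div_eq_mul_inv]
    calc ∑ i, ‖pdC i w x‖ ^ 2 ≤ ∑ _i : Fin N, (K / ‖x‖) ^ 2 :=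
          Finset.sum_le_sum fun i _ =>
            pow_le_pow_left₀ (norm_nonneg _) ((norm_pdC_le i w x).trans hdw) 2
      _ = N * (K ^ 2 * ‖x‖ ^ (-2 : ℝ)) := by simp [hsq]
  have h1 : ‖x‖ ^ α ≤ 1 := rpow_le_one hx.le hx1 hα0
  have h2 : ‖x‖ ^ β ≤ 1 := rpow_le_one hx.le hx1 hβ
  have h3 : ‖x‖ ^ (α - 2) ≤ ‖x‖ ^ (-2 : ℝ) := rpow_le_rpow_of_exponent_ge hx hx1 (by linarith)
  have h4 : 1 ≤ ‖x‖ ^ (-2 : ℝ) := one_le_rpow_of_pos_of_le_one_of_nonpos hx hx1 (by norm_num)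
  calc _ ≤ 2 * (N * (K ^ 2 * ‖x‖ ^ (-2 : ℝ))) + (3 * ‖x‖ ^ (-2 : ℝ)) * K ^ 2 := by
        gcongr <;> linarith
    _ = _ := by ring

theorem stmt5 (N : ℕ) (hN : 3 ≤ N) (α β : ℝ) (hα0 : 0 ≤ α) (hα2 : α < 2) (hβ : 0 < β)
    (u : EuclideanSpace ℝ (Fin N) → ℂ) (hu : ContDiff ℝ (⊤ : ℕ∞) u) (hus : HasCompactSupport u)
    (δ : ℝ) (hδ : 0 < δ) :
    ∃ v : EuclideanSpace ℝ (Fin N) → ℂ, IsTestAway0 v ∧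
      (∫ x, ((1 + ‖x‖ ^ α) * ∑ i, ‖pdC i (u - v) x‖ ^ 2
        + (‖x‖ ^ (α - 2) + ‖x‖ ^ β + 1) * ‖u x - v x‖ ^ 2)) < δ := by
  have hdim : Module.finrank ℝ (EuclideanSpace ℝ (Fin N)) = N := by simp
  have hN' : (3 : ℝ) ≤ N := by exact_mod_cast hN
  have : Nonempty (Fin N) := ⟨⟨0, by omega⟩⟩
  obtain ⟨K, hK, hcut⟩ := exists_cutoff_near_zero hu hus
  let g : EuclideanSpace ℝ (Fin N) → ℝ := fun x => (2 * N + 3) * K ^ 2 * ‖x‖ ^ (-2 : ℝ)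
  have hg0 : ∀ x, 0 ≤ g x := fun x => by positivity
  have hgloc : LocallyIntegrable g volume :=
    locallyIntegrable_of_norm_le_rpow (C := (2 * N + 3) * K ^ 2) (α := 2)
      (by rw [hdim]; omega) (by rw [hdim]; linarith)
      (Filter.Eventually.of_forall fun x => (Real.norm_of_nonneg (hg0 x)).le)
      (by fun_prop)
  obtain ⟨ρ, hρ, hρ1, hint⟩ := exists_setIntegral_closedBall_lt hgloc hδ
  obtain ⟨w, hwsmooth, hwsupp, hwu, hout, hwK, hdwK⟩ := hcut ρ hρ hρ1
  refine ⟨u - w, ⟨hu.sub hwsmooth, hus.sub hwsupp, ?_⟩, ?_⟩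
  · rw [notMem_tsupport_iff_eventuallyEq]
    filter_upwards [hwu] with x hx
    simp [hx]
  simp only [sub_sub_cancel, Pi.sub_apply]
  refine lt_of_le_of_lt ?_ hint
  rw [← integral_indicator Metric.isClosed_closedBall.measurableSet]
  refine integral_mono_of_nonneg (Filter.Eventually.of_forall fun x => by positivity)
    ((integrable_indicator_iff Metric.isClosed_closedBall.measurableSet).2
      (hgloc.integrableOn_isCompact (isCompact_closedBall _ _))) ?_
  filter_upwards [Measure.ae_ne volume 0] with x hx0
  by_cases hx : x ∈ Metric.closedBall 0 ρ
  · rw [Set.indicator_of_mem hx]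
    exact energy_density_le hα0 hβ.le hx0 ((mem_closedBall_zero_iff.1 hx).trans hρ1) (hwK x)
      (hdwK x hx0)
  · rw [Set.indicator_of_notMem hx]
    obtain ⟨h1, h2⟩ := hout x (by simpa using hx)
    simp [pdC, h1, h2]
end
end

section
/- Let N ≥ 3, 0 ≤ α < 2, β > 0, b, c ∈ ℝ, 1 < p ≤ (N−α)/(2−α) and p' = p/(p−1). Set k₁ = (α − 2 + N/p)(−α + b + N/p') + c, k₂ = (α/p' − 2 + N/p)(−α/p' + N/p'), k₃ = ((α−2+N)/p)( b + (−α + (p−1)(N−2))/p ) + c, and k₄ = (p−1)((N−2)/p)². Then for every ε > 0 and every u ∈ C_c^∞(ℝ^N; ℂ): Re ∫_{ℝ^N} (−A_{b,c}u)(x) W_ε(x)^{p−1} \bar{u}(x) |u(x)|^{p−2} dx ≥ ∫_{ℝ^N} W_ε^p |u|^p [ k₁ + k₂ |x|^{−α} + ε k₃ |x|^{α−2} + ε k₄ |x|^{−2} + |x|^{β−α+2} ] dx, where the integrand on the left is understood to vanish at points where u vanishes. -/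
open MeasureTheory Real

noncomputable section

/-- The Laplacian of a complex-valued function on `ℝ^N`. -/
def lapC {N : ℕ} (f : EuclideanSpace ℝ (Fin N) → ℂ)
    (x : EuclideanSpace ℝ (Fin N)) : ℂ :=
  ∑ i, pdC i (pdC i f) x

/-- The elliptic operator `A_{b,c} = (1+|x|^α)Δ + b|x|^{α-2} x·∇ - c|x|^{α-2} - |x|^β`. -/
def Abc {N : ℕ} (α β b c : ℝ) (f : EuclideanSpace ℝ (Fin N) → ℂ)
    (x : EuclideanSpace ℝ (Fin N)) : ℂ :=
  ((1 + ‖x‖ ^ α : ℝ) : ℂ) * lapC f x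
    + ((b * ‖x‖ ^ (α - 2) : ℝ) : ℂ) * ∑ i, (x i : ℂ) * pdC i f x
    - ((c * ‖x‖ ^ (α - 2) : ℝ) : ℂ) * f x
    - ((‖x‖ ^ β : ℝ) : ℂ) * f x

/-- The Yosida approximation `W_ε(x) = 1/(|x|^{2-α} + ε)` of the potential `|x|^{α-2}`. -/
def Weps {N : ℕ} (α ε : ℝ) (x : EuclideanSpace ℝ (Fin N)) : ℝ :=
  1 / (‖x‖ ^ (2 - α) + ε)

/-- A continuous compactly supported function divided by `‖x‖ ^ 2` is integrable in dimension at
least three. -/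
lemma integrable_div_norm_sq {N : ℕ} (hN : 3 ≤ N) {φ : EuclideanSpace ℝ (Fin N) → ℝ}
    (hφ : Continuous φ) (hc : HasCompactSupport φ) : Integrable fun x ↦ φ x / ‖x‖ ^ 2 := by
  have hloc : LocallyIntegrable (fun x : EuclideanSpace ℝ (Fin N) ↦ (‖x‖ ^ 2)⁻¹) := by
    refine locallyIntegrable_of_norm_le_rpow (C := 1) (α := 2) ?_ ?_ ?_ ?_
    · simp; omega
    · simp only [finrank_euclideanSpace, Fintype.card_fin]
      exact_mod_cast (by omega : 2 < N)
    · refine .of_forall fun x ↦ ?_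
      rw [Real.rpow_neg (norm_nonneg _)]
      simp
    · exact (by fun_prop : Measurable fun x : EuclideanSpace ℝ (Fin N) ↦
        (‖x‖ ^ 2)⁻¹).aestronglyMeasurable
  simpa [div_eq_mul_inv] using
    hloc.integrable_smul_left_of_hasCompactSupport hφ hc

lemma ae_ne_zero_euclidean {N : ℕ} (hN : 3 ≤ N) :
    ∀ᵐ x : EuclideanSpace ℝ (Fin N), x ≠ 0 := by
  have : Nonempty (Fin N) := ⟨⟨0, by omega⟩⟩
  exact Measure.ae_ne volume 0

/-- A measurable function dominated by `φ x / ‖x‖ ^ 2` away from the origin is integrable. -/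
lemma integrable_of_norm_le_div_norm_sq {N : ℕ} (hN : 3 ≤ N) {F : Type*} [NormedAddCommGroup F]
    {φ : EuclideanSpace ℝ (Fin N) → ℝ} (hφ : Continuous φ) (hc : HasCompactSupport φ)
    {f : EuclideanSpace ℝ (Fin N) → F} (hm : AEStronglyMeasurable f volume)
    (hb : ∀ x, x ≠ 0 → ‖f x‖ ≤ φ x / ‖x‖ ^ 2) : Integrable f := by
  refine (integrable_div_norm_sq hN hφ hc).mono' hm ?_
  filter_upwards [ae_ne_zero_euclidean hN] with x hx using hb x hx

/-- A function which is smooth off the origin of `ℝ^N`, `N ≥ 3`, and has singularities at the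
origin of order `‖x‖⁻¹` (and `‖x‖⁻²` for the derivative), integrates by parts without boundary
term. -/
lemma integral_lineDeriv_eq_zero_of_singular {N : ℕ} (hN : 3 ≤ N)
    {f f' φ φ' : EuclideanSpace ℝ (Fin N) → ℝ} {v : EuclideanSpace ℝ (Fin N)}
    (hφ : Continuous φ) (hcφ : HasCompactSupport φ)
    (hφ' : Continuous φ') (hcφ' : HasCompactSupport φ')
    (hm : Measurable f) (hm' : Measurable f')
    (hd : ∀ x, x ≠ 0 → HasLineDerivAt ℝ f (f' x) x v)
    (hb : ∀ x, x ≠ 0 → |f x| ≤ φ x / ‖x‖) (hb' : ∀ x, x ≠ 0 → |f' x| ≤ φ' x / ‖x‖ ^ 2) :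
    Integrable f' ∧ ∫ x, f' x = 0 := by
  have hint' : Integrable f' :=
    integrable_of_norm_le_div_norm_sq hN hφ' hcφ' hm'.aestronglyMeasurable hb'
  refine ⟨hint', ?_⟩
  -- a regularizing factor vanishing to fourth order at the origin
  let q : ℝ → EuclideanSpace ℝ (Fin N) → ℝ := fun η x ↦ (‖x‖ ^ 2 / (‖x‖ ^ 2 + η)) ^ 2
  let q' : ℝ → EuclideanSpace ℝ (Fin N) → ℝ := fun η x ↦
    2 * (‖x‖ ^ 2 / (‖x‖ ^ 2 + η)) * (2 * inner ℝ x v * η / (‖x‖ ^ 2 + η) ^ 2)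
  have hq1 : ∀ η, 0 < η → ∀ x, |q η x| ≤ 1 := by
    intro η hη x
    have : ‖x‖ ^ 2 / (‖x‖ ^ 2 + η) ≤ 1 := by
      rw [div_le_one (by positivity)]; linarith
    rw [abs_of_nonneg (by positivity)]
    exact pow_le_one₀ (by positivity) this
  have hqd : ∀ η, 0 < η → ∀ x, HasLineDerivAt ℝ (q η) (q' η x) x v := by
    intro η hη x
    have hl : HasDerivAt (fun τ : ℝ ↦ x + τ • v) v 0 := by
      simpa using ((hasDerivAt_id (0 : ℝ)).smul_const v).const_add x
    have h1 := hl.norm_sq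
    have h2 := ((h1.div (h1.add_const η) (by positivity)).pow 2)
    refine h2.congr_deriv ?_
    have : (‖x‖ ^ 2 + η) ≠ 0 := by positivity
    simp only [q', zero_smul, add_zero, Pi.div_apply, Nat.cast_ofNat, Nat.add_one_sub_one, pow_one]
    field_simp
    ring
  have hq'b : ∀ η, 0 < η → ∀ x, x ≠ 0 → |q' η x| ≤ 4 * ‖v‖ * (1 / ‖x‖) := by
    intro η hη x hx
    have hx' : 0 < ‖x‖ := norm_pos_iff.2 hx
    have h1 : |(inner ℝ x v : ℝ)| ≤ ‖x‖ * ‖v‖ := abs_real_inner_le_norm x v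
    have e : q' η x = 4 * (‖x‖ ^ 2 * η / (‖x‖ ^ 2 + η) ^ 3) * inner ℝ x v := by
      simp only [q']
      have : (‖x‖ ^ 2 + η) ≠ 0 := by positivity
      field_simp
      ring
    have h2 : ‖x‖ ^ 2 * η / (‖x‖ ^ 2 + η) ^ 3 ≤ 1 / ‖x‖ ^ 2 := by
      rw [div_le_div_iff₀ (by positivity) (by positivity)]
      have : 0 < ‖x‖ ^ 2 := by positivity
      nlinarith [pow_pos this 3, pow_pos this 2, mul_pos this hη, pow_pos hη 3, pow_pos hη 2,
        mul_pos (pow_pos this 2) hη, mul_pos this (pow_pos hη 2)]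
    rw [e, abs_mul, abs_of_nonneg (by positivity)]
    calc 4 * (‖x‖ ^ 2 * η / (‖x‖ ^ 2 + η) ^ 3) * |inner ℝ x v|
        ≤ 4 * (1 / ‖x‖ ^ 2) * (‖x‖ * ‖v‖) := by gcongr
      _ = _ := by field_simp
  have hqf : ∀ η, 0 < η → ∀ x, HasLineDerivAt ℝ (fun x ↦ q η x * f x)
      (q' η x * f x + q η x * f' x) x v := by
    intro η hη x
    by_cases hx : x = 0
    · subst hx
      have hval : q' η 0 * f 0 + q η 0 * f' 0 = 0 := by simp [q, q']
      rw [hval]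
      obtain ⟨M, hM⟩ := hφ.bounded_above_of_compact_support hcφ
      have hM0 : 0 ≤ M := (norm_nonneg _).trans (hM 0)
      have hO : (fun x ↦ q η x * f x) =O[nhds 0] fun x ↦ ‖x - 0‖ ^ 3 := by
        refine Asymptotics.IsBigO.of_bound (M / η ^ 2) (.of_forall fun x ↦ ?_)
        by_cases hx : x = 0
        · subst hx; simp [q]
        have hx' : 0 < ‖x‖ := norm_pos_iff.2 hx
        have h1 : |f x| ≤ M / ‖x‖ := (hb x hx).trans (by
          gcongr; exact (le_abs_self _).trans (hM x))
        have h2 : |q η x| ≤ ‖x‖ ^ 4 / η ^ 2 := by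
          rw [abs_of_nonneg (by positivity)]
          simp only [q, div_pow, ← pow_mul]
          gcongr
          nlinarith
        simp only [sub_zero, norm_mul, Real.norm_eq_abs, abs_pow, abs_norm]
        calc |q η x| * |f x| ≤ (‖x‖ ^ 4 / η ^ 2) * (M / ‖x‖) := by gcongr
          _ = _ := by field_simp
      simpa using (hO.hasFDerivAt (𝕜 := ℝ) (by norm_num)).hasLineDerivAt v
    · exact (HasDerivAt.mul (hqd η hη x) (hd x hx)).congr_deriv (by simp)
  have hcont : Continuous fun x ↦ ‖x‖ * φ x := by fun_prop
  have hcomp : HasCompactSupport fun x ↦ ‖x‖ * φ x := hcφ.mul_left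
  have hcont2 : Continuous fun x ↦ 4 * ‖v‖ * φ x + φ' x := by fun_prop
  have hcomp2 : HasCompactSupport fun x ↦ 4 * ‖v‖ * φ x + φ' x := by
    exact (HasCompactSupport.mul_left hcφ).add hcφ'
  have hqm : ∀ η, Measurable (q η) := fun η ↦ by
    simp only [q]; fun_prop
  have hq'm : ∀ η, Measurable (q' η) := fun η ↦ by
    simp only [q']; fun_prop
  have hbound : ∀ η, 0 < η → ∀ x, x ≠ 0 →
      ‖q' η x * f x + q η x * f' x‖ ≤ (4 * ‖v‖ * φ x + φ' x) / ‖x‖ ^ 2 := by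
    intro η hη x hx
    have hx' : 0 < ‖x‖ := norm_pos_iff.2 hx
    calc ‖q' η x * f x + q η x * f' x‖ ≤ |q' η x| * |f x| + |q η x| * |f' x| := by
          rw [← abs_mul, ← abs_mul]; exact abs_add_le _ _
      _ ≤ (4 * ‖v‖ * (1 / ‖x‖)) * (φ x / ‖x‖) + 1 * (φ' x / ‖x‖ ^ 2) := by
          gcongr
          · exact hq'b η hη x hx
          · exact hb x hx
          · exact hq1 η hη x
          · exact hb' x hx
      _ = _ := by field_simp
  have hzero : ∀ η, 0 < η → ∫ x, (q' η x * f x + q η x * f' x) = 0 := by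
    intro η hη
    have hi1 : Integrable fun x ↦ q' η x * f x + q η x * f' x :=
      integrable_of_norm_le_div_norm_sq hN hcont2 hcomp2
        ((((hq'm η).mul hm).add ((hqm η).mul hm')).aestronglyMeasurable) (hbound η hη)
    have hi2 : Integrable fun x ↦ q η x * f x := by
      refine integrable_of_norm_le_div_norm_sq hN hcont hcomp
        ((hqm η).mul hm).aestronglyMeasurable fun x hx ↦ ?_
      have hx' : 0 < ‖x‖ := norm_pos_iff.2 hx
      rw [norm_mul]
      calc ‖q η x‖ * ‖f x‖ ≤ 1 * (φ x / ‖x‖) := by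
            gcongr
            · exact hq1 η hη x
            · exact hb x hx
        _ = _ := by field_simp
    have := integral_bilinear_hasLineDerivAt_right_eq_neg_left_of_integrable
      (μ := (volume : Measure (EuclideanSpace ℝ (Fin N)))) (f := fun _ ↦ (1 : ℝ))
      (f' := fun _ ↦ (0 : ℝ)) (g := fun x ↦ q η x * f x)
      (g' := fun x ↦ q' η x * f x + q η x * f' x) (v := v) (B := ContinuousLinearMap.mul ℝ ℝ)
      (by simp) (by simpa using hi1) (by simpa using hi2)
      (fun x _ ↦ by simpa [HasLineDerivAt] using hasDerivAt_const (0 : ℝ) (1 : ℝ))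
      (fun x _ ↦ hqf η hη x)
    simpa using this
  have hpos : ∀ n : ℕ, (0 : ℝ) < 1 / ((n : ℝ) + 1) := fun n ↦ by positivity
  have hlim0 : Filter.Tendsto (fun n : ℕ ↦ (1 : ℝ) / ((n : ℝ) + 1)) Filter.atTop (nhds 0) :=
    tendsto_one_div_add_atTop_nhds_zero_nat
  have hlim := tendsto_integral_of_dominated_convergence
    (μ := (volume : Measure (EuclideanSpace ℝ (Fin N))))
    (F := fun (n : ℕ) x ↦ q' (1 / ((n : ℝ) + 1)) x * f x + q (1 / ((n : ℝ) + 1)) x * f' x)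
    (f := f') (fun x ↦ (4 * ‖v‖ * φ x + φ' x) / ‖x‖ ^ 2)
    (fun n ↦ ((((hq'm _).mul hm).add ((hqm _).mul hm')).aestronglyMeasurable))
    (integrable_div_norm_sq hN hcont2 hcomp2)
    (fun n ↦ by
      filter_upwards [ae_ne_zero_euclidean hN] with x hx using hbound _ (hpos n) x hx)
    (by
      filter_upwards [ae_ne_zero_euclidean hN] with x hx
      have hx' : ‖x‖ ^ 2 + 0 ≠ 0 := by have := norm_pos_iff.2 hx; positivity
      have hc : ContinuousAt (fun η : ℝ ↦ q' η x * f x + q η x * f' x) 0 := by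
        simp only [q, q']
        have : (‖x‖ ^ 2 + 0) ^ 2 ≠ 0 := pow_ne_zero _ hx'
        fun_prop (disch := assumption)
      have h0 : q' 0 x * f x + q 0 x * f' x = f' x := by
        have : ‖x‖ ≠ 0 := norm_ne_zero_iff.2 hx
        simp [q, q', this]
      have h3 := hc.tendsto.comp hlim0
      rw [h0] at h3
      exact h3)
  simp only [hzero _ (hpos _)] at hlim
  exact (tendsto_nhds_unique hlim tendsto_const_nhds)

/-- The line derivative of a radial function, in terms of its Euler derivative `r g'(r)`. -/
lemma hasLineDerivAt_comp_norm {N : ℕ} {g g₁ : ℝ → ℝ}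
    (hg : ∀ r, 0 < r → HasDerivAt g (g₁ r / r) r) {x : EuclideanSpace ℝ (Fin N)} (hx : x ≠ 0)
    (v : EuclideanSpace ℝ (Fin N)) :
    HasLineDerivAt ℝ (fun y ↦ g ‖y‖) (g₁ ‖x‖ * inner ℝ x v / ‖x‖ ^ 2) x v := by
  have hx' : 0 < ‖x‖ := norm_pos_iff.2 hx
  have hl : HasDerivAt (fun τ : ℝ ↦ x + τ • v) v 0 := by
    simpa using ((hasDerivAt_id (0 : ℝ)).smul_const v).const_add x
  have h2 := hl.norm_sq.sqrt (by simp [hx])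
  simp only [Real.sqrt_sq (norm_nonneg _)] at h2
  have h3 := HasDerivAt.comp (0 : ℝ) (h₂ := g) (h := fun τ : ℝ ↦ ‖x + τ • v‖)
    (by simpa using hg ‖x‖ hx') h2
  refine h3.congr_deriv ?_
  simp only [zero_smul, add_zero]
  field_simp

/-- The denominator `r ^ (2 - α) + ε` of the Yosida approximation, as a function of `r = ‖x‖`. -/
def yosidaDenom (α ε r : ℝ) : ℝ := r ^ (2 - α) + ε

/-- The ratio `r ^ (2 - α) / (r ^ (2 - α) + ε)`. -/
def yosidaRatio (α ε r : ℝ) : ℝ := r ^ (2 - α) / yosidaDenom α ε r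

/-- The radial profile `W_ε ^ (p - 1) * ((A₀ + B t) + r ^ α (A₁ + B t))`, where `t` is
`yosidaRatio α ε r`. -/
def radialProfile (α ε p A₀ A₁ B r : ℝ) : ℝ :=
  yosidaDenom α ε r ^ (1 - p) *
    ((A₀ + B * yosidaRatio α ε r) + r ^ α * (A₁ + B * yosidaRatio α ε r))

/-- The Euler derivative `r d/dr` of `radialProfile`. -/
def radialProfileEuler (α ε p A₀ A₁ B r : ℝ) : ℝ :=
  yosidaDenom α ε r ^ (1 - p) *
    ((-((p - 1) * (2 - α) * yosidaRatio α ε r) * (A₀ + B * yosidaRatio α ε r)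
        + B * (2 - α) * yosidaRatio α ε r * (1 - yosidaRatio α ε r))
      + r ^ α * ((α - (p - 1) * (2 - α) * yosidaRatio α ε r) * (A₁ + B * yosidaRatio α ε r)
        + B * (2 - α) * yosidaRatio α ε r * (1 - yosidaRatio α ε r)))

lemma yosidaDenom_pos {α ε r : ℝ} (hε : 0 < ε) (hr : 0 ≤ r) : 0 < yosidaDenom α ε r := by
  unfold yosidaDenom; positivity

lemma yosidaRatio_nonneg {α ε r : ℝ} (hε : 0 < ε) (hr : 0 ≤ r) : 0 ≤ yosidaRatio α ε r :=
  div_nonneg (Real.rpow_nonneg hr _) (yosidaDenom_pos hε hr).le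

lemma yosidaRatio_le_one {α ε r : ℝ} (hε : 0 < ε) (hr : 0 ≤ r) : yosidaRatio α ε r ≤ 1 := by
  rw [yosidaRatio, div_le_one (yosidaDenom_pos hε hr), yosidaDenom]
  linarith

lemma hasDerivAt_radialProfile {α ε p A₀ A₁ B : ℝ} (hε : 0 < ε) {r : ℝ} (hr : 0 < r) :
    HasDerivAt (radialProfile α ε p A₀ A₁ B) (radialProfileEuler α ε p A₀ A₁ B r / r) r := by
  have hV : yosidaDenom α ε r ≠ 0 := (yosidaDenom_pos hε hr.le).ne'
  have hpow : ∀ γ : ℝ, HasDerivAt (fun r : ℝ ↦ r ^ γ) (γ * (r ^ γ / r)) r := fun γ ↦ by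
    have := Real.hasDerivAt_rpow_const (p := γ) (Or.inl hr.ne')
    rwa [Real.rpow_sub_one hr.ne'] at this
  have h1 : HasDerivAt (yosidaDenom α ε) ((2 - α) * (r ^ (2 - α) / r)) r :=
    (hpow (2 - α)).add_const ε
  have h2 := h1.rpow_const (p := 1 - p) (Or.inl hV)
  have h3 : HasDerivAt (yosidaRatio α ε) _ r := (hpow (2 - α)).div h1 hV
  have h4 := h2.mul (((h3.const_mul B).const_add A₀).add
    ((hpow α).mul ((h3.const_mul B).const_add A₁)))
  refine h4.congr_deriv ?_
  rw [Real.rpow_sub_one hV]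
  have e : r ^ (2 - α) = yosidaDenom α ε r - ε := by simp [yosidaDenom]
  have e2 : yosidaRatio α ε r = (yosidaDenom α ε r - ε) / yosidaDenom α ε r := by
    rw [yosidaRatio, e]
  simp only [radialProfileEuler, e2, e, Pi.add_apply, Pi.mul_apply]
  field_simp
  ring

lemma continuous_yosidaDenom_norm {N : ℕ} {α : ℝ} (ε : ℝ) (hα2 : α < 2) :
    Continuous fun x : EuclideanSpace ℝ (Fin N) ↦ yosidaDenom α ε ‖x‖ := by
  have := Real.continuous_rpow_const (q := 2 - α) (by linarith)
  unfold yosidaDenom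
  fun_prop

lemma continuous_yosidaRatio_norm {N : ℕ} {α ε : ℝ} (hε : 0 < ε) (hα2 : α < 2) :
    Continuous fun x : EuclideanSpace ℝ (Fin N) ↦ yosidaRatio α ε ‖x‖ := by
  have := Real.continuous_rpow_const (q := 2 - α) (by linarith)
  exact (by fun_prop : Continuous fun x : EuclideanSpace ℝ (Fin N) ↦ ‖x‖ ^ (2 - α)).div
    (continuous_yosidaDenom_norm ε hα2) fun x ↦ (yosidaDenom_pos hε (norm_nonneg x)).ne'

lemma continuous_yosidaDenom_norm_rpow {N : ℕ} {α ε : ℝ} (hε : 0 < ε) (hα2 : α < 2) (γ : ℝ) :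
    Continuous fun x : EuclideanSpace ℝ (Fin N) ↦ yosidaDenom α ε ‖x‖ ^ γ :=
  (continuous_yosidaDenom_norm ε hα2).rpow_const fun x ↦
    Or.inl (yosidaDenom_pos hε (norm_nonneg x)).ne'

lemma continuous_norm_rpow {N : ℕ} {γ : ℝ} (hγ : 0 ≤ γ) :
    Continuous fun x : EuclideanSpace ℝ (Fin N) ↦ ‖x‖ ^ γ :=
  (Real.continuous_rpow_const hγ).comp continuous_norm

lemma continuous_radialProfile_norm {N : ℕ} {α ε p A₀ A₁ B : ℝ} (hε : 0 < ε) (hα0 : 0 ≤ α)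
    (hα2 : α < 2) :
    Continuous fun x : EuclideanSpace ℝ (Fin N) ↦ radialProfile α ε p A₀ A₁ B ‖x‖ := by
  have h1 := continuous_yosidaDenom_norm_rpow (N := N) hε hα2 (1 - p)
  have h2 := continuous_yosidaRatio_norm (N := N) hε hα2
  have h3 := continuous_norm_rpow (N := N) hα0
  unfold radialProfile
  fun_prop

lemma continuous_radialProfileEuler_norm {N : ℕ} {α ε p A₀ A₁ B : ℝ} (hε : 0 < ε) (hα0 : 0 ≤ α)
    (hα2 : α < 2) :
    Continuous fun x : EuclideanSpace ℝ (Fin N) ↦ radialProfileEuler α ε p A₀ A₁ B ‖x‖ := by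
  have h1 := continuous_yosidaDenom_norm_rpow (N := N) hε hα2 (1 - p)
  have h2 := continuous_yosidaRatio_norm (N := N) hε hα2
  have h3 := continuous_norm_rpow (N := N) hα0
  unfold radialProfileEuler
  fun_prop

lemma abs_coord_le_norm {N : ℕ} (x : EuclideanSpace ℝ (Fin N)) (i : Fin N) : |x i| ≤ ‖x‖ :=
  PiLp.norm_apply_le x i

/-- Integration by parts of `k(x) Y(x)` in a coordinate direction, `k` being radial with Euler
derivative `k₁`. -/
lemma integral_radial_mul_lineDeriv {N : ℕ} (hN : 3 ≤ N) {k k₁ : EuclideanSpace ℝ (Fin N) → ℝ}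
    (hk : ∀ x, x ≠ 0 → ∀ v, HasLineDerivAt ℝ k (k₁ x * inner ℝ x v / ‖x‖ ^ 2) x v)
    (hkc : Continuous k) (hk₁c : Continuous k₁)
    {Y Y' : EuclideanSpace ℝ (Fin N) → ℝ} (hY : Continuous Y) (hYs : HasCompactSupport Y)
    (hY' : Continuous Y') (hYs' : HasCompactSupport Y') (i : Fin N)
    (hd : ∀ x, HasLineDerivAt ℝ Y (Y' x) x (EuclideanSpace.single i 1)) :
    Integrable (fun x ↦ k x * Y' x + k₁ x * x i / ‖x‖ ^ 2 * Y x) ∧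
      ∫ x, (k x * Y' x + k₁ x * x i / ‖x‖ ^ 2 * Y x) = 0 := by
  have hi : ∀ x : EuclideanSpace ℝ (Fin N),
      inner ℝ x (EuclideanSpace.single i (1 : ℝ)) = x i := fun x ↦ by
    simp [EuclideanSpace.inner_single_right]
  have hkm := hkc.measurable
  have hk₁m := hk₁c.measurable
  have hYm := hY.measurable
  have hYm' := hY'.measurable
  have m1 : Measurable (fun x ↦ k x * Y x) := by fun_prop
  have m2 : Measurable (fun x ↦ k x * Y' x + k₁ x * x i / ‖x‖ ^ 2 * Y x) := by fun_prop
  have c1 : Continuous (fun x ↦ ‖x‖ * |k x| * |Y x|) := by fun_prop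
  have c2 : Continuous (fun x ↦ ‖x‖ ^ 2 * |k x| * |Y' x| + |k₁ x| * ‖x‖ * |Y x|) := by fun_prop
  have s1 : HasCompactSupport (fun x ↦ ‖x‖ * |k x| * |Y x|) :=
    hYs.mono fun x hx h0 ↦ hx (by simp [h0])
  have s2 : HasCompactSupport (fun x ↦ ‖x‖ ^ 2 * |k x| * |Y' x| + |k₁ x| * ‖x‖ * |Y x|) :=
    .add (hYs'.mono fun x hx h0 ↦ hx (by simp [h0])) (hYs.mono fun x hx h0 ↦ hx (by simp [h0]))
  refine integral_lineDeriv_eq_zero_of_singular hN c1 s1 c2 s2 m1 m2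
    (v := EuclideanSpace.single i 1) ?_ ?_ ?_
  · intro x hx
    refine (HasDerivAt.mul (hk x hx _) (hd x)).congr_deriv ?_
    simp only [hi, zero_smul, add_zero]
    ring
  · intro x hx
    have hx' : 0 < ‖x‖ := norm_pos_iff.2 hx
    rw [abs_mul]
    exact le_of_eq (by field_simp)
  · intro x hx
    have hx' : 0 < ‖x‖ := norm_pos_iff.2 hx
    calc |k x * Y' x + k₁ x * x i / ‖x‖ ^ 2 * Y x|
        ≤ |k x| * |Y' x| + |k₁ x| * |x i| / ‖x‖ ^ 2 * |Y x| := by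
          refine (abs_add_le _ _).trans (le_of_eq ?_)
          rw [abs_mul, abs_mul, abs_div, abs_mul, abs_pow, abs_norm]
      _ ≤ |k x| * |Y' x| + |k₁ x| * ‖x‖ / ‖x‖ ^ 2 * |Y x| := by
          gcongr; exact abs_coord_le_norm x i
      _ = _ := by field_simp

/-- Integration by parts of `k(x) ‖x‖⁻² xᵢ G(x)` in the `i`-th direction, `k` being radial with
Euler derivative `k₁`. -/
lemma integral_radial_mul_coord_lineDeriv {N : ℕ} (hN : 3 ≤ N) {k k₁ : EuclideanSpace ℝ (Fin N) → ℝ}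
    (hk : ∀ x, x ≠ 0 → ∀ v, HasLineDerivAt ℝ k (k₁ x * inner ℝ x v / ‖x‖ ^ 2) x v)
    (hkc : Continuous k) (hk₁c : Continuous k₁)
    {G G' : EuclideanSpace ℝ (Fin N) → ℝ} (hG : Continuous G) (hGs : HasCompactSupport G)
    (hG' : Continuous G') (hGs' : HasCompactSupport G') (i : Fin N)
    (hd : ∀ x, HasLineDerivAt ℝ G (G' x) x (EuclideanSpace.single i 1)) :
    Integrable (fun x ↦ k x / ‖x‖ ^ 2 * (G x + x i * G' x) +
        (k₁ x - 2 * k x) / ‖x‖ ^ 2 * x i / ‖x‖ ^ 2 * (x i * G x)) ∧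
      ∫ x, (k x / ‖x‖ ^ 2 * (G x + x i * G' x) +
        (k₁ x - 2 * k x) / ‖x‖ ^ 2 * x i / ‖x‖ ^ 2 * (x i * G x)) = 0 := by
  have hi : ∀ x : EuclideanSpace ℝ (Fin N),
      inner ℝ x (EuclideanSpace.single i (1 : ℝ)) = x i := fun x ↦ by
    simp [EuclideanSpace.inner_single_right]
  have hkm := hkc.measurable
  have hk₁m := hk₁c.measurable
  have hGm := hG.measurable
  have hGm' := hG'.measurable
  have hkd : ∀ x, x ≠ 0 → ∀ v, HasLineDerivAt ℝ (fun x ↦ k x / ‖x‖ ^ 2)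
      ((k₁ x - 2 * k x) / ‖x‖ ^ 2 * inner ℝ x v / ‖x‖ ^ 2) x v := by
    intro x hx v
    have hx' : ‖x‖ ≠ 0 := norm_ne_zero_iff.2 hx
    have hl : HasDerivAt (fun τ : ℝ ↦ x + τ • v) v 0 := by
      simpa using ((hasDerivAt_id (0 : ℝ)).smul_const v).const_add x
    refine (HasDerivAt.div (hk x hx v) hl.norm_sq (by simpa using hx)).congr_deriv ?_
    simp only [zero_smul, add_zero]
    field_simp
  refine integral_lineDeriv_eq_zero_of_singular hN (f := fun x ↦ k x / ‖x‖ ^ 2 * (x i * G x))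
    (φ := fun x ↦ |k x| * |G x|)
    (φ' := fun x ↦ |k x| * |G x| + |k x| * ‖x‖ * |G' x| + |k₁ x - 2 * k x| * |G x|)
    (v := EuclideanSpace.single i 1)
    (by fun_prop) (HasCompactSupport.mul_left hGs.norm) (by fun_prop)
    (((HasCompactSupport.mul_left hGs.norm).add (HasCompactSupport.mul_left hGs'.norm)).add
      (HasCompactSupport.mul_left hGs.norm))
    (by fun_prop) (by fun_prop) ?_ ?_ ?_
  · intro x hx
    have hc : HasLineDerivAt ℝ (fun x : EuclideanSpace ℝ (Fin N) ↦ x i) 1 x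
        (EuclideanSpace.single i 1) := by
      have := (EuclideanSpace.proj (𝕜 := ℝ) i).hasFDerivAt.hasLineDerivAt (x := x)
        (EuclideanSpace.single i (1 : ℝ))
      simpa using this
    refine (HasDerivAt.mul (hkd x hx _)
      (HasDerivAt.mul hc (hd x))).congr_deriv ?_
    simp only [hi, zero_smul, add_zero, Pi.mul_apply]
    ring
  · intro x hx
    have hx' : 0 < ‖x‖ := norm_pos_iff.2 hx
    calc |k x / ‖x‖ ^ 2 * (x i * G x)| = |k x| / ‖x‖ ^ 2 * (|x i| * |G x|) := by
          rw [abs_mul, abs_mul, abs_div, abs_pow, abs_norm]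
      _ ≤ |k x| / ‖x‖ ^ 2 * (‖x‖ * |G x|) := by
          gcongr; exact abs_coord_le_norm x i
      _ = _ := by field_simp
  · intro x hx
    have hx' : 0 < ‖x‖ := norm_pos_iff.2 hx
    calc |k x / ‖x‖ ^ 2 * (G x + x i * G' x) +
          (k₁ x - 2 * k x) / ‖x‖ ^ 2 * x i / ‖x‖ ^ 2 * (x i * G x)|
        ≤ |k x| / ‖x‖ ^ 2 * (|G x| + |x i| * |G' x|) +
          |k₁ x - 2 * k x| / ‖x‖ ^ 2 * |x i| / ‖x‖ ^ 2 * (|x i| * |G x|) := by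
          refine (abs_add_le _ _).trans ?_
          simp only [abs_mul, abs_div, abs_pow, abs_norm]
          gcongr
          exact (abs_add_le _ _).trans (le_of_eq (by rw [abs_mul]))
      _ ≤ |k x| / ‖x‖ ^ 2 * (|G x| + ‖x‖ * |G' x|) +
          |k₁ x - 2 * k x| / ‖x‖ ^ 2 * ‖x‖ / ‖x‖ ^ 2 * (‖x‖ * |G x|) := by
          have := abs_coord_le_norm x i
          gcongr
      _ = _ := by field_simp

section Smooth

variable {N : ℕ} {u : EuclideanSpace ℝ (Fin N) → ℂ}

lemma contDiff_pdC (hu : ContDiff ℝ (⊤ : ℕ∞) u) (i : Fin N) :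
    ContDiff ℝ (⊤ : ℕ∞) (pdC i u) :=
  (hu.fderiv_right (m := (⊤ : ℕ∞)) (by simp)).clm_apply contDiff_const

lemma pdC_eq_zero_of_notMem_tsupport (i : Fin N) {x : EuclideanSpace ℝ (Fin N)}
    (hx : x ∉ tsupport u) : pdC i u x = 0 := by
  have : fderiv ℝ u x = 0 := by
    by_contra h
    exact hx (support_fderiv_subset ℝ h)
  simp [pdC, this]

lemma tsupport_pdC_subset (i : Fin N) : tsupport (pdC i u) ⊆ tsupport u := by
  refine closure_minimal (fun x hx ↦ ?_) (isClosed_tsupport u)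
  by_contra h
  exact hx (pdC_eq_zero_of_notMem_tsupport i h)

lemma hasLineDerivAt_pdC (hu : ContDiff ℝ (⊤ : ℕ∞) u) (i : Fin N)
    (x : EuclideanSpace ℝ (Fin N)) :
    HasLineDerivAt ℝ u (pdC i u x) x (EuclideanSpace.single i 1) :=
  ((hu.differentiable (by simp)) x).hasFDerivAt.hasLineDerivAt _

/-- The regularization `(|u|² + δ) ^ ((p - 2) / 2)` of `|u| ^ (p - 2)`. -/
def regWeight (u : EuclideanSpace ℝ (Fin N) → ℂ) (p δ : ℝ) (x : EuclideanSpace ℝ (Fin N)) : ℝ :=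
  (‖u x‖ ^ 2 + δ) ^ ((p - 2) / 2)

/-- The regularization `(|u|² + δ) ^ (p / 2) - δ ^ (p / 2)` of `|u| ^ p`. -/
def regPow (u : EuclideanSpace ℝ (Fin N) → ℂ) (p δ : ℝ) (x : EuclideanSpace ℝ (Fin N)) : ℝ :=
  (‖u x‖ ^ 2 + δ) ^ (p / 2) - δ ^ (p / 2)

/-- The real part of `ū ∂ᵢu`. -/
def reGrad (u : EuclideanSpace ℝ (Fin N) → ℂ) (i : Fin N) (x : EuclideanSpace ℝ (Fin N)) : ℝ :=
  inner ℝ (u x) (pdC i u x)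

lemma hasLineDerivAt_regSq_rpow (hu : ContDiff ℝ (⊤ : ℕ∞) u) {δ : ℝ} (hδ : 0 < δ) (s : ℝ)
    (i : Fin N) (x : EuclideanSpace ℝ (Fin N)) :
    HasLineDerivAt ℝ (fun y ↦ (‖u y‖ ^ 2 + δ) ^ s)
      (2 * s * (‖u x‖ ^ 2 + δ) ^ (s - 1) * reGrad u i x) x (EuclideanSpace.single i 1) := by
  have h := ((HasDerivAt.norm_sq (hasLineDerivAt_pdC hu i x)).add_const δ).rpow_const (p := s)
    (Or.inl (by positivity))
  refine h.congr_deriv ?_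
  simp only [reGrad, zero_smul, add_zero]
  ring

lemma continuous_regSq_rpow (hu : Continuous u) {δ : ℝ} (hδ : 0 < δ) (s : ℝ) :
    Continuous fun y ↦ (‖u y‖ ^ 2 + δ) ^ s :=
  (by fun_prop : Continuous fun y ↦ ‖u y‖ ^ 2 + δ).rpow_const fun x ↦ Or.inl (by positivity)

lemma continuous_reGrad (hu : ContDiff ℝ (⊤ : ℕ∞) u) (i : Fin N) : Continuous (reGrad u i) :=
  hu.continuous.inner (contDiff_pdC hu i).continuous

lemma hasCompactSupport_of_zero_off_tsupport (hus : HasCompactSupport u)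
    {F : Type*} [Zero F] {f : EuclideanSpace ℝ (Fin N) → F}
    (h : ∀ x, x ∉ tsupport u → f x = 0) : HasCompactSupport f :=
  HasCompactSupport.intro hus h

lemma reGrad_eq_zero_of_notMem_tsupport (i : Fin N) {x : EuclideanSpace ℝ (Fin N)}
    (hx : x ∉ tsupport u) : reGrad u i x = 0 := by
  simp [reGrad, pdC_eq_zero_of_notMem_tsupport i hx]

lemma hasLineDerivAt_reGrad (hu : ContDiff ℝ (⊤ : ℕ∞) u) (i : Fin N)
    (x : EuclideanSpace ℝ (Fin N)) :
    HasLineDerivAt ℝ (reGrad u i) (inner ℝ (u x) (pdC i (pdC i u) x) + ‖pdC i u x‖ ^ 2) x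
      (EuclideanSpace.single i 1) := by
  have h := HasDerivAt.inner ℝ (hasLineDerivAt_pdC hu i x)
    (hasLineDerivAt_pdC (contDiff_pdC hu i) i x)
  refine h.congr_deriv ?_
  simp

/-- The weak form of the radially weighted divergence of `|u|^{p-2} Re(ū∇u)`, regularized. -/
lemma integral_regWeight_laplacian (hN : 3 ≤ N) {k k₁ : EuclideanSpace ℝ (Fin N) → ℝ}
    (hk : ∀ x, x ≠ 0 → ∀ v, HasLineDerivAt ℝ k (k₁ x * inner ℝ x v / ‖x‖ ^ 2) x v)
    (hkc : Continuous k) (hk₁c : Continuous k₁)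
    (hu : ContDiff ℝ (⊤ : ℕ∞) u) (hus : HasCompactSupport u) (p : ℝ) {δ : ℝ} (hδ : 0 < δ) :
    let E : EuclideanSpace ℝ (Fin N) → ℝ := fun x ↦
      k x * (regWeight u p δ x * (∑ i, inner ℝ (u x) (pdC i (pdC i u) x))
        + regWeight u p δ x * (∑ i, ‖pdC i u x‖ ^ 2)
        + (p - 2) * (regWeight u p δ x / (‖u x‖ ^ 2 + δ)) * ∑ i, reGrad u i x ^ 2)
      + k₁ x / ‖x‖ ^ 2 * regWeight u p δ x * ∑ i, x i * reGrad u i x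
    Integrable E ∧ ∫ x, E x = 0 := by
  intro E
  have hc1 := hu.continuous
  have hc2 := fun i ↦ (contDiff_pdC hu i).continuous
  have hc3 := fun i ↦ (contDiff_pdC (contDiff_pdC hu i) i).continuous
  have hc4 := continuous_reGrad hu
  have hc5 : Continuous (regWeight u p δ) := continuous_regSq_rpow hc1 hδ _
  have hq : ∀ x, ‖u x‖ ^ 2 + δ ≠ 0 := fun x ↦ by positivity
  have key := fun i ↦ integral_radial_mul_lineDeriv hN hk hkc hk₁c
    (Y := fun x ↦ regWeight u p δ x * reGrad u i x)
    (Y' := fun x ↦ (p - 2) * (regWeight u p δ x / (‖u x‖ ^ 2 + δ)) * reGrad u i x ^ 2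
      + regWeight u p δ x * (inner ℝ (u x) (pdC i (pdC i u) x) + ‖pdC i u x‖ ^ 2))
    (by fun_prop)
    (hasCompactSupport_of_zero_off_tsupport hus fun x hx ↦ by
      simp [reGrad_eq_zero_of_notMem_tsupport i hx])
    (by
      have := (hc1.inner (𝕜 := ℝ) (hc3 i))
      fun_prop (disch := exact hq))
    (hasCompactSupport_of_zero_off_tsupport hus fun x hx ↦ by
      simp [reGrad_eq_zero_of_notMem_tsupport i hx, pdC_eq_zero_of_notMem_tsupport i hx,
        image_eq_zero_of_notMem_tsupport hx])
    i
    (fun x ↦ by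
      refine (HasDerivAt.mul (hasLineDerivAt_regSq_rpow hu hδ ((p - 2) / 2) i x)
        (hasLineDerivAt_reGrad hu i x)).congr_deriv ?_
      simp only [regWeight, zero_smul, add_zero, Real.rpow_sub_one (hq x)]
      ring)
  have hE : E = fun x ↦ ∑ i, (k x * ((p - 2) * (regWeight u p δ x / (‖u x‖ ^ 2 + δ)) *
      reGrad u i x ^ 2 + regWeight u p δ x * (inner ℝ (u x) (pdC i (pdC i u) x)
        + ‖pdC i u x‖ ^ 2)) + k₁ x * x i / ‖x‖ ^ 2 * (regWeight u p δ x * reGrad u i x)) := by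
    funext x
    simp only [E, Finset.mul_sum, mul_add, ← Finset.sum_add_distrib]
    refine Finset.sum_congr rfl fun i _ ↦ ?_
    ring
  rw [hE]
  refine ⟨integrable_finsetSum _ fun i _ ↦ (key i).1, ?_⟩
  rw [integral_finsetSum _ fun i _ ↦ (key i).1]
  exact Finset.sum_eq_zero fun i _ ↦ (key i).2

/-- The weak form of the divergence of the radial field `k(x) ‖x‖⁻² x` against `|u|^p`,
regularized. -/
lemma integral_regPow_radial_div (hN : 3 ≤ N) {k k₁ : EuclideanSpace ℝ (Fin N) → ℝ}
    (hk : ∀ x, x ≠ 0 → ∀ v, HasLineDerivAt ℝ k (k₁ x * inner ℝ x v / ‖x‖ ^ 2) x v)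
    (hkc : Continuous k) (hk₁c : Continuous k₁)
    (hu : ContDiff ℝ (⊤ : ℕ∞) u) (hus : HasCompactSupport u) (p : ℝ) {δ : ℝ} (hδ : 0 < δ) :
    let E : EuclideanSpace ℝ (Fin N) → ℝ := fun x ↦
      (k x * (p * regWeight u p δ x * ∑ i, x i * reGrad u i x)
        + regPow u p δ x * ((N - 2) * k x + k₁ x)) / ‖x‖ ^ 2
    Integrable E ∧ ∫ x, E x = 0 := by
  intro E
  have hc1 := hu.continuous
  have hc4 := continuous_reGrad hu
  have hc5 : Continuous (regWeight u p δ) := continuous_regSq_rpow hc1 hδ _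
  have hc6 : Continuous (regPow u p δ) := (continuous_regSq_rpow hc1 hδ _).sub continuous_const
  have hq : ∀ x, ‖u x‖ ^ 2 + δ ≠ 0 := fun x ↦ by positivity
  have key := fun i ↦ integral_radial_mul_coord_lineDeriv hN hk hkc hk₁c
    (G := regPow u p δ) (G' := fun x ↦ p * regWeight u p δ x * reGrad u i x)
    hc6
    (hasCompactSupport_of_zero_off_tsupport hus fun x hx ↦ by
      simp [regPow, image_eq_zero_of_notMem_tsupport hx])
    (by fun_prop)
    (hasCompactSupport_of_zero_off_tsupport hus fun x hx ↦ by
      simp [reGrad_eq_zero_of_notMem_tsupport i hx])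
    i
    (fun x ↦ by
      refine (HasDerivAt.sub_const _ (hasLineDerivAt_regSq_rpow hu hδ (p / 2) i x)).congr_deriv ?_
      rw [regWeight, show p / 2 - 1 = (p - 2) / 2 by ring]
      ring)
  have hE : E =ᵐ[volume] fun x ↦ ∑ i, (k x / ‖x‖ ^ 2 *
      (regPow u p δ x + x i * (p * regWeight u p δ x * reGrad u i x)) +
        (k₁ x - 2 * k x) / ‖x‖ ^ 2 * x i / ‖x‖ ^ 2 * (x i * regPow u p δ x)) := by
    filter_upwards [ae_ne_zero_euclidean hN] with x hx
    have hx' : ‖x‖ ≠ 0 := norm_ne_zero_iff.2 hx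
    have hs : ∑ i, x i ^ 2 = ‖x‖ ^ 2 := (EuclideanSpace.real_norm_sq_eq x).symm
    have h1 : ∑ i, (k₁ x - 2 * k x) / ‖x‖ ^ 2 * x i / ‖x‖ ^ 2 * (x i * regPow u p δ x)
        = (k₁ x - 2 * k x) / ‖x‖ ^ 2 / ‖x‖ ^ 2 * regPow u p δ x * ∑ i, x i ^ 2 := by
      rw [Finset.mul_sum]
      exact Finset.sum_congr rfl fun i _ ↦ by ring
    have h2 : ∑ i, k x / ‖x‖ ^ 2 *
        (regPow u p δ x + x i * (p * regWeight u p δ x * reGrad u i x))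
        = k x / ‖x‖ ^ 2 * (N * regPow u p δ x
          + p * regWeight u p δ x * ∑ i, x i * reGrad u i x) := by
      rw [← Finset.mul_sum, Finset.sum_add_distrib, Finset.mul_sum]
      simp only [Finset.sum_const, Finset.card_univ, Fintype.card_fin, nsmul_eq_mul]
      congr 2
      exact Finset.sum_congr rfl fun i _ ↦ by ring
    rw [Finset.sum_add_distrib, h1, h2, hs]
    simp only [E]
    field_simp
    ring
  refine ⟨(integrable_finsetSum _ fun i _ ↦ (key i).1).congr hE.symm, ?_⟩
  rw [integral_congr_ae hE, integral_finsetSum _ fun i _ ↦ (key i).1]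
  exact Finset.sum_eq_zero fun i _ ↦ (key i).2

end Smooth

/-- The coefficient `(A₀ + B t) + y (A₁ + B t)` of the radial vector field used in the integration
by parts is `-(2(p-1)(f₀ + y f₁)) + (gradient of the diffusion coefficient) - (drift)`;
completing the squares yields this pointwise lower bound. -/
lemma pointwise_square_completion {p w σ q y U Z L S Q Y R G G' s t α b c n f₀ f₁ A₀ A₁ B h h₁ : ℝ}
    (hp1 : 1 < p) (hw : 0 ≤ w) (hσ : 0 ≤ σ) (hq : 0 < q) (hy : 0 ≤ y) (hUq : U ≤ q) (hS : 0 ≤ S)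
    (hR : 0 < R) (hQ : Q ≤ U * S) (hY : Y ^ 2 ≤ R * Q) (hG' : σ * q ≤ G')
    (hf₀ : f₀ = (n - s * t) / p) (hf₁ : f₁ = (n + α - s * t) / p)
    (hA₀ : A₀ = -2 * (p - 1) * n / p) (hA₁ : A₁ = α - 2 * (p - 1) * (n + α) / p - b)
    (hB : B = -s + 2 * (p - 1) * s / p) (hh : h = w * ((A₀ + B * t) + y * (A₁ + B * t))) :
    (G * (-(n * h + h₁) / p) - (p - 1) * w * (f₀ ^ 2 + y * f₁ ^ 2) * G'
        + w * y * (c + Z) * (U * σ)) / R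
      ≤ w * σ * (-(1 + y) * L - b * (y / R) * Y + (c * (y / R) + y * Z / R) * U)
        + (w * (1 + y) * (σ * L + σ * S + (p - 2) * (σ / q) * Q)
          + w * (-(s * t) + y * (α - s * t)) / R * σ * Y)
        - (h * (p * σ * Y) + G * (n * h + h₁)) / R / p := by
  have hp0 : p ≠ 0 := by linarith
  have hc0 : 0 ≤ σ / q := by positivity
  have hcq : σ / q * q = σ := by field_simp
  set k := σ / q with hk
  have e1 : (p - 1) * k * Y ^ 2 ≤ R * (σ * S + (p - 2) * k * Q) := by
    have h1 : k * Q ≤ σ * S := by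
      rw [← hcq, mul_assoc]
      exact mul_le_mul_of_nonneg_left
        (hQ.trans (mul_le_mul_of_nonneg_right hUq hS)) hc0
    have h2 : (p - 1) * k * Y ^ 2 ≤ (p - 1) * k * (R * Q) :=
      mul_le_mul_of_nonneg_left hY (mul_nonneg (by linarith) hc0)
    have h3 := mul_le_mul_of_nonneg_left h1 hR.le
    nlinarith
  have e2 : k * q ^ 2 ≤ G' := by
    rw [pow_two, ← mul_assoc, hcq]; exact hG'
  have e3 : 0 ≤ (1 + y) * (R * (σ * S + (p - 2) * k * Q)) + 2 * (p - 1) * σ * Y * (f₀ + y * f₁)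
      + (p - 1) * (f₀ ^ 2 + y * f₁ ^ 2) * G' := by
    have h1 := mul_le_mul_of_nonneg_left e1 (by linarith : 0 ≤ 1 + y)
    have h2 := mul_le_mul_of_nonneg_left e2
      (mul_nonneg (by linarith : 0 ≤ p - 1) (by positivity : 0 ≤ f₀ ^ 2 + y * f₁ ^ 2))
    have h3 : 0 ≤ (p - 1) * k * ((Y + f₀ * q) ^ 2 + y * (Y + f₁ * q) ^ 2) := by
      have : 0 ≤ p - 1 := by linarith
      positivity
    have h4 : 2 * (p - 1) * σ * Y * (f₀ + y * f₁)
        = 2 * (p - 1) * (k * q) * Y * (f₀ + y * f₁) := by rw [hcq]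
    rw [h4]
    nlinarith
  have e4 : -(b * y) - s * t + y * (α - s * t) - (A₀ + B * t) - y * (A₁ + B * t)
      = 2 * (p - 1) * (f₀ + y * f₁) := by
    rw [hA₀, hA₁, hB, hf₀, hf₁]
    field_simp
    ring
  rw [← sub_nonneg]
  have e5 : w * σ * (-(1 + y) * L - b * (y / R) * Y + (c * (y / R) + y * Z / R) * U)
        + (w * (1 + y) * (σ * L + σ * S + (p - 2) * k * Q)
          + w * (-(s * t) + y * (α - s * t)) / R * σ * Y)
        - (h * (p * σ * Y) + G * (n * h + h₁)) / R / p
      - (G * (-(n * h + h₁) / p) - (p - 1) * w * (f₀ ^ 2 + y * f₁ ^ 2) * G'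
        + w * y * (c + Z) * (U * σ)) / R
      = w / R * ((1 + y) * (R * (σ * S + (p - 2) * k * Q))
        + (-(b * y) - s * t + y * (α - s * t) - (A₀ + B * t) - y * (A₁ + B * t)) * (σ * Y)
        + (p - 1) * (f₀ ^ 2 + y * f₁ ^ 2) * G') := by
    rw [hh]
    field_simp
    ring
  rw [e5, e4]
  refine mul_nonneg (by positivity) ?_
  linarith [e3]

/-- Comparison of the coefficient produced by the square completion with its affine interpolation
in `t`. -/
lemma coefficient_lower_bound {p α b c n s t y Z f₀ f₁ A₀ A₁ B k₁ k₂ k₃ k₄ p' : ℝ}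
    (hp1 : 1 < p) (hα2 : α < 2) (ht0 : 0 ≤ t) (ht1 : t ≤ 1) (hy : 0 ≤ y) (hZ : 0 ≤ Z)
    (hs : s = (p - 1) * (2 - α)) (hp' : p' = p / (p - 1))
    (hf₀ : f₀ = (n - s * t) / p) (hf₁ : f₁ = (n + α - s * t) / p)
    (hA₀ : A₀ = -2 * (p - 1) * n / p) (hA₁ : A₁ = α - 2 * (p - 1) * (n + α) / p - b)
    (hB : B = -s + 2 * (p - 1) * s / p)
    (hk₁ : k₁ = (α - 2 + (n + 2) / p) * (-α + b + (n + 2) / p') + c)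
    (hk₂ : k₂ = (α / p' - 2 + (n + 2) / p) * (-(α / p') + (n + 2) / p'))
    (hk₃ : k₃ = (α + n) / p * (b + (-α + (p - 1) * n) / p) + c)
    (hk₄ : k₄ = (p - 1) * (n / p) ^ 2) :
    k₁ * y * t + k₂ * t + k₃ * y * (1 - t) + k₄ * (1 - t) + y * t * Z ≤
      -(n * ((A₀ + B * t) + y * (A₁ + B * t))
          + ((-(s * t) * (A₀ + B * t) + B * (2 - α) * t * (1 - t))
            + y * ((α - s * t) * (A₁ + B * t) + B * (2 - α) * t * (1 - t)))) / p
        - (p - 1) * (f₀ ^ 2 + y * f₁ ^ 2) + y * (c + Z) := by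
  have hp0 : p ≠ 0 := by linarith
  have hpm : p - 1 ≠ 0 := by linarith
  rw [← sub_nonneg]
  have e : -(n * ((A₀ + B * t) + y * (A₁ + B * t))
          + ((-(s * t) * (A₀ + B * t) + B * (2 - α) * t * (1 - t))
            + y * ((α - s * t) * (A₁ + B * t) + B * (2 - α) * t * (1 - t)))) / p
        - (p - 1) * (f₀ ^ 2 + y * f₁ ^ 2) + y * (c + Z)
        - (k₁ * y * t + k₂ * t + k₃ * y * (1 - t) + k₄ * (1 - t) + y * t * Z)
      = (p - 1) * ((2 - α) / p) ^ 2 * (t * (1 - t)) * (1 + y) + y * Z * (1 - t) := by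
    subst hs hp' hf₀ hf₁ hA₀ hA₁ hB hk₁ hk₂ hk₃ hk₄
    field_simp
    ring
  rw [e]
  have h1 : 0 ≤ 1 - t := by linarith
  have h2 : 0 ≤ p - 1 := by linarith
  positivity

section Limit

variable {N : ℕ} {u : EuclideanSpace ℝ (Fin N) → ℂ}

lemma regWeight_zero (p : ℝ) (x : EuclideanSpace ℝ (Fin N)) :
    regWeight u p 0 x = ‖u x‖ ^ (p - 2) := by
  rw [regWeight, add_zero, ← Real.rpow_natCast ‖u x‖ 2, ← Real.rpow_mul (norm_nonneg _)]
  congr 1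
  push_cast
  ring

lemma regPow_zero {p : ℝ} (hp : 1 < p) (x : EuclideanSpace ℝ (Fin N)) :
    regPow u p 0 x = ‖u x‖ ^ p := by
  rw [regPow, add_zero, Real.zero_rpow (by linarith), sub_zero, ← Real.rpow_natCast ‖u x‖ 2,
    ← Real.rpow_mul (norm_nonneg _)]
  congr 1
  push_cast
  ring

lemma regWeight_nonneg {δ : ℝ} (hδ : 0 ≤ δ) (p : ℝ) (x : EuclideanSpace ℝ (Fin N)) :
    0 ≤ regWeight u p δ x :=
  Real.rpow_nonneg (by positivity) _

lemma norm_mul_regWeight_le {p δ : ℝ} (hp : 1 < p) (hδ : 0 ≤ δ) (hδ1 : δ ≤ 1)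
    (x : EuclideanSpace ℝ (Fin N)) :
    ‖u x‖ * regWeight u p δ x ≤ (‖u x‖ ^ 2 + 1) ^ ((p - 1) / 2) := by
  rcases (norm_nonneg (u x)).eq_or_lt with h | h
  · rw [← h, zero_mul]; positivity
  have hq : 0 < ‖u x‖ ^ 2 + δ := by positivity
  calc ‖u x‖ * regWeight u p δ x
      ≤ (‖u x‖ ^ 2 + δ) ^ (1 / 2 : ℝ) * regWeight u p δ x := by
        refine mul_le_mul_of_nonneg_right ?_ (regWeight_nonneg hδ p x)
        rw [← Real.sqrt_eq_rpow]
        exact Real.le_sqrt_of_sq_le (by linarith)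
    _ = (‖u x‖ ^ 2 + δ) ^ ((p - 1) / 2) := by
        rw [regWeight, ← Real.rpow_add hq]; congr 1; ring
    _ ≤ _ := Real.rpow_le_rpow hq.le (by linarith) (by linarith)

lemma regPow_nonneg {p δ : ℝ} (hp : 1 < p) (hδ : 0 ≤ δ) (x : EuclideanSpace ℝ (Fin N)) :
    0 ≤ regPow u p δ x :=
  sub_nonneg.2 (Real.rpow_le_rpow hδ (by nlinarith [norm_nonneg (u x)]) (by linarith))

lemma regPow_le {p δ : ℝ} (hp : 1 < p) (hδ : 0 ≤ δ) (hδ1 : δ ≤ 1)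
    (x : EuclideanSpace ℝ (Fin N)) :
    regPow u p δ x ≤ (‖u x‖ ^ 2 + 1) ^ (p / 2) :=
  (sub_le_self _ (Real.rpow_nonneg hδ _)).trans
    (Real.rpow_le_rpow (by positivity) (by linarith) (by linarith))

lemma measurable_regWeight (hu : Continuous u) (p δ : ℝ) : Measurable (regWeight u p δ) := by
  have := hu.measurable
  unfold regWeight
  fun_prop

lemma measurable_regPow (hu : Continuous u) (p δ : ℝ) : Measurable (regPow u p δ) := by
  have := hu.measurable
  unfold regPow
  fun_prop

lemma continuousAt_regWeight {x : EuclideanSpace ℝ (Fin N)} (hx : u x ≠ 0) (p : ℝ) :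
    ContinuousAt (fun δ ↦ regWeight u p δ x) 0 := by
  have h : ‖u x‖ ^ 2 + 0 ≠ 0 := by simpa using hx
  exact (by fun_prop : ContinuousAt (fun δ : ℝ ↦ ‖u x‖ ^ 2 + δ) 0).rpow_const (Or.inl h)

lemma continuous_regPow_param {p : ℝ} (hp : 1 < p) (x : EuclideanSpace ℝ (Fin N)) :
    Continuous (fun δ ↦ regPow u p δ x) := by
  have := Real.continuous_rpow_const (q := p / 2) (by linarith)
  unfold regPow
  fun_prop

/-- Integrability and convergence of `∫ Re(A ū) (|u|² + δ) ^ ((p - 2) / 2)` as `δ → 0`. -/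
lemma integrable_and_tendsto_main (hN : 3 ≤ N) (hu : Continuous u) {p : ℝ} (hp : 1 < p)
    {A : EuclideanSpace ℝ (Fin N) → ℂ} {Φ : EuclideanSpace ℝ (Fin N) → ℝ} (hA : Measurable A)
    (hΦ : Continuous Φ) (hΦs : HasCompactSupport Φ)
    (hAΦ : ∀ x, x ≠ 0 → ‖A x‖ ≤ Φ x / ‖x‖ ^ 2) :
    (∀ δ, 0 ≤ δ → δ ≤ 1 → Integrable fun x ↦ inner ℝ (u x) (A x) * regWeight u p δ x) ∧
    Filter.Tendsto (fun n : ℕ ↦ ∫ x, inner ℝ (u x) (A x) * regWeight u p (1 / ((n : ℝ) + 1)) x)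
      Filter.atTop
      (nhds (∫ x, A x * (starRingEnd ℂ) (u x) * ((‖u x‖ ^ (p - 2) : ℝ) : ℂ)).re) := by
  have hum := hu.measurable
  set Ψ : EuclideanSpace ℝ (Fin N) → ℝ := fun x ↦ Φ x * (‖u x‖ ^ 2 + 1) ^ ((p - 1) / 2) with hΨdef
  have hΨ : Continuous Ψ := hΦ.mul (continuous_regSq_rpow hu one_pos _)
  have hΨs : HasCompactSupport Ψ := hΦs.mul_right
  have hbase : ∀ δ, 0 ≤ δ → δ ≤ 1 → ∀ x, x ≠ 0 →
      ‖A x‖ * (‖u x‖ * regWeight u p δ x) ≤ Ψ x / ‖x‖ ^ 2 := by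
    intro δ h0 h1 x hx
    calc ‖A x‖ * (‖u x‖ * regWeight u p δ x)
        ≤ Φ x / ‖x‖ ^ 2 * (‖u x‖ ^ 2 + 1) ^ ((p - 1) / 2) :=
          mul_le_mul (hAΦ x hx) (norm_mul_regWeight_le hp h0 h1 x)
            (mul_nonneg (norm_nonneg _) (regWeight_nonneg h0 p x))
            ((norm_nonneg _).trans (hAΦ x hx))
      _ = _ := by simp only [hΨdef]; ring
  have hbd : ∀ δ, 0 ≤ δ → δ ≤ 1 → ∀ x, x ≠ 0 →
      ‖(inner ℝ (u x) (A x) : ℝ) * regWeight u p δ x‖ ≤ Ψ x / ‖x‖ ^ 2 := by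
    intro δ h0 h1 x hx
    refine le_trans ?_ (hbase δ h0 h1 x hx)
    rw [norm_mul, Real.norm_of_nonneg (regWeight_nonneg h0 p x)]
    calc _ ≤ ‖u x‖ * ‖A x‖ * regWeight u p δ x :=
          mul_le_mul_of_nonneg_right (norm_inner_le_norm _ _) (regWeight_nonneg h0 p x)
      _ = _ := by ring
  have hmeas : ∀ δ, Measurable fun x ↦ (inner ℝ (u x) (A x) : ℝ) * regWeight u p δ x :=
    fun δ ↦ (hum.inner hA).mul (measurable_regWeight hu p δ)
  refine ⟨fun δ h0 h1 ↦ integrable_of_norm_le_div_norm_sq hN hΨ hΨs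
    (hmeas δ).aestronglyMeasurable (hbd δ h0 h1), ?_⟩
  have hcint : Integrable fun x ↦ A x * (starRingEnd ℂ) (u x) * ((‖u x‖ ^ (p - 2) : ℝ) : ℂ) := by
    refine integrable_of_norm_le_div_norm_sq hN hΨ hΨs ?_ fun x hx ↦ ?_
    · have h1 : Measurable fun x ↦ (starRingEnd ℂ) (u x) :=
        (Complex.continuous_conj.comp hu).measurable
      have h2 : Measurable fun x ↦ ((‖u x‖ ^ (p - 2) : ℝ) : ℂ) := by fun_prop
      exact ((hA.mul h1).mul h2).aestronglyMeasurable
    · have := hbase 0 le_rfl zero_le_one x hx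
      rw [regWeight_zero] at this
      rw [norm_mul, norm_mul, RCLike.norm_conj, Complex.norm_real,
        Real.norm_of_nonneg (Real.rpow_nonneg (norm_nonneg _) _)]
      linarith
  have hre : (∫ x, A x * (starRingEnd ℂ) (u x) * ((‖u x‖ ^ (p - 2) : ℝ) : ℂ)).re
      = ∫ x, inner ℝ (u x) (A x) * regWeight u p 0 x := by
    refine (integral_re hcint).symm.trans (integral_congr_ae (.of_forall fun x ↦ ?_))
    simp only [regWeight_zero, Complex.inner, RCLike.re_eq_complex_re, Complex.re_mul_ofReal]
  rw [hre]
  have hlim0 : Filter.Tendsto (fun n : ℕ ↦ (1 : ℝ) / ((n : ℝ) + 1)) Filter.atTop (nhds 0) :=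
    tendsto_one_div_add_atTop_nhds_zero_nat
  refine tendsto_integral_of_dominated_convergence (fun x ↦ Ψ x / ‖x‖ ^ 2)
    (fun n ↦ (hmeas _).aestronglyMeasurable) (integrable_div_norm_sq hN hΨ hΨs) (fun n ↦ ?_)
    (.of_forall fun x ↦ ?_)
  · filter_upwards [ae_ne_zero_euclidean hN] with x hx
    refine hbd _ (by positivity) ?_ x hx
    rw [div_le_one (by positivity)]
    linarith [(Nat.cast_nonneg n : (0 : ℝ) ≤ n)]
  · by_cases hx : u x = 0
    · simp [hx]
    · exact ((continuousAt_regWeight hx p).tendsto.comp hlim0).const_mul _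

/-- The regularized lower bound density. -/
def lowerDensity (u : EuclideanSpace ℝ (Fin N) → ℂ) (p : ℝ)
    (T₁ T₂ T₃ χ : EuclideanSpace ℝ (Fin N) → ℝ) (δ : ℝ) (x : EuclideanSpace ℝ (Fin N)) : ℝ :=
  (regPow u p δ x * T₁ x - T₂ x * (regPow u p δ x + δ ^ (p / 2) * χ x)
    + T₃ x * (‖u x‖ ^ 2 * regWeight u p δ x)) / ‖x‖ ^ 2

lemma integrable_and_tendsto_lowerDensity (hN : 3 ≤ N) (hu : Continuous u) {p : ℝ} (hp : 1 < p)
    {T₁ T₂ T₃ χ : EuclideanSpace ℝ (Fin N) → ℝ} (hT₁ : Continuous T₁) (hT₂ : Continuous T₂)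
    (hT₃ : Continuous T₃) (hχ : Continuous χ) (hχs : HasCompactSupport χ) (hχ0 : ∀ x, 0 ≤ χ x)
    (hχ1 : ∀ x, u x ≠ 0 → 1 ≤ χ x) :
    (∀ δ, 0 ≤ δ → δ ≤ 1 → Integrable (lowerDensity u p T₁ T₂ T₃ χ δ)) ∧
    Filter.Tendsto (fun n : ℕ ↦ ∫ x, lowerDensity u p T₁ T₂ T₃ χ (1 / ((n : ℝ) + 1)) x)
      Filter.atTop (nhds (∫ x, lowerDensity u p T₁ T₂ T₃ χ 0 x)) := by
  have hum := hu.measurable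
  have hP := continuous_regSq_rpow hu one_pos (p / 2)
  have hP' := continuous_regSq_rpow hu one_pos ((p - 1) / 2)
  set P := fun x ↦ (‖u x‖ ^ 2 + 1) ^ (p / 2) with hPdef
  set P' := fun x ↦ (‖u x‖ ^ 2 + 1) ^ ((p - 1) / 2) with hP'def
  set Ψ : EuclideanSpace ℝ (Fin N) → ℝ := fun x ↦
    χ x * (P x * |T₁ x| + |T₂ x| * (P x + 1) + |T₃ x| * (‖u x‖ * P' x)) with hΨdef
  have hΨ : Continuous Ψ := by fun_prop
  have hΨs : HasCompactSupport Ψ := hχs.mul_right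
  have hG : ∀ δ, 0 ≤ δ → δ ≤ 1 → ∀ x, regPow u p δ x ≤ χ x * P x := by
    intro δ h0 h1 x
    have hPx : 0 ≤ P x := by simp only [hPdef]; positivity
    by_cases hx : u x = 0
    · have : regPow u p δ x = 0 := by simp [regPow, hx]
      rw [this]
      exact mul_nonneg (hχ0 x) hPx
    · exact (regPow_le hp h0 h1 x).trans (le_mul_of_one_le_left hPx (hχ1 x hx))
  have hv : ∀ δ, 0 ≤ δ → δ ≤ 1 → ∀ x, ‖u x‖ ^ 2 * regWeight u p δ x ≤ χ x * (‖u x‖ * P' x) := by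
    intro δ h0 h1 x
    have hPx : 0 ≤ P' x := by simp only [hP'def]; positivity
    by_cases hx : u x = 0
    · simp [hx]
    · refine le_trans ?_ (le_mul_of_one_le_left (by positivity) (hχ1 x hx))
      rw [pow_two, mul_assoc]
      exact mul_le_mul_of_nonneg_left (norm_mul_regWeight_le hp h0 h1 x) (norm_nonneg _)
  have hbd : ∀ δ, 0 ≤ δ → δ ≤ 1 → ∀ x, x ≠ 0 →
      ‖lowerDensity u p T₁ T₂ T₃ χ δ x‖ ≤ Ψ x / ‖x‖ ^ 2 := by
    intro δ h0 h1 x hx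
    have hG0 := regPow_nonneg (u := u) hp h0 x
    have hv0 : 0 ≤ ‖u x‖ ^ 2 * regWeight u p δ x :=
      mul_nonneg (by positivity) (regWeight_nonneg h0 p x)
    have hδ0 : 0 ≤ δ ^ (p / 2) := Real.rpow_nonneg h0 _
    have hδ1 : δ ^ (p / 2) ≤ 1 := Real.rpow_le_one h0 h1 (by linarith)
    have hχx := hχ0 x
    rw [lowerDensity, norm_div, norm_pow, norm_norm, Real.norm_eq_abs]
    gcongr
    calc _ ≤ |regPow u p δ x * T₁ x| + |T₂ x * (regPow u p δ x + δ ^ (p / 2) * χ x)|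
          + |T₃ x * (‖u x‖ ^ 2 * regWeight u p δ x)| :=
          (abs_add_le _ _).trans (add_le_add_left (abs_sub _ _) _)
      _ = regPow u p δ x * |T₁ x| + |T₂ x| * (regPow u p δ x + δ ^ (p / 2) * χ x)
          + |T₃ x| * (‖u x‖ ^ 2 * regWeight u p δ x) := by
          rw [abs_mul, abs_mul, abs_mul, abs_of_nonneg hG0, abs_of_nonneg hv0,
            abs_of_nonneg (by positivity : 0 ≤ regPow u p δ x + δ ^ (p / 2) * χ x)]
      _ ≤ (χ x * P x) * |T₁ x| + |T₂ x| * (χ x * P x + 1 * χ x)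
          + |T₃ x| * (χ x * (‖u x‖ * P' x)) := by
          refine add_le_add (add_le_add ?_ ?_)
            (mul_le_mul_of_nonneg_left (hv δ h0 h1 x) (abs_nonneg _))
          · gcongr
            exact hG δ h0 h1 x
          · gcongr
            exact hG δ h0 h1 x
      _ = _ := by simp only [hΨdef]; ring
  have hmeas : ∀ δ, Measurable (lowerDensity u p T₁ T₂ T₃ χ δ) := by
    intro δ
    have h1 := measurable_regWeight hu p δ
    have h2 := measurable_regPow hu p δ
    have := hT₁.measurable
    have := hT₂.measurable
    have := hT₃.measurable
    have := hχ.measurable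
    unfold lowerDensity
    fun_prop
  refine ⟨fun δ h0 h1 ↦ integrable_of_norm_le_div_norm_sq hN hΨ hΨs
    (hmeas δ).aestronglyMeasurable (hbd δ h0 h1), ?_⟩
  have hlim0 : Filter.Tendsto (fun n : ℕ ↦ (1 : ℝ) / ((n : ℝ) + 1)) Filter.atTop (nhds 0) :=
    tendsto_one_div_add_atTop_nhds_zero_nat
  refine tendsto_integral_of_dominated_convergence (fun x ↦ Ψ x / ‖x‖ ^ 2)
    (fun n ↦ (hmeas _).aestronglyMeasurable) (integrable_div_norm_sq hN hΨ hΨs) (fun n ↦ ?_)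
    (.of_forall fun x ↦ ?_)
  · filter_upwards [ae_ne_zero_euclidean hN] with x hx
    refine hbd _ (by positivity) ?_ x hx
    rw [div_le_one (by positivity)]
    linarith [(Nat.cast_nonneg n : (0 : ℝ) ≤ n)]
  · have hc1 := (continuous_regPow_param (u := u) hp x).continuousAt (x := 0)
    have hc2 : ContinuousAt (fun δ : ℝ ↦ δ ^ (p / 2)) 0 :=
      (Real.continuous_rpow_const (by linarith)).continuousAt
    have hc3 : ContinuousAt (fun δ ↦ ‖u x‖ ^ 2 * regWeight u p δ x) 0 := by
      by_cases hx : u x = 0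
      · simpa [hx] using continuousAt_const
      · exact (continuousAt_regWeight hx p).const_mul _
    have hc : ContinuousAt (fun δ ↦ lowerDensity u p T₁ T₂ T₃ χ δ x) 0 :=
      (((hc1.mul_const _).sub ((hc1.add (hc2.mul_const _)).const_mul _)).add
        (hc3.const_mul _)).div_const _
    exact hc.tendsto.comp hlim0

end Limit

section Lower

variable {N : ℕ} {u : EuclideanSpace ℝ (Fin N) → ℂ}

lemma Weps_rpow {ε : ℝ} (hε : 0 < ε) (α s : ℝ) (x : EuclideanSpace ℝ (Fin N)) :
    Weps α ε x ^ s = yosidaDenom α ε ‖x‖ ^ (-s) := by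
  rw [Weps, one_div, ← yosidaDenom, Real.inv_rpow (yosidaDenom_pos hε (norm_nonneg x)).le,
    Real.rpow_neg (yosidaDenom_pos hε (norm_nonneg x)).le]

lemma rpow_sub_two {r : ℝ} (hr : 0 < r) (α : ℝ) : r ^ (α - 2) = r ^ α / r ^ 2 := by
  rw [Real.rpow_sub hr, Real.rpow_two]

lemma rpow_eq_mul_div_sq {r : ℝ} (hr : 0 < r) (α β : ℝ) :
    r ^ β = r ^ α * r ^ (β - α + 2) / r ^ 2 := by
  rw [← Real.rpow_add hr, ← Real.rpow_two, ← Real.rpow_sub hr]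
  congr 1
  ring

lemma inner_neg_Abc_mul (α β b c w : ℝ) {x : EuclideanSpace ℝ (Fin N)} (hx : x ≠ 0) :
    inner ℝ (u x) (-Abc α β b c u x * (w : ℂ)) =
      w * (-(1 + ‖x‖ ^ α) * (∑ i, inner ℝ (u x) (pdC i (pdC i u) x))
        - b * (‖x‖ ^ α / ‖x‖ ^ 2) * (∑ i, x i * reGrad u i x)
        + (c * (‖x‖ ^ α / ‖x‖ ^ 2) + ‖x‖ ^ α * ‖x‖ ^ (β - α + 2) / ‖x‖ ^ 2) * ‖u x‖ ^ 2) := by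
  have hr : 0 < ‖x‖ := norm_pos_iff.2 hx
  rw [mul_comm, ← Complex.real_smul, inner_smul_right, inner_neg_right, Abc]
  simp only [← Complex.real_smul, inner_sub_right, inner_add_right, inner_smul_right, lapC,
    inner_sum, real_inner_self_eq_norm_sq, rpow_sub_two hr, ← rpow_eq_mul_div_sq hr α β, reGrad]
  ring

lemma norm_neg_Abc_mul_le (α β b c : ℝ) {w : ℝ} (hw : 0 ≤ w) {x : EuclideanSpace ℝ (Fin N)}
    (hx : x ≠ 0) :
    ‖-Abc α β b c u x * (w : ℂ)‖ ≤
      w * (‖x‖ ^ 2 * (1 + ‖x‖ ^ α) * ‖lapC u x‖ + |b| * ‖x‖ ^ α * ‖∑ i, (x i : ℂ) * pdC i u x‖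
        + |c| * ‖x‖ ^ α * ‖u x‖ + ‖x‖ ^ α * ‖x‖ ^ (β - α + 2) * ‖u x‖) / ‖x‖ ^ 2 := by
  have hr : 0 < ‖x‖ := norm_pos_iff.2 hx
  have hy : 0 ≤ ‖x‖ ^ α := Real.rpow_nonneg hr.le _
  have h : ‖Abc α β b c u x‖ ≤ (1 + ‖x‖ ^ α) * ‖lapC u x‖
      + |b| * (‖x‖ ^ α / ‖x‖ ^ 2) * ‖∑ i, (x i : ℂ) * pdC i u x‖
      + |c| * (‖x‖ ^ α / ‖x‖ ^ 2) * ‖u x‖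
      + ‖x‖ ^ α * ‖x‖ ^ (β - α + 2) / ‖x‖ ^ 2 * ‖u x‖ := by
    rw [Abc, rpow_sub_two hr, ← rpow_eq_mul_div_sq hr α β]
    refine (norm_sub_le _ _).trans (add_le_add ((norm_sub_le _ _).trans
      (add_le_add ((norm_add_le _ _).trans (add_le_add ?_ ?_)) ?_)) ?_)
    · rw [norm_mul, Complex.norm_real, Real.norm_of_nonneg (by positivity)]
    · rw [norm_mul, Complex.norm_real, norm_mul, Real.norm_eq_abs,
        Real.norm_of_nonneg (by positivity)]
    · rw [norm_mul, Complex.norm_real, norm_mul, Real.norm_eq_abs,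
        Real.norm_of_nonneg (by positivity)]
    · rw [norm_mul, Complex.norm_real, Real.norm_of_nonneg (by positivity)]
  rw [norm_mul, norm_neg, Complex.norm_real, Real.norm_of_nonneg hw]
  refine (mul_le_mul_of_nonneg_right h hw).trans (le_of_eq ?_)
  field_simp

lemma sum_reGrad_sq_le (x : EuclideanSpace ℝ (Fin N)) :
    ∑ i, reGrad u i x ^ 2 ≤ ‖u x‖ ^ 2 * ∑ i, ‖pdC i u x‖ ^ 2 := by
  rw [Finset.mul_sum]
  refine Finset.sum_le_sum fun i _ ↦ ?_
  rw [← mul_pow, sq_le_sq, abs_of_nonneg (by positivity : 0 ≤ ‖u x‖ * ‖pdC i u x‖)]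
  exact abs_real_inner_le_norm _ _

lemma sq_sum_coord_mul_le (x : EuclideanSpace ℝ (Fin N)) (g : Fin N → ℝ) :
    (∑ i, x i * g i) ^ 2 ≤ ‖x‖ ^ 2 * ∑ i, g i ^ 2 := by
  rw [EuclideanSpace.real_norm_sq_eq]
  exact Finset.sum_mul_sq_le_sq_mul_sq _ _ _

/-- The regularized lower bound holds pointwise up to two total divergences. -/
lemma lowerDensity_le {p α β ε b c f₀ f₁ A₀ A₁ B s δ : ℝ}
    {T₁ T₂ T₃ χ : EuclideanSpace ℝ (Fin N) → ℝ} (hε : 0 < ε) (hp1 : 1 < p) (hδ : 0 < δ)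
    (hχ0 : ∀ x, 0 ≤ χ x) (hχ1 : ∀ x ∈ tsupport u, 1 ≤ χ x)
    {x : EuclideanSpace ℝ (Fin N)} (hx : x ≠ 0) (hs : s = (p - 1) * (2 - α))
    (hf₀ : f₀ = ((N - 2) - s * yosidaRatio α ε ‖x‖) / p)
    (hf₁ : f₁ = ((N - 2) + α - s * yosidaRatio α ε ‖x‖) / p)
    (hA₀ : A₀ = -2 * (p - 1) * (N - 2) / p) (hA₁ : A₁ = α - 2 * (p - 1) * ((N - 2) + α) / p - b)
    (hB : B = -s + 2 * (p - 1) * s / p)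
    (hT₁ : T₁ x = -((N - 2) * radialProfile α ε p A₀ A₁ B ‖x‖
      + radialProfileEuler α ε p A₀ A₁ B ‖x‖) / p)
    (hT₂ : T₂ x = (p - 1) * yosidaDenom α ε ‖x‖ ^ (1 - p) * (f₀ ^ 2 + ‖x‖ ^ α * f₁ ^ 2))
    (hT₃ : T₃ x = yosidaDenom α ε ‖x‖ ^ (1 - p) * ‖x‖ ^ α * (c + ‖x‖ ^ (β - α + 2))) :
    lowerDensity u p T₁ T₂ T₃ χ δ x ≤
      inner ℝ (u x) (-Abc α β b c u x * ((Weps α ε x ^ (p - 1) : ℝ) : ℂ)) * regWeight u p δ x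
      + (radialProfile α ε p 1 1 0 ‖x‖ * (regWeight u p δ x *
          (∑ i, inner ℝ (u x) (pdC i (pdC i u) x))
        + regWeight u p δ x * (∑ i, ‖pdC i u x‖ ^ 2)
        + (p - 2) * (regWeight u p δ x / (‖u x‖ ^ 2 + δ)) * ∑ i, reGrad u i x ^ 2)
      + radialProfileEuler α ε p 1 1 0 ‖x‖ / ‖x‖ ^ 2 * regWeight u p δ x *
          ∑ i, x i * reGrad u i x)
      - (radialProfile α ε p A₀ A₁ B ‖x‖ * (p * regWeight u p δ x * ∑ i, x i * reGrad u i x)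
        + regPow u p δ x * ((N - 2) * radialProfile α ε p A₀ A₁ B ‖x‖
          + radialProfileEuler α ε p A₀ A₁ B ‖x‖)) / ‖x‖ ^ 2 / p := by
  have hr : 0 < ‖x‖ := norm_pos_iff.2 hx
  have hy : 0 ≤ ‖x‖ ^ α := Real.rpow_nonneg hr.le _
  have hw : 0 ≤ yosidaDenom α ε ‖x‖ ^ (1 - p) :=
    Real.rpow_nonneg (yosidaDenom_pos hε hr.le).le _
  have hδp : 0 ≤ δ ^ (p / 2) := Real.rpow_nonneg hδ.le _
  by_cases hxs : x ∈ tsupport u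
  · have hq : 0 < ‖u x‖ ^ 2 + δ := by positivity
    have hG' : regWeight u p δ x * (‖u x‖ ^ 2 + δ) ≤ regPow u p δ x + δ ^ (p / 2) * χ x := by
      have : regWeight u p δ x * (‖u x‖ ^ 2 + δ) = (‖u x‖ ^ 2 + δ) ^ (p / 2) := by
        rw [regWeight, ← Real.rpow_add_one hq.ne']
        congr 1
        ring
      rw [this, regPow]
      nlinarith [hχ1 x hxs]
    have key := pointwise_square_completion (Z := ‖x‖ ^ (β - α + 2))
      (L := ∑ i, inner ℝ (u x) (pdC i (pdC i u) x)) (c := c) (G := regPow u p δ x)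
      (h₁ := radialProfileEuler α ε p A₀ A₁ B ‖x‖)
      hp1 hw (regWeight_nonneg hδ.le p x) hq hy (le_add_of_nonneg_right hδ.le)
      (Finset.sum_nonneg fun i _ ↦ by positivity) (pow_pos hr 2) (sum_reGrad_sq_le x)
      (sq_sum_coord_mul_le x fun i ↦ reGrad u i x) hG' hf₀ hf₁ hA₀ hA₁ hB
      (show radialProfile α ε p A₀ A₁ B ‖x‖ = _ from rfl)
    have hk : radialProfile α ε p 1 1 0 ‖x‖
        = yosidaDenom α ε ‖x‖ ^ (1 - p) * (1 + ‖x‖ ^ α) := by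
      simp only [radialProfile]; ring
    have hk₁ : radialProfileEuler α ε p 1 1 0 ‖x‖ = yosidaDenom α ε ‖x‖ ^ (1 - p) *
        (-(s * yosidaRatio α ε ‖x‖) + ‖x‖ ^ α * (α - s * yosidaRatio α ε ‖x‖)) := by
      simp only [radialProfileEuler, hs]; ring
    rw [lowerDensity, hT₁, hT₂, hT₃, inner_neg_Abc_mul α β b c _ hx, Weps_rpow hε, neg_sub,
      hk, hk₁]
    refine (le_of_eq ?_).trans (key.trans (le_of_eq ?_)) <;> ring
  · have hu0 : u x = 0 := image_eq_zero_of_notMem_tsupport hxs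
    have hG0 : regPow u p δ x = 0 := by simp [regPow, hu0]
    simp only [lowerDensity, hu0, hG0, reGrad_eq_zero_of_notMem_tsupport _ hxs,
      pdC_eq_zero_of_notMem_tsupport _ hxs, inner_zero_left, norm_zero]
    have h2 : 0 ≤ T₂ x := by
      have : 0 ≤ p - 1 := by linarith
      rw [hT₂]
      positivity
    have h3 := mul_nonneg h2 (mul_nonneg hδp (hχ0 x))
    simp only [Finset.sum_const_zero, mul_zero, zero_mul, zero_add, add_zero,
      zero_sub, sub_zero, zero_div, ne_eq, OfNat.ofNat_ne_zero, not_false_eq_true, zero_pow]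
    exact div_nonpos_of_nonpos_of_nonneg (by linarith) (by positivity)

/-- The target density is bounded by the unregularized lower bound. -/
lemma target_le_lowerDensity {p p' α β ε b c f₀ f₁ A₀ A₁ B s k₁ k₂ k₃ k₄ : ℝ}
    {T₁ T₂ T₃ χ : EuclideanSpace ℝ (Fin N) → ℝ} (hε : 0 < ε) (hp1 : 1 < p) (hα2 : α < 2)
    {x : EuclideanSpace ℝ (Fin N)} (hx : x ≠ 0) (hs : s = (p - 1) * (2 - α))
    (hp' : p' = p / (p - 1))
    (hk₁ : k₁ = (α - 2 + (N : ℝ) / p) * (-α + b + (N : ℝ) / p') + c)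
    (hk₂ : k₂ = (α / p' - 2 + (N : ℝ) / p) * (-(α / p') + (N : ℝ) / p'))
    (hk₃ : k₃ = (α - 2 + (N : ℝ)) / p * (b + (-α + (p - 1) * ((N : ℝ) - 2)) / p) + c)
    (hk₄ : k₄ = (p - 1) * (((N : ℝ) - 2) / p) ^ 2)
    (hf₀ : f₀ = ((N - 2) - s * yosidaRatio α ε ‖x‖) / p)
    (hf₁ : f₁ = ((N - 2) + α - s * yosidaRatio α ε ‖x‖) / p)
    (hA₀ : A₀ = -2 * (p - 1) * (N - 2) / p) (hA₁ : A₁ = α - 2 * (p - 1) * ((N - 2) + α) / p - b)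
    (hB : B = -s + 2 * (p - 1) * s / p)
    (hT₁ : T₁ x = -((N - 2) * radialProfile α ε p A₀ A₁ B ‖x‖
      + radialProfileEuler α ε p A₀ A₁ B ‖x‖) / p)
    (hT₂ : T₂ x = (p - 1) * yosidaDenom α ε ‖x‖ ^ (1 - p) * (f₀ ^ 2 + ‖x‖ ^ α * f₁ ^ 2))
    (hT₃ : T₃ x = yosidaDenom α ε ‖x‖ ^ (1 - p) * ‖x‖ ^ α * (c + ‖x‖ ^ (β - α + 2))) :
    Weps α ε x ^ p * ‖u x‖ ^ p *
        (k₁ + k₂ * ‖x‖ ^ (-α) + ε * k₃ * ‖x‖ ^ (α - 2) + ε * k₄ * ‖x‖ ^ (-2 : ℝ)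
          + ‖x‖ ^ (β - α + 2)) ≤ lowerDensity u p T₁ T₂ T₃ χ 0 x := by
  have hr : 0 < ‖x‖ := norm_pos_iff.2 hx
  have hy : 0 < ‖x‖ ^ α := Real.rpow_pos_of_pos hr _
  have hZ : 0 ≤ ‖x‖ ^ (β - α + 2) := Real.rpow_nonneg hr.le _
  have hV : 0 < yosidaDenom α ε ‖x‖ := yosidaDenom_pos hε hr.le
  have hw : 0 < yosidaDenom α ε ‖x‖ ^ (1 - p) := Real.rpow_pos_of_pos hV _
  have key := coefficient_lower_bound (k₁ := k₁) (k₂ := k₂) (k₃ := k₃) (k₄ := k₄) (c := c)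
    hp1 hα2 (yosidaRatio_nonneg hε hr.le) (yosidaRatio_le_one hε hr.le)
    hy.le hZ hs hp' hf₀ hf₁ hA₀ hA₁ hB (by rw [hk₁]; ring) (by rw [hk₂]; ring)
    (by rw [hk₃]; ring) hk₄
  have hup : ‖u x‖ ^ 2 * ‖u x‖ ^ (p - 2) = ‖u x‖ ^ p := by
    rcases (norm_nonneg (u x)).eq_or_lt with h | h
    · rw [← h, Real.zero_rpow (by linarith : p ≠ 0)]; simp
    · rw [Real.rpow_sub h, Real.rpow_two]; field_simp
  have hVp : Weps α ε x ^ p = yosidaDenom α ε ‖x‖ ^ (1 - p) / yosidaDenom α ε ‖x‖ := by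
    rw [Weps_rpow hε, ← Real.rpow_sub_one hV.ne']
    congr 1
    ring
  have hX : ‖x‖ ^ 2 = ‖x‖ ^ α * ‖x‖ ^ (2 - α) := by
    rw [← Real.rpow_add hr, ← Real.rpow_two]
    congr 1
    ring
  have hXpos : 0 < ‖x‖ ^ (2 - α) := Real.rpow_pos_of_pos hr _
  have hε' : ε = yosidaDenom α ε ‖x‖ * (1 - yosidaRatio α ε ‖x‖) := by
    rw [yosidaRatio, yosidaDenom]
    field_simp
    ring
  have hL : Weps α ε x ^ p * ‖u x‖ ^ p *
        (k₁ + k₂ * ‖x‖ ^ (-α) + ε * k₃ * ‖x‖ ^ (α - 2) + ε * k₄ * ‖x‖ ^ (-2 : ℝ)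
          + ‖x‖ ^ (β - α + 2)) = yosidaDenom α ε ‖x‖ ^ (1 - p) * ‖u x‖ ^ p / ‖x‖ ^ 2 *
      (k₁ * ‖x‖ ^ α * yosidaRatio α ε ‖x‖ + k₂ * yosidaRatio α ε ‖x‖
        + k₃ * ‖x‖ ^ α * (1 - yosidaRatio α ε ‖x‖) + k₄ * (1 - yosidaRatio α ε ‖x‖)
        + ‖x‖ ^ α * yosidaRatio α ε ‖x‖ * ‖x‖ ^ (β - α + 2)) := by
    have e : 1 - yosidaRatio α ε ‖x‖ = ε / yosidaDenom α ε ‖x‖ := by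
      rw [eq_div_iff hV.ne', mul_comm]; exact hε'.symm
    rw [e, hVp, Real.rpow_neg hr.le, Real.rpow_neg hr.le, rpow_sub_two hr, Real.rpow_two, hX,
      yosidaRatio]
    field_simp
  rw [hL, lowerDensity, regPow_zero hp1, regWeight_zero, hup, Real.zero_rpow (by linarith), hT₁,
    hT₂, hT₃]
  refine (mul_le_mul_of_nonneg_left key (by positivity)).trans (le_of_eq ?_)
  simp only [radialProfile, radialProfileEuler, ← hs]
  ring

end Lower

theorem stmt8 (N : ℕ) (hN : 3 ≤ N) (α β b c : ℝ) (hα0 : 0 ≤ α) (hα2 : α < 2) (hβ : 0 < β)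
    (p : ℝ) (hp1 : 1 < p) (hp2 : p ≤ ((N : ℝ) - α) / (2 - α))
    (p' : ℝ) (hp' : p' = p / (p - 1))
    (k₁ k₂ k₃ k₄ : ℝ)
    (hk₁ : k₁ = (α - 2 + (N : ℝ) / p) * (-α + b + (N : ℝ) / p') + c)
    (hk₂ : k₂ = (α / p' - 2 + (N : ℝ) / p) * (-(α / p') + (N : ℝ) / p'))
    (hk₃ : k₃ = (α - 2 + (N : ℝ)) / p * (b + (-α + (p - 1) * ((N : ℝ) - 2)) / p) + c)
    (hk₄ : k₄ = (p - 1) * (((N : ℝ) - 2) / p) ^ 2)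
    (ε : ℝ) (hε : 0 < ε) (u : EuclideanSpace ℝ (Fin N) → ℂ)
    (hu : ContDiff ℝ (⊤ : ℕ∞) u) (hus : HasCompactSupport u) :
    (∫ x, (-Abc α β b c u x) * ((Weps α ε x ^ (p - 1) : ℝ) : ℂ) *
        (starRingEnd ℂ) (u x) * ((‖u x‖ ^ (p - 2) : ℝ) : ℂ)).re ≥
      ∫ x, Weps α ε x ^ p * ‖u x‖ ^ p *
        (k₁ + k₂ * ‖x‖ ^ (-α) + ε * k₃ * ‖x‖ ^ (α - 2) + ε * k₄ * ‖x‖ ^ (-2 : ℝ)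
          + ‖x‖ ^ (β - α + 2)) := by
  obtain ⟨s, hs⟩ : ∃ s, s = (p - 1) * (2 - α) := ⟨_, rfl⟩
  obtain ⟨A₀, hA₀⟩ : ∃ A₀, A₀ = -2 * (p - 1) * ((N : ℝ) - 2) / p := ⟨_, rfl⟩
  obtain ⟨A₁, hA₁⟩ : ∃ A₁, A₁ = α - 2 * (p - 1) * (((N : ℝ) - 2) + α) / p - b := ⟨_, rfl⟩
  obtain ⟨B, hB⟩ : ∃ B, B = -s + 2 * (p - 1) * s / p := ⟨_, rfl⟩
  set T₁ : EuclideanSpace ℝ (Fin N) → ℝ := fun x ↦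
    -(((N : ℝ) - 2) * radialProfile α ε p A₀ A₁ B ‖x‖
      + radialProfileEuler α ε p A₀ A₁ B ‖x‖) / p with hT₁
  set T₂ : EuclideanSpace ℝ (Fin N) → ℝ := fun x ↦
    (p - 1) * yosidaDenom α ε ‖x‖ ^ (1 - p) *
      (((((N : ℝ) - 2) - s * yosidaRatio α ε ‖x‖) / p) ^ 2
        + ‖x‖ ^ α * ((((N : ℝ) - 2) + α - s * yosidaRatio α ε ‖x‖) / p) ^ 2) with hT₂
  set T₃ : EuclideanSpace ℝ (Fin N) → ℝ := fun x ↦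
    yosidaDenom α ε ‖x‖ ^ (1 - p) * ‖x‖ ^ α * (c + ‖x‖ ^ (β - α + 2)) with hT₃
  obtain ⟨ρ, hρ⟩ := hus.isCompact.isBounded.subset_closedBall 0
  set χ : EuclideanSpace ℝ (Fin N) → ℝ := fun x ↦ max 0 (ρ + 1 - ‖x‖) with hχ
  have hχ0 : ∀ x, 0 ≤ χ x := fun x ↦ le_max_left _ _
  have hχ1 : ∀ x ∈ tsupport u, 1 ≤ χ x := fun x hx ↦ by
    have := mem_closedBall_zero_iff.1 (hρ hx)
    exact le_max_of_le_right (by linarith)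
  have hχs : HasCompactSupport χ :=
    .intro (isCompact_closedBall (0 : EuclideanSpace ℝ (Fin N)) (ρ + 1)) fun x hx ↦ by
      rw [mem_closedBall_zero_iff, not_le] at hx
      exact max_eq_left (by linarith)
  have hχc : Continuous χ := by fun_prop
  have huc := hu.continuous
  have hgc := fun i ↦ (contDiff_pdC hu i).continuous
  have hlc : Continuous (lapC u) := by
    have := fun i ↦ (contDiff_pdC (contDiff_pdC hu i) i).continuous
    unfold lapC
    fun_prop
  have hVc := continuous_yosidaDenom_norm_rpow (N := N) hε hα2
  have htc := continuous_yosidaRatio_norm (N := N) hε hα2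
  have hyc := continuous_norm_rpow (N := N) hα0
  have hZc := continuous_norm_rpow (N := N) (γ := β - α + 2) (by linarith)
  have hkc := fun A₀ A₁ B ↦
    continuous_radialProfile_norm (N := N) (p := p) (A₀ := A₀) (A₁ := A₁) (B := B) hε hα0 hα2
  have hk₁c := fun A₀ A₁ B ↦
    continuous_radialProfileEuler_norm (N := N) (p := p) (A₀ := A₀) (A₁ := A₁) (B := B) hε hα0 hα2
  have hVc' := hVc (1 - p)
  have hT₁c : Continuous T₁ := by
    have := hkc A₀ A₁ B
    have := hk₁c A₀ A₁ B
    fun_prop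
  have hT₂c : Continuous T₂ := by fun_prop
  have hT₃c : Continuous T₃ := by fun_prop
  have hk := fun A₀ A₁ B (x : EuclideanSpace ℝ (Fin N)) (hx : x ≠ 0) ↦
    hasLineDerivAt_comp_norm (g := radialProfile α ε p A₀ A₁ B)
      (fun r hr ↦ hasDerivAt_radialProfile hε hr) hx
  obtain ⟨hLint, hLlim⟩ := integrable_and_tendsto_lowerDensity hN huc hp1 hT₁c hT₂c hT₃c hχc hχs hχ0
    fun x hx ↦ hχ1 x (subset_tsupport _ hx)
  obtain ⟨hMint, hMlim⟩ := integrable_and_tendsto_main hN huc hp1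
    (A := fun x ↦ -Abc α β b c u x * ((Weps α ε x ^ (p - 1) : ℝ) : ℂ))
    (Φ := fun x ↦ yosidaDenom α ε ‖x‖ ^ (1 - p) *
      (‖x‖ ^ 2 * (1 + ‖x‖ ^ α) * ‖lapC u x‖ + |b| * ‖x‖ ^ α * ‖∑ i, (x i : ℂ) * pdC i u x‖
        + |c| * ‖x‖ ^ α * ‖u x‖ + ‖x‖ ^ α * ‖x‖ ^ (β - α + 2) * ‖u x‖))
    (by
      have := huc.measurable
      have := hlc.measurable
      have := fun i ↦ (hgc i).measurable
      unfold Abc Weps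
      fun_prop)
    (by
      have : Continuous fun x : EuclideanSpace ℝ (Fin N) ↦ ∑ i, (x i : ℂ) * pdC i u x := by
        fun_prop
      fun_prop)
    (hasCompactSupport_of_zero_off_tsupport hus fun x hx ↦ by
      have h2 : ∀ i, pdC i (pdC i u) x = 0 := fun i ↦
        pdC_eq_zero_of_notMem_tsupport i fun h ↦ hx (tsupport_pdC_subset i h)
      simp [lapC, h2, pdC_eq_zero_of_notMem_tsupport _ hx, image_eq_zero_of_notMem_tsupport hx])
    (fun x hx ↦ by
      rw [Weps_rpow hε, neg_sub]
      exact norm_neg_Abc_mul_le α β b c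
        (Real.rpow_nonneg (yosidaDenom_pos hε (norm_nonneg x)).le _) hx)
  have hreg : ∀ n : ℕ, ∫ x, lowerDensity u p T₁ T₂ T₃ χ (1 / ((n : ℝ) + 1)) x ≤
      ∫ x, inner ℝ (u x) (-Abc α β b c u x * ((Weps α ε x ^ (p - 1) : ℝ) : ℂ))
        * regWeight u p (1 / ((n : ℝ) + 1)) x := by
    intro n
    have hδ : 0 < 1 / ((n : ℝ) + 1) := by positivity
    have hδ1 : 1 / ((n : ℝ) + 1) ≤ 1 := by
      rw [div_le_one (by positivity)]
      linarith [(Nat.cast_nonneg n : (0 : ℝ) ≤ n)]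
    obtain ⟨i1, e1⟩ := integral_regWeight_laplacian hN (hk 1 1 0) (hkc 1 1 0) (hk₁c 1 1 0) hu hus p
      hδ
    obtain ⟨i2, e2⟩ := integral_regPow_radial_div hN (hk A₀ A₁ B) (hkc A₀ A₁ B) (hk₁c A₀ A₁ B)
      hu hus p hδ
    have hM := hMint _ hδ.le hδ1
    have hle := integral_mono_ae (hLint _ hδ.le hδ1) ((hM.add i1).sub (i2.div_const p)) (by
      filter_upwards [ae_ne_zero_euclidean hN] with x hx
      exact lowerDensity_le hε hp1 hδ hχ0 hχ1 hx hs rfl rfl hA₀ hA₁ hB rfl rfl rfl)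
    refine hle.trans (le_of_eq ?_)
    rw [integral_sub' (hM.add i1) (i2.div_const p), integral_add' hM i1, integral_div, e1, e2]
    simp
  refine ge_iff_le.2 (le_trans ?_ (le_of_tendsto_of_tendsto' hLlim hMlim hreg))
  refine integral_mono_ae ?_ (hLint 0 le_rfl zero_le_one) ?_
  · have h1 := continuous_norm_rpow (N := N) (γ := 2 - α) (by linarith)
    have h2 : Continuous fun x ↦ ‖u x‖ ^ p :=
      (Real.continuous_rpow_const (by linarith)).comp huc.norm
    have h3 := hVc (-p)
    refine integrable_of_norm_le_div_norm_sq hN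
      (φ := fun x ↦ ‖u x‖ ^ p * (yosidaDenom α ε ‖x‖ ^ (-p) *
        |k₁ * ‖x‖ ^ 2 + k₂ * ‖x‖ ^ (2 - α) + ε * k₃ * ‖x‖ ^ α + ε * k₄
          + ‖x‖ ^ 2 * ‖x‖ ^ (β - α + 2)|)) (by fun_prop) ?_ ?_ fun x hx ↦ le_of_eq ?_
    · exact hasCompactSupport_of_zero_off_tsupport hus fun x hx ↦ by
        rw [image_eq_zero_of_notMem_tsupport hx, norm_zero, Real.zero_rpow (by linarith), zero_mul]
    · have := huc.measurable
      refine Measurable.aestronglyMeasurable ?_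
      unfold Weps
      fun_prop
    · have hr : 0 < ‖x‖ := norm_pos_iff.2 hx
      have e : k₁ * ‖x‖ ^ 2 + k₂ * ‖x‖ ^ (2 - α) + ε * k₃ * ‖x‖ ^ α + ε * k₄
          + ‖x‖ ^ 2 * ‖x‖ ^ (β - α + 2) = ‖x‖ ^ 2 * (k₁ + k₂ * ‖x‖ ^ (-α)
          + ε * k₃ * ‖x‖ ^ (α - 2) + ε * k₄ * ‖x‖ ^ (-2 : ℝ) + ‖x‖ ^ (β - α + 2)) := by
        rw [rpow_sub_two hr, Real.rpow_sub hr, Real.rpow_neg hr.le, Real.rpow_neg hr.le,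
          Real.rpow_two]
        field_simp
      rw [e, Weps_rpow hε, abs_mul, norm_mul, norm_mul, Real.norm_eq_abs, Real.norm_eq_abs,
        Real.norm_eq_abs, abs_of_pos (pow_pos hr 2),
        abs_of_nonneg (Real.rpow_nonneg (norm_nonneg (u x)) p),
        abs_of_nonneg (Real.rpow_nonneg (yosidaDenom_pos hε (norm_nonneg x)).le _)]
      field_simp
  · filter_upwards [ae_ne_zero_euclidean hN] with x hx
    exact target_le_lowerDensity hε hp1 hα2 hx hs hp' hk₁ hk₂ hk₃ hk₄ rfl rfl hA₀ hA₁ hB rfl rfl rfl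
end
end

section
/- Let N ≥ 3, 0 ≤ α < 2, p > 1, ε > 0, and set γ = (α−2)(p−1). Then for every nonnegative u ∈ C_c^∞(ℝ^N; ℝ): ∫_{ℝ^N} |x|^α W_ε^{p−1} u^{p−2} |∇u|² dx ≥ ∫_{ℝ^N} [ ((α+N−2)/p)² |x|^{α−2} W_ε^{−1} − (γ²/p²) |x|^{2−α} W_ε + (2γ/p²)( N − α + p(α−2) |x|^{2−α} W_ε ) + (2γα/p²) ] W_ε^p u^p dx, where the integrand on the left is understood to vanish at points where u vanishes. -/
open MeasureTheory Real

noncomputable section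

/-- The `i`-th partial derivative of a real-valued function on `ℝ^N`. -/
def pdR {N : ℕ} (i : Fin N) (f : EuclideanSpace ℝ (Fin N) → ℝ)
    (x : EuclideanSpace ℝ (Fin N)) : ℝ :=
  fderiv ℝ f x (EuclideanSpace.single i 1)

lemma fderiv_self_eq_sum {N : ℕ} (F : EuclideanSpace ℝ (Fin N) → ℝ)
    (x : EuclideanSpace ℝ (Fin N)) :
    fderiv ℝ F x x = ∑ i, fderiv ℝ F x (EuclideanSpace.single i 1) * x i := by
  conv_lhs => enter [2]; rw [← (EuclideanSpace.basisFun (Fin N) ℝ).sum_repr x]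
  simp [mul_comm]

open Filter Topology in
/-- The divergence theorem for the vector field `x ↦ F x • x`. -/
lemma integral_div_smul_self {N : ℕ} {F : EuclideanSpace ℝ (Fin N) → ℝ}
    (hF : ContDiff ℝ 1 F) (hFs : HasCompactSupport F) :
    ∫ x, ((N : ℝ) * F x + fderiv ℝ F x x) = 0 := by
  have hFc : Continuous F := hF.continuous
  have hdF : Continuous (fderiv ℝ F) := hF.continuous_fderiv (by simp)
  have hFd : Differentiable ℝ F := hF.differentiable (by simp)
  have hFi : Integrable F := hFc.integrable_of_hasCompactSupport hFs
  have hproj (i : Fin N) (x : EuclideanSpace ℝ (Fin N)) :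
      HasFDerivAt (fun x : EuclideanSpace ℝ (Fin N) => x i)
        (EuclideanSpace.proj i : EuclideanSpace ℝ (Fin N) →L[ℝ] ℝ) x :=
    (EuclideanSpace.proj i : EuclideanSpace ℝ (Fin N) →L[ℝ] ℝ).hasFDerivAt
  have hint (i : Fin N) :
      Integrable fun x => fderiv ℝ F x (EuclideanSpace.single i 1) * x i := by
    refine Continuous.integrable_of_hasCompactSupport (by fun_prop) ?_
    refine (hFs.fderiv_apply ℝ (EuclideanSpace.single i 1)).mul_right
  have hone (i : Fin N) (x : EuclideanSpace ℝ (Fin N)) :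
      fderiv ℝ (fun x : EuclideanSpace ℝ (Fin N) => x i) x (EuclideanSpace.single i 1) = 1 := by
    rw [(hproj i x).fderiv]; simp
  have hparts (i : Fin N) :
      ∫ x, F x = - ∫ x, fderiv ℝ F x (EuclideanSpace.single i 1) * x i := by
    have := integral_mul_fderiv_eq_neg_fderiv_mul_of_integrable (μ := volume) (f := F)
      (g := fun x : EuclideanSpace ℝ (Fin N) => x i) (v := EuclideanSpace.single i 1)
      (hint i) (by simpa only [hone, mul_one] using hFi)
      (Continuous.integrable_of_hasCompactSupport (by fun_prop) hFs.mul_right)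
      (fun x _ => hFd x) (fun x _ => (hproj i x).differentiableAt)
    simpa only [hone, mul_one] using this
  simp_rw [fderiv_self_eq_sum]
  rw [integral_add (hFi.const_mul _) (integrable_finsetSum _ fun i _ => hint i),
    integral_const_mul, integral_finsetSum _ fun i _ => hint i]
  have : ∀ i, ∫ x, fderiv ℝ F x (EuclideanSpace.single i 1) * x i = -∫ x, F x := fun i => by
    rw [hparts i, neg_neg]
  simp [this]

lemma integrable_indicator_closedBall_inv_sq {N : ℕ} (hN : 3 ≤ N) (C R : ℝ) :
    Integrable ((Metric.closedBall (0 : EuclideanSpace ℝ (Fin N)) R).indicator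
      fun x => C * (1 / ‖x‖ ^ 2 + 1)) := by
  rw [integrable_indicator_iff measurableSet_closedBall]
  refine IntegrableOn.mono_set (t := Metric.ball 0 (R + 1)) ?_
    (Metric.closedBall_subset_ball (by linarith))
  refine Integrable.const_mul (Integrable.add ?_ ?_) _
  · refine integrableOn_ball_of_norm_le_rpow (C := 1) (α := 2) (by simp; omega) ?_ ?_ ?_
    · simp only [finrank_euclideanSpace, Fintype.card_fin]
      exact_mod_cast (by omega : 2 < N)
    · refine ae_of_all _ fun x => ?_
      rw [Real.rpow_neg (norm_nonneg _), Real.rpow_two, one_mul, Real.norm_of_nonneg (by positivity),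
        one_div]
    · exact (by fun_prop : Measurable fun x : EuclideanSpace ℝ (Fin N) => 1 / ‖x‖ ^ 2).aestronglyMeasurable
  · exact integrableOn_const (by exact measure_ball_lt_top.ne)

open Filter Topology in
/-- The divergence theorem for a vector field `x ↦ f x * ψ (‖x‖ ^ 2) • x` which is allowed to be
singular at the origin. -/
lemma integral_div_radial {N : ℕ} (hN : 3 ≤ N) {ψ ψ' : ℝ → ℝ}
    (hψ : ∀ s > 0, HasDerivAt ψ (ψ' s) s) (hψc : ContDiffOn ℝ 1 ψ (Set.Ioi 0))
    (hψ' : ContinuousOn ψ' (Set.Ioi 0)) {K : ℝ}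
    (hK : ∀ s > 0, |ψ s| ≤ K * (1 / s + 1)) (hK' : ∀ s > 0, |s * ψ' s| ≤ K * (1 / s + 1))
    {f : EuclideanSpace ℝ (Fin N) → ℝ} (hf : ContDiff ℝ 1 f) (hfs : HasCompactSupport f) :
    Integrable (fun x => (N * ψ (‖x‖ ^ 2) + 2 * (‖x‖ ^ 2 * ψ' (‖x‖ ^ 2))) * f x
        + ψ (‖x‖ ^ 2) * fderiv ℝ f x x) ∧
      ∫ x, ((N * ψ (‖x‖ ^ 2) + 2 * (‖x‖ ^ 2 * ψ' (‖x‖ ^ 2))) * f x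
        + ψ (‖x‖ ^ 2) * fderiv ℝ f x x) = 0 := by
  set H : EuclideanSpace ℝ (Fin N) → ℝ → ℝ := fun x s =>
    (N * ψ s + 2 * (‖x‖ ^ 2 * ψ' s)) * f x + ψ s * fderiv ℝ f x x with hHdef
  have hK0 : 0 ≤ K := by
    have := (abs_nonneg _).trans (hK 1 one_pos)
    linarith
  have hfd : Differentiable ℝ f := hf.differentiable (by simp)
  have hdf : Continuous (fderiv ℝ f) := hf.continuous_fderiv (by simp)
  have hreg (δ : ℝ) (hδ : 0 < δ) :
      Continuous (fun x => H x (‖x‖ ^ 2 + δ)) ∧ ∫ x, H x (‖x‖ ^ 2 + δ) = 0 := by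
    have hpos (x : EuclideanSpace ℝ (Fin N)) : 0 < ‖x‖ ^ 2 + δ := by positivity
    have hq : ContDiff ℝ 1 fun x : EuclideanSpace ℝ (Fin N) => ‖x‖ ^ 2 + δ :=
      (contDiff_norm_sq ℝ).add contDiff_const
    have hφ : ContDiff ℝ 1 fun x : EuclideanSpace ℝ (Fin N) => ψ (‖x‖ ^ 2 + δ) := by
      rw [← contDiffOn_univ]
      exact hψc.comp hq.contDiffOn fun x _ => hpos x
    have hF : ContDiff ℝ 1 fun x => ψ (‖x‖ ^ 2 + δ) * f x := hφ.mul hf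
    have hFs : HasCompactSupport fun x => ψ (‖x‖ ^ 2 + δ) * f x := hfs.mul_left
    have heq (x : EuclideanSpace ℝ (Fin N)) : H x (‖x‖ ^ 2 + δ) =
        N * (ψ (‖x‖ ^ 2 + δ) * f x) + fderiv ℝ (fun x => ψ (‖x‖ ^ 2 + δ) * f x) x x := by
      have h1 := ((hasStrictFDerivAt_norm_sq x).hasFDerivAt).add_const δ
      have h2 := (hψ _ (hpos x)).comp_hasFDerivAt x h1
      have h3 := h2.mul (hfd x).hasFDerivAt
      have h4 : fderiv ℝ (fun x => ψ (‖x‖ ^ 2 + δ) * f x) x x = _ :=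
        congrArg (fun L => L x) h3.fderiv
      rw [h4]
      simp [hHdef]
      ring
    simp_rw [heq]
    refine ⟨?_, integral_div_smul_self hF hFs⟩
    have := hF.continuous
    have := hF.continuous_fderiv (by simp)
    fun_prop
  obtain ⟨M₁, hM₁⟩ := hfs.exists_bound_of_continuous hf.continuous
  have hgs : HasCompactSupport fun x => fderiv ℝ f x x := by
    refine (hfs.fderiv ℝ).mono fun x hx => ?_
    contrapose! hx
    simp [Function.notMem_support.mp hx]
  obtain ⟨M₂, hM₂⟩ := hgs.exists_bound_of_continuous (by fun_prop)
  obtain ⟨R, hR⟩ := hfs.isCompact.isBounded.subset_closedBall 0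
  set C := K * ((N + 2) * M₁ + M₂)
  have hbound (x : EuclideanSpace ℝ (Fin N)) (hx : x ≠ 0) (δ : ℝ) (hδ : 0 ≤ δ) :
      ‖H x (‖x‖ ^ 2 + δ)‖ ≤
        (Metric.closedBall 0 R).indicator (fun x => C * (1 / ‖x‖ ^ 2 + 1)) x := by
    by_cases hxR : x ∈ Metric.closedBall (0 : EuclideanSpace ℝ (Fin N)) R
    · rw [Set.indicator_of_mem hxR]
      have hr : 0 < ‖x‖ ^ 2 := by positivity
      set s := ‖x‖ ^ 2 + δ
      have hs : 0 < s := by positivity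
      have hsr : ‖x‖ ^ 2 ≤ s := by simp [s, hδ]
      set B := K * (1 / ‖x‖ ^ 2 + 1)
      have hsB : K * (1 / s + 1) ≤ B := by simp only [B]; gcongr
      have h1 : |ψ s| ≤ B := (hK s hs).trans hsB
      have h2 : |‖x‖ ^ 2 * ψ' s| ≤ B := by
        refine le_trans ?_ ((hK' s hs).trans hsB)
        rw [abs_mul, abs_mul, abs_of_pos hr, abs_of_pos hs]
        gcongr
      have h3 := hM₁ x
      have h4 := hM₂ x
      rw [Real.norm_eq_abs] at h3 h4 ⊢
      have hB : 0 ≤ B := (abs_nonneg _).trans h1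
      calc |H x s| ≤ (N * |ψ s| + 2 * |‖x‖ ^ 2 * ψ' s|) * |f x| + |ψ s| * |fderiv ℝ f x x| := by
            refine (abs_add_le _ _).trans ?_
            rw [abs_mul, abs_mul]
            gcongr
            refine (abs_add_le _ _).trans ?_
            rw [abs_mul, abs_mul]
            simp
        _ ≤ (N * B + 2 * B) * M₁ + B * M₂ := by gcongr
        _ = C * (1 / ‖x‖ ^ 2 + 1) := by simp only [B, C]; ring
    · rw [Set.indicator_of_notMem hxR]
      have hxt : x ∉ tsupport f := fun h => hxR (hR h)
      simp [hHdef, image_eq_zero_of_notMem_tsupport hxt, fderiv_of_notMem_tsupport ℝ hxt]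
  have : Nontrivial (EuclideanSpace ℝ (Fin N)) :=
    Module.nontrivial_of_finrank_pos (R := ℝ) (by simp; omega)
  have hne : ∀ᵐ x : EuclideanSpace ℝ (Fin N), x ≠ 0 := by
    simp [ae_iff]
  have hlim : ∀ᵐ x : EuclideanSpace ℝ (Fin N),
      Tendsto (fun n : ℕ => H x (‖x‖ ^ 2 + 1 / ((n : ℝ) + 1))) atTop (𝓝 (H x (‖x‖ ^ 2))) := by
    filter_upwards [hne] with x hx
    have hr : 0 < ‖x‖ ^ 2 := by positivity
    have hc : ContinuousAt (H x) (‖x‖ ^ 2) := by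
      have h1 : ContinuousAt ψ (‖x‖ ^ 2) := (hψ _ hr).continuousAt
      have h2 : ContinuousAt ψ' (‖x‖ ^ 2) := hψ'.continuousAt (Ioi_mem_nhds hr)
      fun_prop
    refine hc.tendsto.comp ?_
    simpa using tendsto_const_nhds.add (tendsto_one_div_add_atTop_nhds_zero_nat (𝕜 := ℝ))
  have hmeas (n : ℕ) : AEStronglyMeasurable (fun x => H x (‖x‖ ^ 2 + 1 / ((n : ℝ) + 1))) volume :=
    (hreg _ (by positivity)).1.aestronglyMeasurable
  have hg := integrable_indicator_closedBall_inv_sq hN C R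
  refine ⟨hg.mono' (aestronglyMeasurable_of_tendsto_ae atTop hmeas hlim) ?_, ?_⟩
  · filter_upwards [hne] with x hx
    simpa using hbound x hx 0 le_rfl
  · have := tendsto_integral_of_dominated_convergence _ hmeas hg
      (fun n => by filter_upwards [hne] with x hx using hbound x hx _ (by positivity)) hlim
    simp_rw [fun n : ℕ => (hreg (1 / ((n : ℝ) + 1)) (by positivity)).2] at this
    exact (tendsto_nhds_unique tendsto_const_nhds this).symm

/-- The profile `s ↦ a w(s)^p + c s^(-b) w(s)^(p-1)`, where `w(s) = (s^b + ε)⁻¹`. -/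
def yosidaProfile (a c b ε p s : ℝ) : ℝ :=
  a * (s ^ b + ε)⁻¹ ^ p + c * (s ^ (-b) * (s ^ b + ε)⁻¹ ^ (p - 1))

/-- The logarithmic derivative `s ↦ s ψ'(s)` of `ψ = yosidaProfile a c b ε p`. -/
def yosidaProfileLogDeriv (a c b ε p s : ℝ) : ℝ :=
  -(b * (a * p * (s ^ b * (s ^ b + ε)⁻¹ ^ (p + 1)) + c * (s ^ (-b) * (s ^ b + ε)⁻¹ ^ (p - 1))
    + c * (p - 1) * (s ^ b + ε)⁻¹ ^ p))

lemma hasDerivAt_yosidaProfile {a c b ε p s : ℝ} (hε : 0 < ε) (hs : 0 < s) :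
    HasDerivAt (yosidaProfile a c b ε p) (s⁻¹ * yosidaProfileLogDeriv a c b ε p s) s := by
  have hT : 0 < s ^ b := Real.rpow_pos_of_pos hs b
  have hD : 0 < s ^ b + ε := by positivity
  have hw : 0 < (s ^ b + ε)⁻¹ := by positivity
  have h1 := Real.hasDerivAt_rpow_const (p := b) (Or.inl hs.ne')
  have h2 : HasDerivAt (fun s : ℝ => (s ^ b + ε)⁻¹) _ s := (h1.add_const ε).inv hD.ne'
  have h3 := h2.rpow_const (p := p) (Or.inl hw.ne')
  have h4 := h2.rpow_const (p := p - 1) (Or.inl hw.ne')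
  have h5 := Real.hasDerivAt_rpow_const (p := -b) (Or.inl hs.ne')
  have h6 := (h3.const_mul a).add ((h5.mul h4).const_mul c)
  refine HasDerivAt.congr_deriv (f := yosidaProfile a c b ε p) h6 ?_
  have e1 : s ^ (b - 1) = s ^ b / s := by rw [Real.rpow_sub_one hs.ne']
  have e2 : s ^ (-b - 1) = (s ^ b)⁻¹ / s := by
    rw [Real.rpow_sub_one hs.ne', Real.rpow_neg hs.le]
  rw [yosidaProfileLogDeriv, e1, e2, Real.rpow_neg hs.le, Real.rpow_add_one hw.ne',
    Real.rpow_sub_one hw.ne' (p - 1), Real.rpow_sub_one hw.ne' p, div_eq_mul_inv _ (_ ^ 2),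
    ← inv_pow]
  generalize (s ^ b + ε)⁻¹ = w at hw ⊢
  field_simp
  ring

lemma contDiffOn_yosidaProfile {a c b ε p : ℝ} (hε : 0 < ε) :
    ContDiffOn ℝ 1 (yosidaProfile a c b ε p) (Set.Ioi 0) := by
  have hb (q : ℝ) : ContDiffOn ℝ 1 (fun s : ℝ => s ^ q) (Set.Ioi 0) :=
    contDiffOn_id.rpow_const_of_ne fun s hs => ne_of_gt hs
  have hD : ∀ s ∈ Set.Ioi (0 : ℝ), s ^ b + ε ≠ 0 := fun s hs =>
    (add_pos (Real.rpow_pos_of_pos hs b) hε).ne'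
  have hw (q : ℝ) : ContDiffOn ℝ 1 (fun s : ℝ => (s ^ b + ε)⁻¹ ^ q) (Set.Ioi 0) :=
    (((hb b).add contDiffOn_const).inv hD).rpow_const_of_ne fun s hs => inv_ne_zero (hD s hs)
  exact (contDiffOn_const.mul (hw p)).add (contDiffOn_const.mul ((hb (-b)).mul (hw (p - 1))))

lemma continuousOn_yosidaProfileLogDeriv {a c b ε p : ℝ} (hε : 0 < ε) :
    ContinuousOn (yosidaProfileLogDeriv a c b ε p) (Set.Ioi 0) := by
  have hb (q : ℝ) : ContinuousOn (fun s : ℝ => s ^ q) (Set.Ioi 0) :=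
    continuousOn_id.rpow_const fun s hs => Or.inl (ne_of_gt hs)
  have hD : ∀ s ∈ Set.Ioi (0 : ℝ), s ^ b + ε ≠ 0 := fun s hs =>
    (add_pos (Real.rpow_pos_of_pos hs b) hε).ne'
  have hw (q : ℝ) : ContinuousOn (fun s : ℝ => (s ^ b + ε)⁻¹ ^ q) (Set.Ioi 0) :=
    (((hb b).add continuousOn_const).inv₀ hD).rpow_const fun s hs =>
      Or.inl (inv_ne_zero (hD s hs))
  have h1 := hb b
  have h2 := hb (-b)
  have h3 := hw p
  have h4 := hw (p - 1)
  have h5 := hw (p + 1)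
  unfold yosidaProfileLogDeriv
  fun_prop

lemma rpow_neg_le_one_div_add_one {b s : ℝ} (hb0 : 0 ≤ b) (hb1 : b ≤ 1) (hs : 0 < s) :
    s ^ (-b) ≤ 1 / s + 1 := by
  have h1 : 0 < 1 / s := by positivity
  rcases le_total s 1 with h | h
  · have : s ^ (-b) ≤ s ^ (-1 : ℝ) := Real.rpow_le_rpow_of_exponent_ge hs h (by linarith)
    rw [Real.rpow_neg_one, ← one_div] at this
    linarith
  · have := Real.rpow_le_one_of_one_le_of_nonpos h (neg_nonpos.mpr hb0)
    linarith

lemma exists_yosidaProfile_bound {a c b ε p : ℝ} (hb0 : 0 ≤ b) (hb1 : b ≤ 1) (hε : 0 < ε)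
    (hp : 1 ≤ p) :
    ∃ K, ∀ s > 0, |yosidaProfile a c b ε p s| ≤ K * (1 / s + 1) ∧
      |yosidaProfileLogDeriv a c b ε p s| ≤ K * (1 / s + 1) := by
  set P := ε⁻¹ ^ p
  set Q := ε⁻¹ ^ (p - 1)
  have hP : 0 ≤ P := by positivity
  have hQ : 0 ≤ Q := by positivity
  refine ⟨(|a| * P + |c| * Q) + b * (|a| * p * P + |c| * Q + |c| * (p - 1) * P), fun s hs => ?_⟩
  have hp1 : 0 ≤ p - 1 := by linarith
  have hT : 0 < s ^ b := Real.rpow_pos_of_pos hs b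
  set w := (s ^ b + ε)⁻¹
  have hw : 0 < w := by positivity
  have hwε : w ≤ ε⁻¹ := inv_anti₀ hε (by linarith)
  have hwP : w ^ p ≤ P := Real.rpow_le_rpow hw.le hwε (by linarith)
  have hwQ : w ^ (p - 1) ≤ Q := Real.rpow_le_rpow hw.le hwε hp1
  have hTw : s ^ b * w ≤ 1 := by
    rw [← div_eq_mul_inv, div_le_one (by positivity)]; linarith
  have hwp1 : s ^ b * w ^ (p + 1) ≤ P := by
    rw [Real.rpow_add_one hw.ne']
    calc s ^ b * (w ^ p * w) = (s ^ b * w) * w ^ p := by ring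
      _ ≤ 1 * P := by gcongr
      _ = P := one_mul P
  have hsb := rpow_neg_le_one_div_add_one hb0 hb1 hs
  have hsb0 : 0 < s ^ (-b) := Real.rpow_pos_of_pos hs _
  set Z := 1 / s + 1
  have hZ : 1 ≤ Z := by simp only [Z]; linarith [one_div_pos.mpr hs]
  have hPZ : P ≤ P * Z := le_mul_of_one_le_right hP hZ
  have hsw : s ^ (-b) * w ^ (p - 1) ≤ Q * Z := by rw [mul_comm Q]; gcongr
  have h1 : |yosidaProfile a c b ε p s| ≤ (|a| * P + |c| * Q) * Z := by
    calc |yosidaProfile a c b ε p s| ≤ |a| * w ^ p + |c| * (s ^ (-b) * w ^ (p - 1)) := by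
          refine (abs_add_le _ _).trans_eq ?_
          rw [abs_mul, abs_mul, abs_of_nonneg (by positivity : 0 ≤ w ^ p),
            abs_of_nonneg (by positivity : 0 ≤ s ^ (-b) * w ^ (p - 1))]
      _ ≤ |a| * (P * Z) + |c| * (Q * Z) := by gcongr; exact hwP.trans hPZ
      _ = _ := by ring
  have h2 : |yosidaProfileLogDeriv a c b ε p s| ≤
      b * (|a| * p * P + |c| * Q + |c| * (p - 1) * P) * Z := by
    calc |yosidaProfileLogDeriv a c b ε p s| ≤ b * (|a| * p * (s ^ b * w ^ (p + 1))
            + |c| * (s ^ (-b) * w ^ (p - 1)) + |c| * (p - 1) * w ^ p) := by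
          rw [yosidaProfileLogDeriv, abs_neg, abs_mul, abs_of_nonneg hb0]
          gcongr
          refine (abs_add_three _ _ _).trans_eq ?_
          simp only [abs_mul]
          rw [abs_of_nonneg hp1, abs_of_nonneg (by linarith : 0 ≤ p), abs_of_pos hT,
            abs_of_pos hsb0, abs_of_pos (Real.rpow_pos_of_pos hw p),
            abs_of_pos (Real.rpow_pos_of_pos hw (p + 1)),
            abs_of_pos (Real.rpow_pos_of_pos hw (p - 1))]
      _ ≤ b * (|a| * p * (P * Z) + |c| * (Q * Z) + |c| * (p - 1) * (P * Z)) := by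
          have := hwp1.trans hPZ
          have := hwP.trans hPZ
          gcongr
      _ = _ := by ring
  have h3 : 0 ≤ (|a| * P + |c| * Q) * Z := (abs_nonneg _).trans h1
  have h4 := (abs_nonneg _).trans h2
  constructor <;> linarith

/-- A nonnegative function with Lipschitz derivative controls the square of its derivative. -/
lemma sq_fderiv_apply_le {E : Type*} [NormedAddCommGroup E] [NormedSpace ℝ E] {u : E → ℝ}
    (hu : Differentiable ℝ u) {L : NNReal} (hL : LipschitzWith L (fderiv ℝ u))
    (hu0 : ∀ x, 0 ≤ u x) (x v : E) :
    fderiv ℝ u x v ^ 2 ≤ 4 * (L * ‖v‖ ^ 2) * u x := by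
  have hquad (t : ℝ) : 0 ≤ (L * ‖v‖ ^ 2) * (t * t) + fderiv ℝ u x v * t + u x := by
    have h1 := (convex_segment x (x + t • v)).norm_image_sub_le_of_norm_fderiv_le' (𝕜 := ℝ)
      (f := u) (φ := fderiv ℝ u x) (C := L * ‖t • v‖) (fun y _ => hu y)
      (fun y hy => by
        refine (hL.norm_sub_le y x).trans ?_
        gcongr
        simpa using norm_sub_le_of_mem_segment hy)
      (left_mem_segment ℝ _ _) (right_mem_segment ℝ _ _)
    have h2 := (le_abs_self _).trans h1
    have h3 := hu0 (x + t • v)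
    simp only [add_sub_cancel_left, map_smul, smul_eq_mul, norm_smul, Real.norm_eq_abs] at h2
    have h4 : (L : ℝ) * (|t| * ‖v‖) * (|t| * ‖v‖) = (L * ‖v‖ ^ 2) * (t * t) := by
      rw [← abs_mul_abs_self t]; ring
    linarith
  have := discrim_le_zero hquad
  rw [discrim] at this
  linarith

/-- The pointwise completion of the square behind the weighted Hardy inequality: `P` plays the
role of `|∇u|²`, `X` of `x · ∇u`, `T` of `|x|^(2-α)`, `U` of `u^(p-2)` and `V` of `W^(p-1)`. -/
lemma weighted_hardy_pointwise {n α p r2 T V W U v P X : ℝ} (hp : 0 < p) (hr2 : 0 < r2)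
    (hT : 0 < T) (hV : 0 < V) (hW : 0 < W) (hU : 0 < U)
    (hsq : ∀ h : ℝ, 0 ≤ P + 2 * h * X + h ^ 2 * r2) :
    0 ≤ r2 * T⁻¹ * V * U * P
      - (((α + n - 2) / p) ^ 2 * T⁻¹ * W⁻¹
        - ((α - 2) * (p - 1)) ^ 2 / p ^ 2 * T * W
        + 2 * ((α - 2) * (p - 1)) / p ^ 2 * (n - α + p * (α - 2) * T * W)
        + 2 * ((α - 2) * (p - 1)) * α / p ^ 2) * (V * W) * (U * v * v)
      + 2 / p * ((n * ((α - 2) * (p - 1) / p * (V * W) + (α + n - 2) / p * (T⁻¹ * V))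
        + 2 * -((2 - α) / 2 * ((α - 2) * (p - 1) / p * p * (T * (V * W * W))
          + (α + n - 2) / p * (T⁻¹ * V) + (α + n - 2) / p * (p - 1) * (V * W)))) * (U * v * v)
        + ((α - 2) * (p - 1) / p * (V * W) + (α + n - 2) / p * (T⁻¹ * V)) * (p * (U * v) * X)) := by
  have h1 := hsq (((α - 2) * (p - 1) / p * T * W + (α + n - 2) / p) / r2 * v)
  have h2 : 0 ≤ r2 * T⁻¹ * V * U := by positivity
  refine (mul_nonneg h2 h1).trans_eq ?_
  field_simp
  ring

lemma integrable_weighted_energy {N : ℕ} {α p ε : ℝ} (hα0 : 0 ≤ α) (hα2 : α < 2) (hp : 1 < p)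
    (hε : 0 < ε) {u : EuclideanSpace ℝ (Fin N) → ℝ} (hu : ContDiff ℝ (⊤ : ℕ∞) u)
    (hus : HasCompactSupport u) (hupos : ∀ x, 0 ≤ u x) :
    Integrable fun x => if u x = 0 then 0 else
      ‖x‖ ^ α * Weps α ε x ^ (p - 1) * u x ^ (p - 2) * ∑ i, pdR i u x ^ 2 := by
  have hW (x : EuclideanSpace ℝ (Fin N)) : 0 < Weps α ε x := by unfold Weps; positivity
  have huc : Continuous u := hu.continuous
  have hdu : ContDiff ℝ 1 (fderiv ℝ u) :=
    hu.fderiv_right (m := 1) (by norm_cast)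
  have hduc : Continuous (fderiv ℝ u) := hdu.continuous
  obtain ⟨L, hL⟩ := hdu.lipschitzWith_of_hasCompactSupport (hus.fderiv ℝ) (by simp)
  have hnorm : Continuous fun x : EuclideanSpace ℝ (Fin N) => ‖x‖ ^ α :=
    continuous_norm.rpow_const fun _ => Or.inr hα0
  have hWc : Continuous fun x : EuclideanSpace ℝ (Fin N) => Weps α ε x := by
    unfold Weps
    refine continuous_const.div ((continuous_norm.rpow_const fun _ => Or.inr (by linarith)).add
      continuous_const) fun x => by positivity
  have hWpc : Continuous fun x : EuclideanSpace ℝ (Fin N) => Weps α ε x ^ (p - 1) :=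
    hWc.rpow_const fun x => Or.inl (hW x).ne'
  have hupc : Continuous fun x => u x ^ (p - 1) :=
    huc.rpow_const fun _ => Or.inr (by linarith)
  have hups : HasCompactSupport fun x => u x ^ (p - 1) :=
    hus.comp_left (g := fun t : ℝ => t ^ (p - 1)) (Real.zero_rpow (by linarith))
  have hpd (i : Fin N) : Continuous (pdR i u) := by unfold pdR; fun_prop
  have hdom : Integrable fun x =>
      4 * L * N * (‖x‖ ^ α * Weps α ε x ^ (p - 1)) * u x ^ (p - 1) :=
    Continuous.integrable_of_hasCompactSupport (by fun_prop) hups.mul_left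
  refine hdom.mono' (Measurable.aestronglyMeasurable ?_) (Filter.Eventually.of_forall fun x => ?_)
  · refine Measurable.ite (measurableSet_eq_fun huc.measurable measurable_const)
      measurable_const ?_
    have := huc.measurable
    have := fun i => (hpd i).measurable
    have := hnorm.measurable
    have := hWpc.measurable
    fun_prop
  · have hWx := hW x
    have hux := hupos x
    split_ifs with h0
    · simp only [norm_zero]; positivity
    have hux' : 0 < u x := lt_of_le_of_ne hux (Ne.symm h0)
    have hS : ∑ i, pdR i u x ^ 2 ≤ 4 * L * N * u x := by
      calc ∑ i, pdR i u x ^ 2 ≤ ∑ _i : Fin N, 4 * L * u x := by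
            refine Finset.sum_le_sum fun i _ => ?_
            simpa [pdR] using sq_fderiv_apply_le (hu.differentiable (by simp)) hL hupos x
              (EuclideanSpace.single i 1)
        _ = 4 * L * N * u x := by simp; ring
    have hup : u x ^ (p - 1) = u x ^ (p - 2) * u x := by
      rw [← Real.rpow_add_one h0]; congr 1; ring
    rw [Real.norm_of_nonneg (by positivity), hup]
    calc _ ≤ ‖x‖ ^ α * Weps α ε x ^ (p - 1) * u x ^ (p - 2) * (4 * L * N * u x) := by gcongr
      _ = _ := by ring

theorem stmt10 (N : ℕ) (hN : 3 ≤ N) (α : ℝ) (hα0 : 0 ≤ α) (hα2 : α < 2)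
    (p : ℝ) (hp : 1 < p) (ε : ℝ) (hε : 0 < ε) (γ : ℝ) (hγ : γ = (α - 2) * (p - 1))
    (u : EuclideanSpace ℝ (Fin N) → ℝ) (hu : ContDiff ℝ (⊤ : ℕ∞) u) (hus : HasCompactSupport u)
    (hupos : ∀ x, 0 ≤ u x) :
    (∫ x, if u x = 0 then 0 else
        ‖x‖ ^ α * Weps α ε x ^ (p - 1) * u x ^ (p - 2) * ∑ i, pdR i u x ^ 2) ≥
      ∫ x, (((α + (N : ℝ) - 2) / p) ^ 2 * ‖x‖ ^ (α - 2) * (Weps α ε x)⁻¹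
        - γ ^ 2 / p ^ 2 * ‖x‖ ^ (2 - α) * Weps α ε x
        + 2 * γ / p ^ 2 * ((N : ℝ) - α + p * (α - 2) * ‖x‖ ^ (2 - α) * Weps α ε x)
        + 2 * γ * α / p ^ 2) * Weps α ε x ^ p * u x ^ p := by
  subst hγ
  have hp0 : 0 < p := by linarith
  have hW (x : EuclideanSpace ℝ (Fin N)) : 0 < Weps α ε x := by unfold Weps; positivity
  set A : EuclideanSpace ℝ (Fin N) → ℝ := fun x => if u x = 0 then 0 else
    ‖x‖ ^ α * Weps α ε x ^ (p - 1) * u x ^ (p - 2) * ∑ i, pdR i u x ^ 2 with hA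
  set R : EuclideanSpace ℝ (Fin N) → ℝ := fun x =>
    (((α + (N : ℝ) - 2) / p) ^ 2 * ‖x‖ ^ (α - 2) * (Weps α ε x)⁻¹
        - ((α - 2) * (p - 1)) ^ 2 / p ^ 2 * ‖x‖ ^ (2 - α) * Weps α ε x
        + 2 * ((α - 2) * (p - 1)) / p ^ 2 *
          ((N : ℝ) - α + p * (α - 2) * ‖x‖ ^ (2 - α) * Weps α ε x)
        + 2 * ((α - 2) * (p - 1)) * α / p ^ 2) * Weps α ε x ^ p * u x ^ p with hR
  change ∫ x, R x ≤ ∫ x, A x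
  have hA0 (x : EuclideanSpace ℝ (Fin N)) : 0 ≤ A x := by
    simp only [hA]
    split_ifs
    · exact le_rfl
    · have := hupos x
      have := (hW x).le
      positivity
  by_cases hRi : Integrable R
  swap
  · rw [integral_undef hRi]
    exact integral_nonneg hA0
  have hAi : Integrable A := integrable_weighted_energy hα0 hα2 hp hε hu hus hupos
  have hf : ContDiff ℝ 1 fun x => u x ^ p := by
    have := (hu.of_le (m := ((1 : ℕ) : WithTop ℕ∞)) (by norm_cast)).rpow_const_of_le
      (p := p) (by simpa using hp.le)
    simpa using this
  have hfs : HasCompactSupport fun x => u x ^ p :=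
    hus.comp_left (g := fun t : ℝ => t ^ p) (Real.zero_rpow hp0.ne')
  set a := (α - 2) * (p - 1) / p with ha
  set c := (α + N - 2) / p with hc
  set b := (2 - α) / 2 with hb
  obtain ⟨K, hK⟩ := exists_yosidaProfile_bound (a := a) (c := c) (b := b) (by linarith)
    (by linarith) hε hp.le
  obtain ⟨hHi, hH0⟩ := integral_div_radial hN (ψ := yosidaProfile a c b ε p)
    (ψ' := fun s => s⁻¹ * yosidaProfileLogDeriv a c b ε p s)
    (fun s hs => hasDerivAt_yosidaProfile hε hs) (contDiffOn_yosidaProfile hε)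
    ((continuousOn_id.inv₀ fun s hs => ne_of_gt hs).mul (continuousOn_yosidaProfileLogDeriv hε))
    (K := K) (fun s hs => (hK s hs).1)
    (fun s hs => by rw [mul_inv_cancel_left₀ hs.ne']; exact (hK s hs).2) hf hfs
  have hsum := integral_add (f := fun x => A x - R x) (hAi.sub hRi) (hHi.const_mul (2 / p))
  rw [integral_const_mul, hH0, mul_zero, add_zero, integral_sub hAi hRi] at hsum
  rw [← sub_nonneg, ← hsum]
  have : Nontrivial (EuclideanSpace ℝ (Fin N)) :=
    Module.nontrivial_of_finrank_pos (R := ℝ) (by simp; omega)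
  have hne : ∀ᵐ x : EuclideanSpace ℝ (Fin N), x ≠ 0 := by simp [ae_iff]
  refine integral_nonneg_of_ae ?_
  filter_upwards [hne] with x hx
  have hr : 0 < ‖x‖ := norm_pos_iff.mpr hx
  have hr2 : 0 < ‖x‖ ^ 2 := by positivity
  have hud : DifferentiableAt ℝ u x := hu.differentiable (by simp) x
  have hfd : fderiv ℝ (fun x => u x ^ p) x x = p * u x ^ (p - 1) * fderiv ℝ u x x := by
    rw [(hud.hasFDerivAt.rpow_const (Or.inr hp.le)).fderiv]
    simp
  simp only [Pi.zero_apply, hfd, mul_inv_cancel_left₀ hr2.ne']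
  rcases (hupos x).eq_or_lt with h0 | h0
  · simp [hA, hR, ← h0, Real.zero_rpow hp0.ne', Real.zero_rpow (by linarith : p - 1 ≠ 0)]
  have hT : 0 < ‖x‖ ^ (2 - α) := by positivity
  have eb : (‖x‖ ^ 2) ^ b = ‖x‖ ^ (2 - α) := by
    rw [← Real.rpow_natCast_mul hr.le]
    congr 1
    simp only [hb]; push_cast; ring
  have enb : (‖x‖ ^ 2) ^ (-b) = (‖x‖ ^ (2 - α))⁻¹ := by rw [Real.rpow_neg hr2.le, eb]
  have eW : (‖x‖ ^ (2 - α) + ε)⁻¹ = Weps α ε x := by rw [Weps, one_div]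
  have eα : ‖x‖ ^ α = ‖x‖ ^ 2 * (‖x‖ ^ (2 - α))⁻¹ := by
    rw [← Real.rpow_neg hr.le, ← Real.rpow_natCast, ← Real.rpow_add hr]
    congr 1; push_cast; ring
  have eα2 : ‖x‖ ^ (α - 2) = (‖x‖ ^ (2 - α))⁻¹ := by
    rw [← Real.rpow_neg hr.le]; congr 1; ring
  have eWp : Weps α ε x ^ p = Weps α ε x ^ (p - 1) * Weps α ε x := by
    rw [← Real.rpow_add_one (hW x).ne']; congr 1; ring
  have eup1 : u x ^ (p - 1) = u x ^ (p - 2) * u x := by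
    rw [← Real.rpow_add_one h0.ne']; congr 1; ring
  have eup : u x ^ p = u x ^ (p - 2) * u x * u x := by
    rw [← eup1, ← Real.rpow_add_one h0.ne']; congr 1; ring
  have hsq (h : ℝ) : 0 ≤ (∑ i, pdR i u x ^ 2) + 2 * h * fderiv ℝ u x x + h ^ 2 * ‖x‖ ^ 2 := by
    have : (∑ i, pdR i u x ^ 2) + 2 * h * fderiv ℝ u x x + h ^ 2 * ‖x‖ ^ 2
        = ∑ i, (pdR i u x + h * x i) ^ 2 := by
      rw [fderiv_self_eq_sum, EuclideanSpace.real_norm_sq_eq, Finset.mul_sum, Finset.mul_sum,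
        ← Finset.sum_add_distrib, ← Finset.sum_add_distrib]
      refine Finset.sum_congr rfl fun i _ => ?_
      rw [pdR]; ring
    rw [this]
    positivity
  have key := weighted_hardy_pointwise (n := N) (α := α) hp0 hr2 hT
    (Real.rpow_pos_of_pos (hW x) (p - 1)) (hW x) (Real.rpow_pos_of_pos h0 (p - 2)) (v := u x) hsq
  simp only [hA, hR, if_neg h0.ne', yosidaProfile, yosidaProfileLogDeriv, eb, enb, eW, eα, eα2,
    Real.rpow_add_one (hW x).ne', eWp, eup, eup1]
  exact key
end
end
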